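/- arXiv:math/9908111 — 4 statements merged into one kernel-verified Lean document; each statement's English description precedes it below -/
import Mathlib

section
/- Let (Ω₁,μ₁) and (Ω₂,μ₂) be σ-finite measure spaces, let 1 < r < ∞ with conjugate exponent r', and let 1 ≤ a, b < ∞. Let u : L^{ar}(μ₁) × L^{br'}(μ₂) → ℝ be a homogeneous form (u(c·x,y) = u(x,c·y) = c·u(x,y) for all c ≥ 0). Assume that for every n and all x₁,…,xₙ ∈ L^{ar}(μ₁) and y₁,…,yₙ ∈ L^{br'}(μ₂) one has ∑_{k≤n} |u(x_k,y_k)| ≤ ‖(∑_{k≤n} |x_k|^r)^{1/r}‖_{L^{ar}(μ₁)} · ‖(∑_{k≤n} |y_k|^{r'})^{1/r'}‖_{L^{br'}(μ₂)}. Then there exist measurable functions φ : Ω₁ → [0,∞) and ψ : Ω₂ → [0,∞) with ‖φ‖_{L^{a'}(μ₁)} ≤ 1 and ‖ψ‖_{L^{b'}(μ₂)} ≤ 1 such that for all x ∈ L^{ar}(μ₁) and y ∈ L^{br'}(μ₂), |u(x,y)| ≤ (∫ |x|^r φ dμ₁)^{1/r} · (∫ |y|^{r'} ψ dμ₂)^{1/r'}.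 -/
open MeasureTheory ENNReal
open scoped NNReal ENNReal

/-- **Mazur–Orlicz**: a sublinear functional dominating all finite sums `∑ t i` at `∑ s i`
dominates a linear functional `ℓ` with `t i ≤ ℓ (s i)`. -/
theorem exists_linearMap_le_sublinear {E ι : Type*} [AddCommGroup E] [Module ℝ E]
    (p : E → ℝ) (p_hom : ∀ c : ℝ, 0 < c → ∀ x, p (c • x) = c * p x)
    (p_add : ∀ x y, p (x + y) ≤ p x + p y) (s : ι → E) (t : ι → ℝ)
    (hscale : ∀ c : ℝ, 0 < c → ∀ i, ∃ j, s j = c • s i ∧ t j = c * t i)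
    (h : ∀ L : List ι, (L.map t).sum ≤ p (L.map s).sum) :
    ∃ ℓ : E →ₗ[ℝ] ℝ, (∀ x, ℓ x ≤ p x) ∧ ∀ i, t i ≤ ℓ (s i) := by
  have p_zero : p 0 = 0 := by
    have := p_hom 2 (by norm_num) 0
    rw [smul_zero] at this
    linarith
  let v : E → List ι → ℝ := fun x L => p (x + (L.map s).sum) - (L.map t).sum
  let q : E → ℝ := fun x => ⨅ L, v x L
  have hbdd : ∀ x, BddBelow (Set.range (v x)) := by
    refine fun x => ⟨-p (-x), ?_⟩
    rintro _ ⟨L, rfl⟩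
    have h1 := p_add (x + (L.map s).sum) (-x)
    have h2 := h L
    rw [show x + (L.map s).sum + -x = (L.map s).sum by abel] at h1
    simp only [v]
    linarith
  have hscaleL : ∀ c : ℝ, 0 < c → ∀ L : List ι, ∃ M : List ι,
      (M.map s).sum = c • (L.map s).sum ∧ (M.map t).sum = c * (L.map t).sum := by
    intro c hc L
    induction L with
    | nil => exact ⟨[], by simp⟩
    | cons i L ih =>
      obtain ⟨M, hM1, hM2⟩ := ih
      obtain ⟨j, hj1, hj2⟩ := hscale c hc i
      exact ⟨j :: M, by simp [hM1, hj1], by simp [hM2, hj2, mul_add]⟩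
  have q_le : ∀ c : ℝ, 0 < c → ∀ x, q (c • x) ≤ c * q x := by
    intro c hc x
    rw [← div_le_iff₀' hc]
    refine le_ciInf fun L => ?_
    obtain ⟨M, hM1, hM2⟩ := hscaleL c hc L
    rw [div_le_iff₀' hc]
    refine (ciInf_le (hbdd _) M).trans (le_of_eq ?_)
    simp only [v, hM1, hM2, ← smul_add, p_hom c hc]
    ring
  have q_hom : ∀ c : ℝ, 0 < c → ∀ x, q (c • x) = c * q x := by
    refine fun c hc x => (q_le c hc x).antisymm ?_
    have := q_le c⁻¹ (inv_pos.2 hc) (c • x)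
    rw [smul_smul, inv_mul_cancel₀ hc.ne', one_smul] at this
    rwa [← le_inv_mul_iff₀ hc]
  have q_add : ∀ x y, q (x + y) ≤ q x + q y := by
    intro x y
    refine le_ciInf_add_ciInf fun L M => ?_
    refine (ciInf_le (hbdd _) (L ++ M)).trans ?_
    have := p_add (x + (L.map s).sum) (y + (M.map s).sum)
    rw [add_add_add_comm] at this
    simp only [v, List.map_append, List.sum_append]
    linarith
  have q_le_v : ∀ x L, q x ≤ v x L := fun x L => ciInf_le (hbdd _) L
  have q_zero : q 0 = 0 := by
    have := q_hom 2 (by norm_num) 0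
    rw [smul_zero] at this
    linarith
  obtain ⟨g, -, hg⟩ := exists_extension_of_le_sublinear (⊥ : E →ₗ.[ℝ] ℝ) q q_hom q_add (by
    rintro ⟨x, hx⟩
    obtain rfl : x = 0 := (Submodule.mem_bot ℝ).1 hx
    have : (⊥ : E →ₗ.[ℝ] ℝ) ⟨0, hx⟩ = 0 := LinearPMap.map_zero _
    rw [this]
    exact q_zero.ge)
  refine ⟨g, fun x => (hg x).trans ((q_le_v x []).trans (by simp [v])), fun i => ?_⟩
  have := (hg (-s i)).trans (q_le_v _ [i])
  simp only [v, map_neg, List.map_cons, List.map_nil, List.sum_cons, List.sum_nil, add_zero,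
    neg_add_cancel, p_zero] at this
  linarith

/-- A finitely additive set function dominated by a power of a finite measure is a measure. -/
theorem exists_measure_of_le_rpow {Ω : Type*} [MeasurableSpace Ω] (ρ : Measure Ω)
    [IsFiniteMeasure ρ] (m : Set Ω → ℝ≥0∞) {c : ℝ} (hc : 0 < c)
    (m_le : ∀ s, MeasurableSet s → m s ≤ ρ s ^ c)
    (m_union : ∀ s t, MeasurableSet s → MeasurableSet t → Disjoint s t →
      m (s ∪ t) = m s + m t) :
    ∃ ν : Measure Ω, ∀ s, MeasurableSet s → ν s = m s := by
  have hC : IsSetRing {s : Set Ω | MeasurableSet s} :=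
    ⟨MeasurableSet.empty, fun _ _ hs ht => MeasurableSet.union hs ht,
      fun _ _ hs ht => MeasurableSet.diff hs ht⟩
  have m_empty : m ∅ = 0 := by
    have := m_le ∅ MeasurableSet.empty
    rwa [measure_empty, ENNReal.zero_rpow_of_pos hc, nonpos_iff_eq_zero] at this
  let κ : AddContent ℝ≥0∞ {s : Set Ω | MeasurableSet s} :=
    hC.addContent_of_union m m_empty fun hs ht hst => m_union _ _ hs ht hst
  refine ⟨Measure.ofMeasurable (fun s _ => m s) m_empty fun f hf hd => ?_,
    fun s hs => Measure.ofMeasurable_apply s hs⟩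
  refine addContent_iUnion_eq_sum_of_tendsto_zero hC κ (fun s hs => ?_)
    (fun s hs hanti hempty => ?_) hf (MeasurableSet.iUnion hf) hd
  · exact ((m_le s hs).trans_lt (ENNReal.rpow_lt_top_of_nonneg hc.le (measure_ne_top ρ s))).ne
  · have h0 : Filter.Tendsto (fun n => ρ (s n)) Filter.atTop (nhds 0) := by
      have := tendsto_measure_iInter_atTop (μ := ρ) (fun n => (hs n).nullMeasurableSet) hanti
        ⟨0, measure_ne_top _ _⟩
      rwa [hempty, measure_empty] at this
    have h1 := (ENNReal.continuous_rpow_const (y := c)).tendsto 0 |>.comp h0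
    rw [ENNReal.zero_rpow_of_pos hc] at h1
    exact tendsto_of_tendsto_of_tendsto_of_le_of_le tendsto_const_nhds h1
      (fun _ => zero_le) (fun n => m_le _ (hs n))

/-- A positive functional of norm at most one on `L^p(ρ)`, `ρ` finite, is dominated by
integration against a measure. -/
theorem exists_measure_of_positive_functional {Ω : Type*} [MeasurableSpace Ω] (ρ : Measure Ω)
    [IsFiniteMeasure ρ] {p : ℝ≥0∞} [Fact (1 ≤ p)] (hp : p ≠ ∞) (ℓ : Lp ℝ p ρ →ₗ[ℝ] ℝ)
    (ℓ_nonneg : ∀ F, 0 ≤ F → 0 ≤ ℓ F) (ℓ_le : ∀ F, ℓ F ≤ ‖F‖) :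
    ∃ ν : Measure Ω, ν ≪ ρ ∧
      (∀ f : Ω → ℝ≥0∞, Measurable f → ∫⁻ ω, f ω ∂ν ≤ (∫⁻ ω, f ω ^ p.toReal ∂ρ) ^ (1 / p.toReal)) ∧
      ∀ F : Lp ℝ p ρ, ENNReal.ofReal (ℓ F) ≤ ∫⁻ ω, ENNReal.ofReal (F ω) ∂ν := by
  have hp1 : 1 ≤ p := Fact.out
  have hp0 : p ≠ 0 := (zero_lt_one.trans_le hp1).ne'
  have hpr : 0 < p.toReal := ENNReal.toReal_pos hp0 hp
  have ℓ_le_enorm : ∀ F, ENNReal.ofReal (ℓ F) ≤ eLpNorm F p ρ := fun F => by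
    rw [← Lp.enorm_def, ← ofReal_norm]
    exact ENNReal.ofReal_le_ofReal (ℓ_le F)
  have ℓ_mono : ∀ F G, F ≤ G → ℓ F ≤ ℓ G := fun F G h => by
    have := ℓ_nonneg (G - F) (sub_nonneg.2 h)
    rw [map_sub] at this
    linarith
  have ind_nonneg : ∀ s (hs : MeasurableSet s),
      0 ≤ indicatorConstLp p hs (measure_ne_top ρ s) (1 : ℝ) := fun s hs => by
    rw [← Lp.coeFn_nonneg]
    filter_upwards [indicatorConstLp_coeFn (p := p) (hs := hs) (hμs := measure_ne_top ρ s)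
      (c := (1 : ℝ))] with ω hω
    rw [hω]
    exact Set.indicator_nonneg (fun _ _ => zero_le_one) _
  classical
  let m : Set Ω → ℝ≥0∞ := fun s => if hs : MeasurableSet s then
    ENNReal.ofReal (ℓ (indicatorConstLp p hs (measure_ne_top ρ s) 1)) else 0
  have m_eq : ∀ s (hs : MeasurableSet s), m s =
    ENNReal.ofReal (ℓ (indicatorConstLp p hs (measure_ne_top ρ s) 1)) := fun s hs => by
      simp only [m, dif_pos hs]
  have m_le : ∀ s, MeasurableSet s → m s ≤ ρ s ^ (1 / p.toReal) := fun s hs => by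
    rw [m_eq s hs]
    refine (ℓ_le_enorm _).trans (le_of_eq ?_)
    rw [eLpNorm_congr_ae indicatorConstLp_coeFn, eLpNorm_indicator_const hs hp0 hp]
    simp
  obtain ⟨ν, hν⟩ := exists_measure_of_le_rpow ρ m (c := 1 / p.toReal) (by positivity) m_le
    (fun s t hs ht hst => by
      rw [m_eq s hs, m_eq t ht, m_eq _ (hs.union ht),
        indicatorConstLp_disjoint_union hs ht (measure_ne_top ρ s) (measure_ne_top ρ t) hst,
        map_add, ENNReal.ofReal_add (ℓ_nonneg _ (ind_nonneg s hs)) (ℓ_nonneg _ (ind_nonneg t ht))])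
  have memLp_simple : ∀ g : SimpleFunc Ω ℝ≥0, MemLp (fun ω => (g ω : ℝ)) p ρ := fun g =>
    (g.map ((↑) : ℝ≥0 → ℝ)).memLp_of_isFiniteMeasure p ρ
  have simple_nonneg : ∀ g : SimpleFunc Ω ℝ≥0, 0 ≤ (memLp_simple g).toLp := fun g => by
    rw [← Lp.coeFn_nonneg]
    filter_upwards [(memLp_simple g).coeFn_toLp] with ω hω
    rw [hω]
    exact (g ω).2
  have key : ∀ g : SimpleFunc Ω ℝ≥0,
      ∫⁻ ω, g ω ∂ν = ENNReal.ofReal (ℓ (memLp_simple g).toLp) := by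
    intro g
    induction g using SimpleFunc.induction with
    | const c hs =>
      rename_i s
      have : (memLp_simple (SimpleFunc.piecewise s hs (SimpleFunc.const Ω c)
          (SimpleFunc.const Ω 0))).toLp =
          (c : ℝ) • indicatorConstLp p hs (measure_ne_top ρ s) (1 : ℝ) := by
        rw [indicatorConstLp, ← MemLp.toLp_const_smul]
        refine MemLp.toLp_congr _ _ (Filter.Eventually.of_forall fun ω => ?_)
        by_cases hω : ω ∈ s <;> simp [hω]
      rw [this, map_smul, smul_eq_mul, ENNReal.ofReal_mul (p := (c : ℝ)) c.2, ← m_eq, ← hν s hs,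
        ENNReal.ofReal_coe_nnreal, ← lintegral_indicator_const hs]
      refine lintegral_congr fun ω => ?_
      by_cases hω : ω ∈ s <;> simp [hω]
    | add hd hf hg =>
      rename_i f g
      have : (memLp_simple (f + g)).toLp = (memLp_simple f).toLp + (memLp_simple g).toLp := by
        rw [← MemLp.toLp_add]
        refine MemLp.toLp_congr _ _ (Filter.Eventually.of_forall fun ω => ?_)
        simp
      rw [this, map_add, ENNReal.ofReal_add (ℓ_nonneg _ (simple_nonneg f))
        (ℓ_nonneg _ (simple_nonneg g)), ← hf, ← hg, ← lintegral_add_left (by fun_prop)]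
      simp
  have int_le : ∀ f : Ω → ℝ≥0∞, Measurable f →
      ∫⁻ ω, f ω ∂ν ≤ (∫⁻ ω, f ω ^ p.toReal ∂ρ) ^ (1 / p.toReal) := by
    intro f _
    rw [lintegral_eq_nnreal]
    refine iSup₂_le fun g hg => ?_
    rw [← SimpleFunc.lintegral_eq_lintegral]
    simp only [SimpleFunc.map_apply]
    rw [key]
    refine (ℓ_le_enorm _).trans ?_
    rw [eLpNorm_congr_ae (memLp_simple g).coeFn_toLp,
      eLpNorm_eq_lintegral_rpow_enorm_toReal hp0 hp]
    gcongr with ω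
    simpa using hg ω
  have hac : ν ≪ ρ := by
    refine Measure.AbsolutelyContinuous.mk fun s hs h0 => ?_
    have := m_le s hs
    rwa [← hν s hs, h0, ENNReal.zero_rpow_of_pos (by positivity), nonpos_iff_eq_zero] at this
  refine ⟨ν, hac, int_le, fun F => ?_⟩
  have hF := Lp.memLp F
  refine ENNReal.le_of_forall_pos_le_add fun ε hε _ => ?_
  have hε2 : (ε / 2 : ℝ≥0∞) ≠ 0 := by simp [hε.ne']
  obtain ⟨g, hg, hgm⟩ := hF.exists_simpleFunc_eLpNorm_sub_lt hp hε2
  have h1 : ENNReal.ofReal (ℓ F) ≤ ENNReal.ofReal (ℓ hgm.toLp) + ε / 2 := by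
    have : ℓ F = ℓ hgm.toLp + ℓ (F - hgm.toLp) := by rw [map_sub]; ring
    rw [this]
    refine ENNReal.ofReal_add_le.trans ?_
    gcongr
    refine (ℓ_le_enorm _).trans (le_trans (le_of_eq ?_) hg.le)
    refine eLpNorm_congr_ae ?_
    filter_upwards [Lp.coeFn_sub F hgm.toLp, hgm.coeFn_toLp] with ω h1 h2
    rw [h1, Pi.sub_apply, h2, Pi.sub_apply]
  have h2 : ENNReal.ofReal (ℓ hgm.toLp) ≤ ∫⁻ ω, ENNReal.ofReal (g ω) ∂ν := by
    refine le_trans (ENNReal.ofReal_le_ofReal (ℓ_mono _ _ ?_)) (key (g.map Real.toNNReal)).ge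
    rw [← Lp.coeFn_le]
    filter_upwards [hgm.coeFn_toLp, (memLp_simple (g.map Real.toNNReal)).coeFn_toLp] with ω h1 h2
    rw [h1, h2]
    simp
  have h3 : ∫⁻ ω, ENNReal.ofReal (g ω) ∂ν ≤ ∫⁻ ω, ENNReal.ofReal (F ω) ∂ν + ε / 2 := by
    have hFm : AEMeasurable F ν := hF.1.aemeasurable.mono_ac hac
    calc ∫⁻ ω, ENNReal.ofReal (g ω) ∂ν
        ≤ ∫⁻ ω, ENNReal.ofReal (F ω) + ‖F ω - g ω‖ₑ ∂ν := by
          gcongr with ω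
          rw [← ofReal_norm, Real.norm_eq_abs]
          refine le_trans (ENNReal.ofReal_le_ofReal ?_) ENNReal.ofReal_add_le
          have := neg_abs_le (F ω - g ω)
          linarith
      _ = ∫⁻ ω, ENNReal.ofReal (F ω) ∂ν + ∫⁻ ω, ‖F ω - g ω‖ₑ ∂ν :=
          lintegral_add_left' hFm.ennreal_ofReal _
      _ ≤ _ := by
          gcongr
          have hm : AEMeasurable (fun ω => ‖F ω - g ω‖ₑ) ρ :=
            (hF.1.sub g.aestronglyMeasurable).enorm
          calc ∫⁻ ω, ‖F ω - g ω‖ₑ ∂ν = ∫⁻ ω, hm.mk _ ω ∂ν := lintegral_congr_ae (hac hm.ae_eq_mk)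
            _ ≤ (∫⁻ ω, hm.mk _ ω ^ p.toReal ∂ρ) ^ (1 / p.toReal) := int_le _ hm.measurable_mk
            _ = (∫⁻ ω, ‖F ω - g ω‖ₑ ^ p.toReal ∂ρ) ^ (1 / p.toReal) := by
              congr 1
              refine lintegral_congr_ae ?_
              filter_upwards [hm.ae_eq_mk] with ω hω
              rw [hω]
            _ ≤ ε / 2 := by
              rw [← eLpNorm_eq_lintegral_rpow_enorm_toReal hp0 hp]
              exact hg.le
  calc ENNReal.ofReal (ℓ F) ≤ ENNReal.ofReal (ℓ hgm.toLp) + ε / 2 := h1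
    _ ≤ (∫⁻ ω, ENNReal.ofReal (F ω) ∂ν + ε / 2) + ε / 2 := by gcongr; exact h2.trans h3
    _ = _ := by rw [add_assoc, ENNReal.add_halves]

/-- A positive functional of norm at most one on `L^p(μ)`, `p < ∞`, is dominated by integration
against a density of norm at most one in the Köthe dual. -/
theorem exists_density_of_positive_functional {Ω : Type*} [MeasurableSpace Ω] (μ : Measure Ω)
    [SigmaFinite μ] {p : ℝ≥0∞} [Fact (1 ≤ p)] (hp : p ≠ ∞) (ℓ : Lp ℝ p μ →ₗ[ℝ] ℝ)
    (ℓ_nonneg : ∀ F, 0 ≤ F → 0 ≤ ℓ F) (ℓ_le : ∀ F, ℓ F ≤ ‖F‖) :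
    ∃ ψ : Ω → ℝ≥0∞, Measurable ψ ∧
      (∀ f : Ω → ℝ≥0∞, Measurable f →
        ∫⁻ ω, f ω * ψ ω ∂μ ≤ (∫⁻ ω, f ω ^ p.toReal ∂μ) ^ (1 / p.toReal)) ∧
      ∀ F : Lp ℝ p μ, ENNReal.ofReal (ℓ F) ≤ ∫⁻ ω, ENNReal.ofReal (F ω) * ψ ω ∂μ := by
  have hp1 : 1 ≤ p := Fact.out
  have hp0 : p ≠ 0 := (zero_lt_one.trans_le hp1).ne'
  have hpr : 0 < p.toReal := ENNReal.toReal_pos hp0 hp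
  obtain ⟨g, g_pos, g_meas, g_int⟩ := exists_pos_lintegral_lt_of_sigmaFinite μ one_ne_zero
  let w : Ω → ℝ≥0 := fun ω => g ω ^ (1 / p.toReal)
  have w_pos : ∀ ω, 0 < w ω := fun ω => NNReal.rpow_pos (g_pos ω)
  have w_meas : Measurable w := g_meas.pow_const _
  have w_pow : ∀ ω, (w ω : ℝ≥0∞) ^ p.toReal = g ω := fun ω => by
    rw [← ENNReal.coe_rpow_of_nonneg _ hpr.le, ← NNReal.rpow_mul, one_div,
      inv_mul_cancel₀ hpr.ne', NNReal.rpow_one]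
  have gm : Measurable fun ω => (g ω : ℝ≥0∞) := g_meas.coe_nnreal_ennreal
  let ρ : Measure Ω := μ.withDensity fun ω => (g ω : ℝ≥0∞)
  have : IsFiniteMeasure ρ := isFiniteMeasure_withDensity (g_int.trans one_lt_top).ne
  have hρμ : ρ ≪ μ := withDensity_absolutelyContinuous _ _
  have hμρ : μ ≪ ρ := withDensity_absolutelyContinuous' gm.aemeasurable
    (Filter.Eventually.of_forall fun ω => by simpa using (g_pos ω).ne')
  have int_ρ : ∀ f : Ω → ℝ≥0∞, ∫⁻ ω, f ω ∂ρ = ∫⁻ ω, g ω * f ω ∂μ := fun f =>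
    lintegral_withDensity_eq_lintegral_mul_non_measurable μ gm
      (Filter.Eventually.of_forall fun ω => coe_lt_top) f
  have norm_eq : ∀ h : Ω → ℝ, eLpNorm (fun ω => (w ω : ℝ) * h ω) p μ = eLpNorm h p ρ := fun h => by
    rw [eLpNorm_eq_lintegral_rpow_enorm_toReal hp0 hp, eLpNorm_eq_lintegral_rpow_enorm_toReal hp0 hp,
      int_ρ]
    congr 1
    refine lintegral_congr fun ω => ?_
    rw [enorm_mul, ENNReal.mul_rpow_of_nonneg _ _ hpr.le, ← w_pow]
    simp
  have memLp_mul : ∀ h : Ω → ℝ, MemLp h p ρ → MemLp (fun ω => (w ω : ℝ) * h ω) p μ := fun h hh =>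
    ⟨w_meas.coe_nnreal_real.aestronglyMeasurable.mul (hh.1.mono_ac hμρ), by
      rw [norm_eq]; exact hh.2⟩
  let J : Lp ℝ p ρ →ₗ[ℝ] Lp ℝ p μ :=
    { toFun := fun h => (memLp_mul h (Lp.memLp h)).toLp
      map_add' := fun h k => by
        rw [← MemLp.toLp_add]
        refine MemLp.toLp_congr _ _ ?_
        filter_upwards [hμρ (Lp.coeFn_add h k)] with ω hω
        simp only [hω, Pi.add_apply, mul_add]
      map_smul' := fun c h => by
        rw [RingHom.id_apply, ← MemLp.toLp_const_smul]
        refine MemLp.toLp_congr _ _ ?_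
        filter_upwards [hμρ (Lp.coeFn_smul c h)] with ω hω
        simp only [hω, Pi.smul_apply, smul_eq_mul]
        ring }
  have J_coe : ∀ h : Lp ℝ p ρ, J h =ᵐ[μ] fun ω => (w ω : ℝ) * h ω := fun h =>
    MemLp.coeFn_toLp (memLp_mul h (Lp.memLp h))
  obtain ⟨ν, hνρ, ν_le, ν_ge⟩ := exists_measure_of_positive_functional ρ hp (ℓ ∘ₗ J)
    (fun h hh => ℓ_nonneg _ (by
      rw [← Lp.coeFn_nonneg] at hh ⊢
      filter_upwards [hμρ hh, J_coe h] with ω h1 h2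
      rw [h2]
      exact mul_nonneg (w ω).2 h1))
    (fun h => (ℓ_le _).trans (le_of_eq (by
      rw [Lp.norm_def, Lp.norm_def, eLpNorm_congr_ae (J_coe h), norm_eq])))
  have : IsFiniteMeasure ν := ⟨by
    have := ν_le (fun _ => 1) measurable_const
    simp only [ENNReal.one_rpow, lintegral_one] at this
    exact this.trans_lt (ENNReal.rpow_lt_top_of_nonneg (by positivity) (measure_ne_top ρ _))⟩
  have hνμ : ν ≪ μ := hνρ.trans hρμ
  have w_ne : ∀ ω, (w ω : ℝ≥0∞) ≠ 0 := fun ω => by simpa using (w_pos ω).ne'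
  have int_ν : ∀ f : Ω → ℝ≥0∞, AEMeasurable f μ →
      ∫⁻ ω, f ω * (ν.rnDeriv μ ω * (w ω : ℝ≥0∞)⁻¹) ∂μ = ∫⁻ ω, f ω * (w ω : ℝ≥0∞)⁻¹ ∂ν := by
    intro f hf
    have hfw : AEMeasurable (fun ω => f ω * (w ω : ℝ≥0∞)⁻¹) μ :=
      hf.mul w_meas.coe_nnreal_ennreal.inv.aemeasurable
    rw [← lintegral_rnDeriv_mul hνμ hfw]
    exact lintegral_congr fun ω => mul_left_comm _ _ _
  refine ⟨fun ω => ν.rnDeriv μ ω * (w ω : ℝ≥0∞)⁻¹,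
    (ν.measurable_rnDeriv μ).mul w_meas.coe_nnreal_ennreal.inv, fun f hf => ?_, fun F => ?_⟩
  · rw [int_ν f hf.aemeasurable]
    have hfw : Measurable fun ω => f ω * (w ω : ℝ≥0∞)⁻¹ :=
      hf.mul w_meas.coe_nnreal_ennreal.inv
    refine (ν_le _ hfw).trans (le_of_eq ?_)
    rw [int_ρ]
    congr 1
    refine lintegral_congr fun ω => ?_
    rw [← w_pow, ← ENNReal.mul_rpow_of_nonneg _ _ hpr.le, mul_left_comm,
      ENNReal.mul_inv_cancel (w_ne ω) coe_ne_top, mul_one]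
  · have hFm := (Lp.memLp F).1
    rw [int_ν _ hFm.aemeasurable.ennreal_ofReal]
    have hcancel : (fun ω => (w ω : ℝ) * ((w ω : ℝ)⁻¹ * F ω)) = F := by
      ext ω
      rw [mul_inv_cancel_left₀]
      exact_mod_cast (w_pos ω).ne'
    have hh : MemLp (fun ω => (w ω : ℝ)⁻¹ * F ω) p ρ :=
      ⟨(w_meas.coe_nnreal_real.inv.aestronglyMeasurable.mul hFm).mono_ac hρμ, by
        rw [← norm_eq, hcancel]; exact (Lp.memLp F).2⟩
    have hJ : J hh.toLp = F := by
      refine Lp.ext ((J_coe _).trans ?_)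
      filter_upwards [hμρ hh.coeFn_toLp] with ω hω
      rw [hω]
      exact congrFun hcancel ω
    have := ν_ge hh.toLp
    rw [LinearMap.comp_apply, hJ] at this
    refine this.trans (le_of_eq (lintegral_congr_ae ?_))
    filter_upwards [hνρ hh.coeFn_toLp] with ω hω
    rw [hω, mul_comm, ENNReal.ofReal_mul' (inv_nonneg.2 (w ω).coe_nonneg), ENNReal.ofReal_inv_of_pos
      (NNReal.coe_pos.2 (w_pos ω)), ENNReal.ofReal_coe_nnreal]

/-- Converse Hölder inequality for a nonnegative weight. -/
theorem lintegral_rpow_le_one_of_dual {Ω : Type*} [MeasurableSpace Ω] (μ : Measure Ω)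
    [SigmaFinite μ] {a q : ℝ} (haq : a.HolderConjugate q) {ψ : Ω → ℝ≥0∞} (hψ : Measurable ψ)
    (h : ∀ f : Ω → ℝ≥0∞, Measurable f →
      ∫⁻ ω, f ω * ψ ω ∂μ ≤ (∫⁻ ω, f ω ^ a ∂μ) ^ (1 / a)) :
    ∫⁻ ω, ψ ω ^ q ∂μ ≤ 1 := by
  have hq := haq.symm.pos
  have hq1 : 0 < q - 1 := haq.symm.sub_one_pos
  let g : ℕ → Ω → ℝ≥0∞ := fun n => (spanningSets μ n).indicator fun ω => min (ψ ω) n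
  have g_meas : ∀ n, Measurable (g n) := fun n =>
    (hψ.min measurable_const).indicator (measurableSet_spanningSets μ n)
  have g_le : ∀ n ω, g n ω ≤ ψ ω := fun n ω =>
    (Set.indicator_le_self _ _ ω).trans (min_le_left _ _)
  have g_int : ∀ n, ∫⁻ ω, g n ω ^ q ∂μ < ∞ := fun n => by
    calc ∫⁻ ω, g n ω ^ q ∂μ ≤ ∫⁻ ω, (spanningSets μ n).indicator (fun _ => (n : ℝ≥0∞) ^ q) ω ∂μ := by
          refine lintegral_mono fun ω => ?_
          by_cases hω : ω ∈ spanningSets μ n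
          · simp only [g, Set.indicator_of_mem hω]
            gcongr
            exact min_le_right _ _
          · simp [g, Set.indicator_of_notMem hω, hq]
      _ = (n : ℝ≥0∞) ^ q * μ (spanningSets μ n) :=
          lintegral_indicator_const (measurableSet_spanningSets μ n) _
      _ < ∞ := ENNReal.mul_lt_top (ENNReal.rpow_lt_top_of_nonneg hq.le (natCast_ne_top n))
          (measure_spanningSets_lt_top μ n)
  have g_le_one : ∀ n, ∫⁻ ω, g n ω ^ q ∂μ ≤ 1 := fun n => by
    have key : ∫⁻ ω, g n ω ^ q ∂μ ≤ (∫⁻ ω, g n ω ^ q ∂μ) ^ (1 / a) := by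
      calc ∫⁻ ω, g n ω ^ q ∂μ ≤ ∫⁻ ω, g n ω ^ (q - 1) * ψ ω ∂μ := by
            refine lintegral_mono fun ω => ?_
            calc g n ω ^ q = g n ω ^ (q - 1) * g n ω := by
                  conv_rhs => rw [← ENNReal.rpow_one (g n ω), ← ENNReal.rpow_mul, one_mul,
                    ← ENNReal.rpow_add_of_nonneg _ _ hq1.le zero_le_one]
                  rw [sub_add_cancel]
              _ ≤ _ := by gcongr; exact g_le n ω
        _ ≤ (∫⁻ ω, (g n ω ^ (q - 1)) ^ a ∂μ) ^ (1 / a) := h _ ((g_meas n).pow_const _)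
        _ = _ := by
            simp_rw [← ENNReal.rpow_mul, haq.symm.sub_one_mul_conj]
    by_contra! hlt
    have hlt' := ENNReal.rpow_lt_rpow_of_exponent_lt hlt (g_int n).ne
      ((div_lt_one haq.pos).2 haq.lt)
    rw [ENNReal.rpow_one] at hlt'
    exact hlt'.not_ge key
  have g_tendsto : ∀ ω, Filter.Tendsto (fun n => g n ω ^ q) Filter.atTop (nhds (ψ ω ^ q)) := fun ω => by
    refine (ENNReal.continuous_rpow_const.tendsto _).comp ?_
    have h1 : Filter.Tendsto (fun n : ℕ => min (ψ ω) n) Filter.atTop (nhds (min (ψ ω) ∞)) :=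
      tendsto_const_nhds.min ENNReal.tendsto_nat_nhds_top
    rw [min_eq_left le_top] at h1
    refine h1.congr' ?_
    filter_upwards [Filter.eventually_ge_atTop (spanningSetsIndex μ ω)] with n hn
    exact (Set.indicator_of_mem (monotone_spanningSets μ hn (mem_spanningSetsIndex μ ω))
      fun ω => min (ψ ω) (n : ℝ≥0∞)).symm
  calc ∫⁻ ω, ψ ω ^ q ∂μ = ∫⁻ ω, Filter.liminf (fun n => g n ω ^ q) Filter.atTop ∂μ :=
        lintegral_congr fun ω => (g_tendsto ω).liminf_eq.symm
    _ ≤ Filter.liminf (fun n => ∫⁻ ω, g n ω ^ q ∂μ) Filter.atTop :=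
        lintegral_liminf_le fun n => (g_meas n).pow_const _
    _ ≤ Filter.liminf (fun _ : ℕ => (1 : ℝ≥0∞)) Filter.atTop :=
        Filter.liminf_le_liminf (Filter.Eventually.of_forall g_le_one)
    _ = 1 := Filter.liminf_const _

/-- A weight of norm at most one in the Köthe dual of `L^a` is given by a real function of norm at
most one in `L^{a'}`. -/
theorem exists_real_density_of_dual {Ω : Type*} [MeasurableSpace Ω] (μ : Measure Ω)
    [SigmaFinite μ] {a : ℝ} (ha : 1 ≤ a) {ψ : Ω → ℝ≥0∞} (hψ : Measurable ψ)
    (h : ∀ f : Ω → ℝ≥0∞, Measurable f →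
      ∫⁻ ω, f ω * ψ ω ∂μ ≤ (∫⁻ ω, f ω ^ a ∂μ) ^ (1 / a)) :
    ∃ (φ : Ω → ℝ) (a' : ℝ≥0∞), Measurable φ ∧ (∀ ω, 0 ≤ φ ω) ∧
      1 / ENNReal.ofReal a + 1 / a' = 1 ∧ eLpNorm φ a' μ ≤ 1 ∧
      ∀ᵐ ω ∂μ, ψ ω = ENNReal.ofReal (φ ω) := by
  have enorm_toReal_le : ∀ x : ℝ≥0∞, ‖x.toReal‖ₑ ≤ x := fun x => by
    rw [Real.enorm_eq_ofReal toReal_nonneg]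
    exact ENNReal.ofReal_toReal_le
  have coe_toReal : (∀ᵐ ω ∂μ, ψ ω < ∞) → ∀ᵐ ω ∂μ, ψ ω = ENNReal.ofReal (ψ ω).toReal :=
    fun hfin => hfin.mono fun ω hω => (ENNReal.ofReal_toReal hω.ne).symm
  rcases ha.eq_or_lt with rfl | ha1
  · have hle : ψ ≤ᵐ[μ] fun _ => 1 := by
      refine ae_le_of_forall_setLIntegral_le_of_sigmaFinite hψ fun s hs _ => ?_
      have := h (s.indicator 1) (measurable_one.indicator hs)
      simp only [ENNReal.rpow_one, div_one] at this
      rw [← lintegral_indicator hs, ← lintegral_indicator hs]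
      refine le_trans (le_of_eq (lintegral_congr fun ω => ?_)) this
      by_cases hω : ω ∈ s <;> simp [hω]
    refine ⟨fun ω => (ψ ω).toReal, ∞, hψ.ennreal_toReal, fun _ => toReal_nonneg, by simp, ?_,
      coe_toReal (hle.mono fun ω hω => hω.trans_lt one_lt_top)⟩
    rw [eLpNorm_exponent_top]
    refine essSup_le_of_ae_le _ ?_
    filter_upwards [hle] with ω hω
    exact (enorm_toReal_le _).trans hω
  · have haq := Real.HolderConjugate.conjExponent ha1
    set q := a.conjExponent
    have hq := haq.symm.pos
    have hle := lintegral_rpow_le_one_of_dual μ haq hψ h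
    refine ⟨fun ω => (ψ ω).toReal, ENNReal.ofReal q, hψ.ennreal_toReal, fun _ => toReal_nonneg, ?_,
      ?_, coe_toReal ?_⟩
    · rw [one_div, one_div, ← ENNReal.ofReal_inv_of_pos haq.pos, ← ENNReal.ofReal_inv_of_pos hq,
        ← ENNReal.ofReal_add (inv_nonneg.2 haq.pos.le) (inv_nonneg.2 hq.le), haq.inv_add_inv_eq_one,
        ENNReal.ofReal_one]
    · rw [eLpNorm_eq_lintegral_rpow_enorm_toReal (by simpa using hq) ofReal_ne_top,
        ENNReal.toReal_ofReal hq.le]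
      refine ENNReal.rpow_le_one (le_trans (lintegral_mono fun ω => ?_) hle) (by positivity)
      gcongr
      exact enorm_toReal_le _
    · filter_upwards [ae_lt_top (hψ.pow_const q) (hle.trans_lt one_lt_top).ne] with ω hω
      rwa [ENNReal.rpow_lt_top_iff_of_pos hq] at hω

section PosPart

variable {E : Type*} [NormedAddCommGroup E] [Lattice E] [HasSolidNorm E] [IsOrderedAddMonoid E]

theorem norm_posPart_add_le (x y : E) : ‖(x + y)⁺‖ ≤ ‖x⁺‖ + ‖y⁺‖ := by
  refine le_trans (norm_le_norm_of_abs_le_abs ?_) (norm_add_le _ _)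
  rw [abs_of_nonneg (posPart_nonneg _),
    abs_of_nonneg (add_nonneg (posPart_nonneg x) (posPart_nonneg y))]
  exact sup_le (add_le_add (le_posPart x) (le_posPart y))
    (add_nonneg (posPart_nonneg x) (posPart_nonneg y))

theorem norm_posPart_le (x : E) : ‖x⁺‖ ≤ ‖x‖ := by
  refine norm_le_norm_of_abs_le_abs ?_
  rw [abs_of_nonneg (posPart_nonneg _)]
  exact sup_le (le_abs_self x) (abs_nonneg x)

end PosPart

theorem nonneg_of_le_norm_posPart {E : Type*} [NormedAddCommGroup E] [Lattice E]
    [IsOrderedAddMonoid E] [Module ℝ E] {ℓ : E →ₗ[ℝ] ℝ} (h : ∀ x, ℓ x ≤ ‖x⁺‖) {x : E}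
    (hx : 0 ≤ x) : 0 ≤ ℓ x := by
  have := h (-x)
  rw [posPart_eq_zero.2 (neg_nonpos.2 hx), norm_zero, map_neg] at this
  linarith

section Lp

variable {Ω : Type*} [MeasurableSpace Ω] {μ : Measure Ω}

theorem Lp_norm_posPart_smul {p : ℝ≥0∞} [Fact (1 ≤ p)] {c : ℝ} (hc : 0 < c) (F : Lp ℝ p μ) :
    ‖(c • F)⁺‖ = c * ‖F⁺‖ := by
  have : (c • F)⁺ = c • F⁺ := by
    refine Lp.ext ?_
    filter_upwards [Lp.coeFn_sup (c • F) 0, Lp.coeFn_smul c F, Lp.coeFn_smul c F⁺,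
      Lp.coeFn_sup F 0, Lp.coeFn_zero ℝ p μ] with ω h1 h2 h3 h4 h5
    rw [h3, posPart_def, posPart_def, h1, Pi.smul_apply, h4]
    simp only [Pi.sup_apply, h2, h5, Pi.smul_apply, Pi.zero_apply, smul_eq_mul]
    simpa using (mul_max_of_nonneg (F ω) 0 hc.le).symm
  rw [this, norm_smul, Real.norm_of_nonneg hc.le]

variable {a r : ℝ}

theorem memLp_abs_rpow (hr : 0 < r) (x : Lp ℝ (ENNReal.ofReal (a * r)) μ) :
    MemLp (fun ω => |x ω| ^ r) (ENNReal.ofReal a) μ := by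
  have := (Lp.memLp x).norm_rpow_div (ENNReal.ofReal r)
  rwa [← ENNReal.ofReal_div_of_pos hr, mul_div_cancel_right₀ _ hr.ne',
    ENNReal.toReal_ofReal hr.le] at this

/-- The map `x ↦ |x|^r` from `L^{ar}` to `L^a`. -/
noncomputable def absRpowLp (hr : 0 < r) (x : Lp ℝ (ENNReal.ofReal (a * r)) μ) :
    Lp ℝ (ENNReal.ofReal a) μ :=
  (memLp_abs_rpow hr x).toLp

theorem coeFn_absRpowLp (hr : 0 < r) (x : Lp ℝ (ENNReal.ofReal (a * r)) μ) :
    absRpowLp hr x =ᵐ[μ] fun ω => |x ω| ^ r :=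
  MemLp.coeFn_toLp (memLp_abs_rpow hr x)

theorem absRpowLp_nonneg (hr : 0 < r) (x : Lp ℝ (ENNReal.ofReal (a * r)) μ) :
    0 ≤ absRpowLp hr x := by
  rw [← Lp.coeFn_nonneg]
  filter_upwards [coeFn_absRpowLp hr x] with ω hω
  rw [hω]
  exact Real.rpow_nonneg (abs_nonneg _) _

theorem absRpowLp_smul (hr : 0 < r) {c : ℝ} (hc : 0 ≤ c)
    (x : Lp ℝ (ENNReal.ofReal (a * r)) μ) :
    absRpowLp hr (c • x) = c ^ r • absRpowLp hr x := by
  refine Lp.ext ?_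
  filter_upwards [coeFn_absRpowLp hr x, coeFn_absRpowLp hr (c • x), Lp.coeFn_smul c x,
    Lp.coeFn_smul (c ^ r) (absRpowLp hr x)] with ω h1 h2 h3 h4
  rw [h2, h4, Pi.smul_apply, h1, h3, Pi.smul_apply, smul_eq_mul, smul_eq_mul, abs_mul,
    abs_of_nonneg hc, Real.mul_rpow hc (abs_nonneg _)]

theorem eLpNorm_sum_abs_rpow (ha : 0 ≤ a) (hr : 0 < r) {n : ℕ}
    (x : Fin n → Lp ℝ (ENNReal.ofReal (a * r)) μ) :
    eLpNorm (fun ω => (∑ k, |x k ω| ^ r) ^ (1 / r)) (ENNReal.ofReal (a * r)) μ =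
      ENNReal.ofReal (‖∑ k, absRpowLp hr (x k)‖ ^ (1 / r)) := by
  have hcoe : ⇑(∑ k, absRpowLp hr (x k)) =ᵐ[μ] fun ω => ∑ k, |x k ω| ^ r := by
    have h : ∀ᵐ ω ∂μ, ∀ k, absRpowLp hr (x k) ω = |x k ω| ^ r :=
      ae_all_iff.2 fun k => coeFn_absRpowLp hr (x k)
    filter_upwards [Lp.coeFn_finsetSum Finset.univ fun k => absRpowLp hr (x k), h] with ω h1 h2
    rw [h1, Finset.sum_apply]
    exact Finset.sum_congr rfl fun k _ => h2 k
  have hr' : 0 < 1 / r := by positivity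
  have h := eLpNorm_norm_rpow (p := ENNReal.ofReal (a * r)) (μ := μ)
    (fun ω => ∑ k, |x k ω| ^ r) hr'
  rw [← ENNReal.ofReal_mul (mul_nonneg ha hr.le), mul_assoc, mul_one_div_cancel hr.ne', mul_one,
    ← eLpNorm_congr_ae hcoe, ← ENNReal.ofReal_toReal (Lp.eLpNorm_ne_top _),
    ENNReal.ofReal_rpow_of_nonneg ENNReal.toReal_nonneg hr'.le, ← Lp.norm_def] at h
  rw [← h]
  congr 1
  ext ω
  rw [Real.norm_of_nonneg (Finset.sum_nonneg fun k _ => Real.rpow_nonneg (abs_nonneg _) _)]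

end Lp

/-- Homogeneity turns a Young-type bound into a product bound. -/
theorem abs_le_rpow_mul_rpow_of_scaling {r r' A B t : ℝ} (hr : 0 < r) (hr' : 0 < r')
    (hrr' : 1 / r + 1 / r' = 1) (hA : 0 ≤ A) (hB : 0 ≤ B)
    (h : ∀ α β : ℝ, 0 < α → 0 < β → α * β * t ≤ 1 / r * (α ^ r * A) + 1 / r' * (β ^ r' * B)) :
    t ≤ A ^ (1 / r) * B ^ (1 / r') := by
  have key : ∀ {s C α : ℝ}, 0 < s → 0 ≤ C → C ^ (1 / s) < α → 0 < α ∧ (α⁻¹) ^ s * C ≤ 1 := by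
    intro s C α hs hC hα
    have hα0 : 0 < α := (Real.rpow_nonneg hC _).trans_lt hα
    refine ⟨hα0, ?_⟩
    rw [Real.inv_rpow hα0.le, inv_mul_le_iff₀ (Real.rpow_pos_of_pos hα0 s), mul_one]
    calc C = (C ^ (1 / s)) ^ s := by
          rw [← Real.rpow_mul hC, one_div_mul_cancel hs.ne', Real.rpow_one]
      _ ≤ α ^ s := Real.rpow_le_rpow (Real.rpow_nonneg hC _) hα.le hs.le
  refine le_mul_of_forall_lt₀ fun α hα β hβ => ?_
  obtain ⟨hα0, hαA⟩ := key hr hA hα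
  obtain ⟨hβ0, hβB⟩ := key hr' hB hβ
  have h1 := h α⁻¹ β⁻¹ (inv_pos.2 hα0) (inv_pos.2 hβ0)
  have h2 : α⁻¹ * β⁻¹ * t ≤ 1 := by
    refine h1.trans (le_trans ?_ hrr'.le)
    exact add_le_add (mul_le_of_le_one_right (one_div_pos.2 hr).le hαA)
      (mul_le_of_le_one_right (one_div_pos.2 hr').le hβB)
  rwa [← mul_inv, inv_mul_le_iff₀ (mul_pos hα0 hβ0), mul_one] at h2

/-- A homogeneous form with the vector-valued bound is dominated by positive functionals on `L^a`
and `L^b`. -/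
theorem exists_functionals_of_homogeneous_form {Ω₁ Ω₂ : Type*} [MeasurableSpace Ω₁]
    [MeasurableSpace Ω₂] {μ₁ : Measure Ω₁} {μ₂ : Measure Ω₂} {r r' a b : ℝ}
    [Fact (1 ≤ ENNReal.ofReal a)] [Fact (1 ≤ ENNReal.ofReal b)] (ha : 0 ≤ a) (hb : 0 ≤ b)
    (hr : 0 < r) (hr' : 0 < r') (hrr' : 1 / r + 1 / r' = 1)
    (u : Lp ℝ (ENNReal.ofReal (a * r)) μ₁ → Lp ℝ (ENNReal.ofReal (b * r')) μ₂ → ℝ)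
    (huhom₁ : ∀ c : ℝ, 0 ≤ c → ∀ x y, u (c • x) y = c * u x y)
    (huhom₂ : ∀ c : ℝ, 0 ≤ c → ∀ x y, u x (c • y) = c * u x y)
    (hmain : ∀ (n : ℕ) (x : Fin n → Lp ℝ (ENNReal.ofReal (a * r)) μ₁)
        (y : Fin n → Lp ℝ (ENNReal.ofReal (b * r')) μ₂),
      ENNReal.ofReal (∑ k, |u (x k) (y k)|) ≤
        eLpNorm (fun ω => (∑ k, |x k ω| ^ r) ^ (1 / r)) (ENNReal.ofReal (a * r)) μ₁ *
        eLpNorm (fun ω => (∑ k, |y k ω| ^ r') ^ (1 / r')) (ENNReal.ofReal (b * r')) μ₂) :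
    ∃ (ℓ₁ : Lp ℝ (ENNReal.ofReal a) μ₁ →ₗ[ℝ] ℝ) (ℓ₂ : Lp ℝ (ENNReal.ofReal b) μ₂ →ₗ[ℝ] ℝ),
      (∀ F, ℓ₁ F ≤ ‖F⁺‖) ∧ (∀ G, ℓ₂ G ≤ ‖G⁺‖) ∧
      ∀ x y, |u x y| ≤ ℓ₁ (absRpowLp hr x) ^ (1 / r) * ℓ₂ (absRpowLp hr' y) ^ (1 / r') := by
  have abs_u_smul : ∀ c d : ℝ, 0 ≤ c → 0 ≤ d → ∀ x y, |u (c • x) (d • y)| = c * d * |u x y| := by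
    intro c d hc hd x y
    rw [huhom₁ c hc, huhom₂ d hd, ← mul_assoc, abs_mul, abs_of_nonneg (mul_nonneg hc hd)]
  obtain ⟨ℓ, hℓ, hu⟩ := exists_linearMap_le_sublinear
    (E := Lp ℝ (ENNReal.ofReal a) μ₁ × Lp ℝ (ENNReal.ofReal b) μ₂)
    (ι := Lp ℝ (ENNReal.ofReal (a * r)) μ₁ × Lp ℝ (ENNReal.ofReal (b * r')) μ₂)
    (fun z => 1 / r * ‖z.1⁺‖ + 1 / r' * ‖z.2⁺‖)
    (fun c hc z => by
      rw [Prod.smul_fst, Prod.smul_snd, Lp_norm_posPart_smul hc, Lp_norm_posPart_smul hc]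
      ring)
    (fun z z' => by
      have h1 := mul_le_mul_of_nonneg_left (norm_posPart_add_le z.1 z'.1) (one_div_pos.2 hr).le
      have h2 := mul_le_mul_of_nonneg_left (norm_posPart_add_le z.2 z'.2) (one_div_pos.2 hr').le
      rw [Prod.fst_add, Prod.snd_add]
      linarith)
    (fun i => (absRpowLp hr i.1, absRpowLp hr' i.2)) (fun i => |u i.1 i.2|)
    (fun c hc i => by
      refine ⟨(c ^ (1 / r) • i.1, c ^ (1 / r') • i.2), ?_, ?_⟩
      · rw [absRpowLp_smul hr (Real.rpow_nonneg hc.le _),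
          absRpowLp_smul hr' (Real.rpow_nonneg hc.le _), ← Real.rpow_mul hc.le,
          ← Real.rpow_mul hc.le, one_div_mul_cancel hr.ne', one_div_mul_cancel hr'.ne',
          Real.rpow_one, Prod.smul_mk]
      · rw [abs_u_smul _ _ (Real.rpow_nonneg hc.le _) (Real.rpow_nonneg hc.le _),
          ← Real.rpow_add hc, hrr', Real.rpow_one])
    (fun L => by
      rw [← List.ofFn_get L, List.map_ofFn, List.map_ofFn, List.sum_ofFn, List.sum_ofFn]
      have h := hmain L.length (fun k => (L.get k).1) fun k => (L.get k).2
      rw [eLpNorm_sum_abs_rpow ha hr, eLpNorm_sum_abs_rpow hb hr', ← ENNReal.ofReal_mul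
        (by positivity), ENNReal.ofReal_le_ofReal_iff (by positivity)] at h
      simp only [Function.comp_apply, Prod.fst_sum, Prod.snd_sum]
      rw [posPart_of_nonneg (Finset.sum_nonneg fun k _ => absRpowLp_nonneg hr _),
        posPart_of_nonneg (Finset.sum_nonneg fun k _ => absRpowLp_nonneg hr' _)]
      exact h.trans (Real.geom_mean_le_arith_mean2_weighted (by positivity) (by positivity)
        (norm_nonneg _) (norm_nonneg _) hrr'))
  let ℓ₁ : Lp ℝ (ENNReal.ofReal a) μ₁ →ₗ[ℝ] ℝ := r • ℓ ∘ₗ LinearMap.inl ℝ _ _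
  let ℓ₂ : Lp ℝ (ENNReal.ofReal b) μ₂ →ₗ[ℝ] ℝ := r' • ℓ ∘ₗ LinearMap.inr ℝ _ _
  have hℓ₁ : ∀ F, ℓ₁ F ≤ ‖F⁺‖ := fun F => by
    have := mul_le_mul_of_nonneg_left (hℓ (F, 0)) hr.le
    simpa [ℓ₁, hr.ne'] using this
  have hℓ₂ : ∀ G, ℓ₂ G ≤ ‖G⁺‖ := fun G => by
    have := mul_le_mul_of_nonneg_left (hℓ (0, G)) hr'.le
    simpa [ℓ₂, hr'.ne'] using this
  have hsplit : ∀ F G, ℓ (F, G) = 1 / r * ℓ₁ F + 1 / r' * ℓ₂ G := fun F G => by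
    have : (F, G) = (F, 0) + ((0, G) : Lp ℝ (ENNReal.ofReal a) μ₁ × Lp ℝ (ENNReal.ofReal b) μ₂) := by
      simp
    rw [this, map_add]
    simp [ℓ₁, ℓ₂, hr.ne', hr'.ne']
  refine ⟨ℓ₁, ℓ₂, hℓ₁, hℓ₂, fun x y => ?_⟩
  refine abs_le_rpow_mul_rpow_of_scaling hr hr' hrr'
    (nonneg_of_le_norm_posPart hℓ₁ (absRpowLp_nonneg hr x))
    (nonneg_of_le_norm_posPart hℓ₂ (absRpowLp_nonneg hr' y)) fun α β hα hβ => ?_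
  have := hu (α • x, β • y)
  rwa [abs_u_smul α β hα.le hβ.le, hsplit, absRpowLp_smul hr hα.le, absRpowLp_smul hr' hβ.le,
    map_smul, map_smul, smul_eq_mul, smul_eq_mul] at this

/-- The weight on one factor: a positive functional on `L^a`, evaluated at `|x|^r`, is dominated
by a weighted integral of `|x|^r`. -/
theorem exists_weight_of_functional {Ω : Type*} [MeasurableSpace Ω] (μ : Measure Ω)
    [SigmaFinite μ] {a r : ℝ} [Fact (1 ≤ ENNReal.ofReal a)] (ha : 1 ≤ a) (hr : 0 < r)
    (ℓ : Lp ℝ (ENNReal.ofReal a) μ →ₗ[ℝ] ℝ) (hℓ : ∀ F, ℓ F ≤ ‖F⁺‖) :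
    ∃ (φ : Ω → ℝ) (a' : ℝ≥0∞), Measurable φ ∧ (∀ ω, 0 ≤ φ ω) ∧
      1 / ENNReal.ofReal a + 1 / a' = 1 ∧ eLpNorm φ a' μ ≤ 1 ∧
      ∀ x : Lp ℝ (ENNReal.ofReal (a * r)) μ, ENNReal.ofReal (ℓ (absRpowLp hr x) ^ (1 / r)) ≤
        (∫⁻ ω, ENNReal.ofReal (|x ω| ^ r * φ ω) ∂μ) ^ (1 / r) := by
  obtain ⟨ψ, ψ_meas, ψ_le, ψ_ge⟩ := exists_density_of_positive_functional μ ofReal_ne_top ℓ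
    (fun F hF => nonneg_of_le_norm_posPart hℓ hF) fun F => (hℓ F).trans (norm_posPart_le F)
  rw [ENNReal.toReal_ofReal (zero_le_one.trans ha)] at ψ_le
  obtain ⟨φ, a', φ_meas, φ_nonneg, haa', φ_le, hφ⟩ := exists_real_density_of_dual μ ha ψ_meas ψ_le
  refine ⟨φ, a', φ_meas, φ_nonneg, haa', φ_le, fun x => ?_⟩
  rw [← ENNReal.ofReal_rpow_of_nonneg
    (nonneg_of_le_norm_posPart hℓ (absRpowLp_nonneg hr x)) (by positivity)]
  gcongr
  refine (ψ_ge _).trans (le_of_eq (lintegral_congr_ae ?_))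
  filter_upwards [hφ, coeFn_absRpowLp hr x] with ω h1 h2
  rw [h1, h2, ENNReal.ofReal_mul (Real.rpow_nonneg (abs_nonneg _) _)]

/-- **Corollary 1** of the paper for `X = L^a(μ₁)`, `Y = L^b(μ₂)` (so
`X^{1/r} = L^{ar}(μ₁)` and `Y^{1/r'} = L^{br'}(μ₂)`): a homogeneous form on
`L^{ar}(μ₁) × L^{br'}(μ₂)` satisfying the vector-valued inequality (2.3) admits
weights `φ, ψ ≥ 0` with `‖φ‖_{L^{a'}(μ₁)} ≤ 1`, `‖ψ‖_{L^{b'}(μ₂)} ≤ 1` dominating it;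
the conjugate exponents `a', b'` are specified by `1/a + 1/a' = 1` in `ℝ≥0∞`. -/
theorem maurey_rosenthal_forms_cor
    {Ω₁ Ω₂ : Type*} [MeasurableSpace Ω₁] [MeasurableSpace Ω₂]
    (μ₁ : Measure Ω₁) (μ₂ : Measure Ω₂) [SigmaFinite μ₁] [SigmaFinite μ₂]
    (r r' a b : ℝ) (hr : 1 < r) (hrr' : 1 / r + 1 / r' = 1)
    (ha : 1 ≤ a) (hb : 1 ≤ b)
    (u : Lp ℝ (ENNReal.ofReal (a * r)) μ₁ → Lp ℝ (ENNReal.ofReal (b * r')) μ₂ → ℝ)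
    (huhom₁ : ∀ (c : ℝ), 0 ≤ c → ∀ x y, u (c • x) y = c * u x y)
    (huhom₂ : ∀ (c : ℝ), 0 ≤ c → ∀ x y, u x (c • y) = c * u x y)
    (hmain : ∀ (n : ℕ) (x : Fin n → Lp ℝ (ENNReal.ofReal (a * r)) μ₁)
        (y : Fin n → Lp ℝ (ENNReal.ofReal (b * r')) μ₂),
      ENNReal.ofReal (∑ k, |u (x k) (y k)|) ≤
        eLpNorm (fun ω => (∑ k, |x k ω| ^ r) ^ (1 / r)) (ENNReal.ofReal (a * r)) μ₁ *
        eLpNorm (fun ω => (∑ k, |y k ω| ^ r') ^ (1 / r')) (ENNReal.ofReal (b * r')) μ₂) :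
    ∃ (φ : Ω₁ → ℝ) (ψ : Ω₂ → ℝ) (a' b' : ℝ≥0∞),
      Measurable φ ∧ Measurable ψ ∧
      (∀ ω, 0 ≤ φ ω) ∧ (∀ ω, 0 ≤ ψ ω) ∧
      1 / ENNReal.ofReal a + 1 / a' = 1 ∧
      1 / ENNReal.ofReal b + 1 / b' = 1 ∧
      eLpNorm φ a' μ₁ ≤ 1 ∧ eLpNorm ψ b' μ₂ ≤ 1 ∧
      ∀ x y,
        ENNReal.ofReal |u x y| ≤
          (∫⁻ ω, ENNReal.ofReal (|x ω| ^ r * φ ω) ∂μ₁) ^ (1 / r) *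
          (∫⁻ ω, ENNReal.ofReal (|y ω| ^ r' * ψ ω) ∂μ₂) ^ (1 / r') := by
  have hr0 : 0 < r := zero_lt_one.trans hr
  have hr0' : 0 < r' := by
    have h1 : 1 / r < 1 := (div_lt_one hr0).2 hr
    exact one_div_pos.1 (by linarith)
  have : Fact (1 ≤ ENNReal.ofReal a) := ⟨ENNReal.one_le_ofReal.2 ha⟩
  have : Fact (1 ≤ ENNReal.ofReal b) := ⟨ENNReal.one_le_ofReal.2 hb⟩
  obtain ⟨ℓ₁, ℓ₂, hℓ₁, hℓ₂, hu⟩ := exists_functionals_of_homogeneous_form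
    (zero_le_one.trans ha) (zero_le_one.trans hb) hr0 hr0' hrr' u huhom₁ huhom₂ hmain
  obtain ⟨φ, a', φ_meas, φ_nonneg, haa', φ_le, hφ⟩ :=
    exists_weight_of_functional μ₁ ha hr0 ℓ₁ hℓ₁
  obtain ⟨ψ, b', ψ_meas, ψ_nonneg, hbb', ψ_le, hψ⟩ :=
    exists_weight_of_functional μ₂ hb hr0' ℓ₂ hℓ₂
  refine ⟨φ, ψ, a', b', φ_meas, ψ_meas, φ_nonneg, ψ_nonneg, haa', hbb', φ_le, ψ_le,
    fun x y => ?_⟩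
  calc ENNReal.ofReal |u x y|
      ≤ ENNReal.ofReal (ℓ₁ (absRpowLp hr0 x) ^ (1 / r) * ℓ₂ (absRpowLp hr0' y) ^ (1 / r')) :=
        ENNReal.ofReal_le_ofReal (hu x y)
    _ = ENNReal.ofReal (ℓ₁ (absRpowLp hr0 x) ^ (1 / r)) *
          ENNReal.ofReal (ℓ₂ (absRpowLp hr0' y) ^ (1 / r')) :=
        ENNReal.ofReal_mul (Real.rpow_nonneg
          (nonneg_of_le_norm_posPart hℓ₁ (absRpowLp_nonneg hr0 x)) _)
    _ ≤ _ := mul_le_mul' (hφ x) (hψ y)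
end

section
/- Let (Ω,ν) be a σ-finite measure space, let 1 ≤ p < r < ∞, let E be a real normed space, let T : E → L^p(ν) be a bounded linear operator, and let C ≥ 0. Then the following are equivalent: (i) for every n and all x₁,…,xₙ ∈ E, ‖(∑_{k≤n} |Tx_k|^r)^{1/r}‖_{L^p(ν)} ≤ C (∑_{k≤n} ‖x_k‖_E^r)^{1/r}; (ii) there exists a measurable function w : Ω → [0,∞) with ‖w‖_{L^{p/(r-p)}(ν)} ≤ 1 such that for every x ∈ E, ∫ |Tx|^r / w dν ≤ C^r ‖x‖_E^r (in particular Tx = 0 ν-a.e. on {w = 0}). -/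
open MeasureTheory ENNReal
open scoped NNReal ENNReal
open Filter Topology

/-- In a real Hilbert space, a family of closed convex sets whose finite subfamilies have common
points in a fixed ball has a common point in that ball. -/
theorem exists_mem_iInter_of_convex_isClosed {H ι : Type*} [NormedAddCommGroup H]
    [InnerProductSpace ℝ H] [CompleteSpace H] {K : ι → Set H} {R : ℝ}
    (hconv : ∀ i, Convex ℝ (K i)) (hclosed : ∀ i, IsClosed (K i))
    (hfin : ∀ F : Finset ι, ∃ y, ‖y‖ ≤ R ∧ ∀ i ∈ F, y ∈ K i) :
    ∃ y, ‖y‖ ≤ R ∧ ∀ i, y ∈ K i := by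
  classical
  have hmin : ∀ F : Finset ι, ∃ y, ‖y‖ ≤ R ∧ (∀ i ∈ F, y ∈ K i) ∧
      ∀ z, (∀ i ∈ F, z ∈ K i) → ‖y - z‖ ^ 2 ≤ ‖z‖ ^ 2 - ‖y‖ ^ 2 := by
    intro F
    obtain ⟨y₀, hy₀R, hy₀⟩ := hfin F
    let L : Set H := ⋂ i ∈ F, K i
    have hLc : Convex ℝ L := convex_iInter₂ fun i _ => hconv i
    have hLcl : IsClosed L := isClosed_biInter fun i _ => hclosed i
    have hmem : ∀ z, z ∈ L ↔ ∀ i ∈ F, z ∈ K i := fun z => by simp [L]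
    obtain ⟨y, hyL, hy⟩ := exists_norm_eq_iInf_of_complete_convex ⟨y₀, (hmem _).2 hy₀⟩
      hLcl.isComplete hLc 0
    have hproj := (norm_eq_iInf_iff_real_inner_le_zero hLc hyL).1 hy
    have key : ∀ z ∈ L, ‖y - z‖ ^ 2 ≤ ‖z‖ ^ 2 - ‖y‖ ^ 2 := by
      intro z hz
      have h1 := hproj z hz
      rw [zero_sub, inner_neg_left, inner_sub_right, real_inner_self_eq_norm_sq] at h1
      rw [norm_sub_sq_real]
      linarith
    refine ⟨y, ?_, (hmem y).1 hyL, fun z hz => key z ((hmem z).2 hz)⟩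
    have h2 := key y₀ ((hmem _).2 hy₀)
    have h3 : ‖y‖ ≤ ‖y₀‖ := by
      refine le_of_sq_le_sq ?_ (norm_nonneg _)
      nlinarith [sq_nonneg ‖y - y₀‖]
    exact h3.trans hy₀R
  choose y hyR hyK hy using hmin
  have hstep : ∀ F G : Finset ι, F ⊆ G → ‖y F - y G‖ ^ 2 ≤ ‖y G‖ ^ 2 - ‖y F‖ ^ 2 :=
    fun F G hFG => hy F _ fun i hi => hyK G i (hFG hi)
  have hmono : Monotone fun F => ‖y F‖ ^ 2 := fun F G hFG => by
    nlinarith [hstep F G hFG, sq_nonneg ‖y F - y G‖]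
  have hbdd : BddAbove (Set.range fun F => ‖y F‖ ^ 2) := by
    refine ⟨R ^ 2, ?_⟩
    rintro _ ⟨F, rfl⟩
    exact pow_le_pow_left₀ (norm_nonneg _) (hyR F) 2
  have hcauchy : CauchySeq y := by
    rw [Metric.cauchySeq_iff']
    intro ε hε
    obtain ⟨F, hF⟩ := exists_lt_of_lt_ciSup
      (show (⨆ F, ‖y F‖ ^ 2) - ε ^ 2 < ⨆ F, ‖y F‖ ^ 2 by nlinarith [pow_pos hε 2])
    refine ⟨F, fun G hG => ?_⟩
    rw [dist_comm, dist_eq_norm]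
    refine lt_of_pow_lt_pow_left₀ 2 hε.le ?_
    have h1 := hstep F G hG
    have h2 := le_ciSup hbdd G
    linarith
  obtain ⟨z, hz⟩ := cauchySeq_tendsto_of_complete hcauchy
  refine ⟨z, le_of_tendsto hz.norm (.of_forall hyR), fun i => (hclosed i).mem_of_tendsto hz ?_⟩
  filter_upwards [eventually_ge_atTop {i}] with F hF
  exact hyK F i (hF (by simp))

/-- Hölder's inequality with a weight and an exponent `0 < s < 1`. -/
theorem lintegral_rpow_le_of_weight {Ω : Type*} [MeasurableSpace Ω] {ν : Measure Ω} {s : ℝ}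
    (hs0 : 0 < s) (hs1 : s < 1) {k w : Ω → ℝ≥0∞} (hk : Measurable k) (hw : Measurable w)
    (hw_top : ∀ᵐ ω ∂ν, w ω ≠ ∞) (hkw : ∀ᵐ ω ∂ν, w ω = 0 → k ω = 0) :
    ∫⁻ ω, k ω ^ s ∂ν ≤
      (∫⁻ ω, k ω / w ω ∂ν) ^ s * (∫⁻ ω, w ω ^ (s / (1 - s)) ∂ν) ^ (1 - s) := by
  refine le_trans (le_of_eq ?_) (ENNReal.lintegral_mul_norm_pow_le (hk.div hw).aemeasurable
    (hw.pow_const _).aemeasurable hs0.le (sub_nonneg.2 hs1.le) (by ring))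
  refine lintegral_congr_ae ?_
  filter_upwards [hw_top, hkw] with ω h1 h2
  rw [← ENNReal.rpow_mul, div_mul_cancel₀ _ (sub_pos.2 hs1).ne',
    ← ENNReal.mul_rpow_of_nonneg _ _ hs0.le]
  by_cases h0 : w ω = 0
  · simp [h0, h2 h0]
  · rw [Pi.div_apply, ENNReal.div_mul_cancel h0 h1]

/-- `t ↦ t ^ (-θ)`, extended by `∞` to `t ≤ 0`, is convex. -/
theorem inv_rpow_ofReal_convex {θ : ℝ} (hθ : 0 < θ) {a b : ℝ} (ha : 0 ≤ a) (hb : 0 ≤ b)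
    (hab : a + b = 1) (u v : ℝ) :
    (ENNReal.ofReal (a * u + b * v) ^ θ)⁻¹ ≤ ENNReal.ofReal a * (ENNReal.ofReal u ^ θ)⁻¹ +
      ENNReal.ofReal b * (ENNReal.ofReal v ^ θ)⁻¹ := by
  rcases ha.eq_or_lt with rfl | ha
  · obtain rfl : b = 1 := by linarith
    simp
  rcases hb.eq_or_lt with rfl | hb
  · obtain rfl : a = 1 := by linarith
    simp
  rcases le_or_gt u 0 with hu | hu
  · simp [ENNReal.ofReal_of_nonpos hu, hθ, ENNReal.mul_top, ha]
  rcases le_or_gt v 0 with hv | hv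
  · simp [ENNReal.ofReal_of_nonpos hv, hθ, ENNReal.mul_top, hb]
  have huv : 0 < a * u + b * v := by positivity
  rw [ENNReal.ofReal_rpow_of_pos huv, ENNReal.ofReal_rpow_of_pos hu, ENNReal.ofReal_rpow_of_pos hv,
    ← ENNReal.ofReal_inv_of_pos (by positivity), ← ENNReal.ofReal_inv_of_pos (by positivity),
    ← ENNReal.ofReal_inv_of_pos (by positivity), ← ENNReal.ofReal_mul ha.le,
    ← ENNReal.ofReal_mul hb.le, ← ENNReal.ofReal_add (by positivity) (by positivity)]
  refine ENNReal.ofReal_le_ofReal ?_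
  have h1 := Real.geom_mean_le_arith_mean2_weighted ha.le hb.le hu.le hv.le hab
  have h2 := Real.geom_mean_le_arith_mean2_weighted ha.le hb.le
    (show 0 ≤ (u ^ θ)⁻¹ by positivity) (show 0 ≤ (v ^ θ)⁻¹ by positivity) hab
  refine le_trans ?_ h2
  rw [Real.inv_rpow (by positivity), Real.inv_rpow (by positivity), ← mul_inv]
  refine inv_anti₀ (by positivity) ?_
  rw [← Real.rpow_mul hu.le, ← Real.rpow_mul hv.le, mul_comm θ a, mul_comm θ b,
    Real.rpow_mul hu.le, Real.rpow_mul hv.le, ← Real.mul_rpow (by positivity) (by positivity)]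
  exact Real.rpow_le_rpow (by positivity) h1 hθ.le

theorem convex_setOf_lintegral_div_le {Ω : Type*} [MeasurableSpace Ω] {ν : Measure Ω}
    {θ : ℝ} (hθ : 0 < θ) {g : Ω → ℝ≥0∞} (hg : Measurable g)
    (B : ℝ≥0∞) :
    Convex ℝ {v : Lp ℝ 2 ν | ∫⁻ ω, g ω / ENNReal.ofReal (v ω) ^ θ ∂ν ≤ B} := by
  intro u hu v hv a b ha hb hab
  simp only [Set.mem_ofPred_eq] at hu hv ⊢
  have hmu : Measurable fun ω => g ω / ENNReal.ofReal (u ω) ^ θ :=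
    hg.div ((Lp.stronglyMeasurable u).measurable.ennreal_ofReal.pow_const θ)
  have hmv : Measurable fun ω => g ω / ENNReal.ofReal (v ω) ^ θ :=
    hg.div ((Lp.stronglyMeasurable v).measurable.ennreal_ofReal.pow_const θ)
  calc ∫⁻ ω, g ω / ENNReal.ofReal ((a • u + b • v : Lp ℝ 2 ν) ω) ^ θ ∂ν
      ≤ ∫⁻ ω, ENNReal.ofReal a * (g ω / ENNReal.ofReal (u ω) ^ θ) +
          ENNReal.ofReal b * (g ω / ENNReal.ofReal (v ω) ^ θ) ∂ν := by
        refine lintegral_mono_ae ?_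
        filter_upwards [Lp.coeFn_add (a • u) (b • v), Lp.coeFn_smul a u, Lp.coeFn_smul b v]
          with ω h1 h2 h3
        rw [h1, Pi.add_apply, h2, h3, Pi.smul_apply, Pi.smul_apply, smul_eq_mul, smul_eq_mul]
        refine (mul_le_mul_right (inv_rpow_ofReal_convex hθ ha hb hab _ _) (g ω)).trans_eq ?_
        simp only [div_eq_mul_inv]
        ring
    _ = ENNReal.ofReal a * ∫⁻ ω, g ω / ENNReal.ofReal (u ω) ^ θ ∂ν +
          ENNReal.ofReal b * ∫⁻ ω, g ω / ENNReal.ofReal (v ω) ^ θ ∂ν := by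
        rw [lintegral_add_left (hmu.const_mul _), lintegral_const_mul _ hmu,
          lintegral_const_mul _ hmv]
    _ ≤ ENNReal.ofReal a * B + ENNReal.ofReal b * B := by gcongr
    _ = B := by rw [← add_mul, ← ENNReal.ofReal_add ha hb, hab, ENNReal.ofReal_one, one_mul]

theorem isClosed_setOf_lintegral_div_le {Ω : Type*} [MeasurableSpace Ω] {ν : Measure Ω}
    {θ : ℝ} {g : Ω → ℝ≥0∞} (hg : Measurable g)
    (hg_top : ∀ ω, g ω ≠ ∞) (B : ℝ≥0∞) :
    IsClosed {v : Lp ℝ 2 ν | ∫⁻ ω, g ω / ENNReal.ofReal (v ω) ^ θ ∂ν ≤ B} := by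
  refine IsSeqClosed.isClosed fun v u hv hvu => ?_
  obtain ⟨φ, -, hφ⟩ := (tendstoInMeasure_of_tendsto_Lp hvu).exists_seq_tendsto_ae
  have hlim : ∀ᵐ ω ∂ν, Tendsto (fun n => g ω / ENNReal.ofReal (v (φ n) ω) ^ θ) atTop
      (𝓝 (g ω / ENNReal.ofReal (u ω) ^ θ)) := by
    filter_upwards [hφ] with ω hω
    exact ENNReal.Tendsto.const_div
      (((ENNReal.continuous_rpow_const (y := θ)).tendsto _).comp (ENNReal.tendsto_ofReal hω))
      (Or.inr (hg_top ω))
  calc ∫⁻ ω, g ω / ENNReal.ofReal (u ω) ^ θ ∂ν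
      = ∫⁻ ω, liminf (fun n => g ω / ENNReal.ofReal (v (φ n) ω) ^ θ) atTop ∂ν :=
        lintegral_congr_ae (hlim.mono fun ω hω => hω.liminf_eq.symm)
    _ ≤ liminf (fun n => ∫⁻ ω, g ω / ENNReal.ofReal (v (φ n) ω) ^ θ ∂ν) atTop :=
        lintegral_liminf_le fun n =>
          hg.div ((Lp.stronglyMeasurable _).measurable.ennreal_ofReal.pow_const θ)
    _ ≤ B := by
        refine (liminf_le_liminf (.of_forall fun n => hv (φ n))).trans_eq ?_
        simp

/-- First-order condition at `k` when `k` maximizes `∫ f ^ s` over the segment from `k` to `g`. -/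
theorem lintegral_div_rpow_le_of_isMax {Ω : Type*} [MeasurableSpace Ω] {ν : Measure Ω} {s : ℝ}
    (hs0 : 0 < s) (hs1 : s < 1) {k g : Ω → ℝ≥0∞} (hk : Measurable k) (hg : Measurable g)
    (hk_top : ∀ ω, k ω ≠ ∞) (hg_top : ∀ ω, g ω ≠ ∞)
    (hM0 : ∫⁻ ω, k ω ^ s ∂ν ≠ 0) (hM : ∫⁻ ω, k ω ^ s ∂ν ≠ ∞)
    (hmax : ∀ a b : ℝ≥0, a + b = 1 →
      ∫⁻ ω, (a * k ω + b * g ω) ^ s ∂ν ≤ ∫⁻ ω, k ω ^ s ∂ν) :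
    ∫⁻ ω, g ω / k ω ^ (1 - s) ∂ν ≤ ∫⁻ ω, k ω ^ s ∂ν := by
  set M := ∫⁻ ω, k ω ^ s ∂ν with hMdef
  have hs1' : 0 < 1 - s := sub_pos.2 hs1
  have hstep : ∀ a b : ℝ≥0, a ≠ 0 → b ≠ 0 → a + b = 1 →
      ∫⁻ ω, g ω / (a * k ω + b * g ω) ^ (1 - s) ∂ν ≤ M := by
    intro a b ha hb hab
    set l : Ω → ℝ≥0∞ := fun ω => a * k ω + b * g ω with hl
    have hlm : Measurable l := (hk.const_mul _).add (hg.const_mul _)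
    have hl_top : ∀ ω, l ω ≠ ∞ := fun ω =>
      ENNReal.add_ne_top.2 ⟨ENNReal.mul_ne_top ENNReal.coe_ne_top (hk_top ω),
        ENNReal.mul_ne_top ENNReal.coe_ne_top (hg_top ω)⟩
    have hwm : Measurable fun ω => l ω ^ (1 - s) := hlm.pow_const _
    have hA : M ≤ ∫⁻ ω, k ω / l ω ^ (1 - s) ∂ν := by
      have h1 := lintegral_rpow_le_of_weight (ν := ν) hs0 hs1 hk hwm
        (.of_forall fun ω => ENNReal.rpow_ne_top_of_nonneg hs1'.le (hl_top ω))
        (.of_forall fun ω h => by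
          have : l ω = 0 := by simpa [ENNReal.rpow_eq_zero_iff, hs1', hs1'.not_gt] using h
          simp only [hl, add_eq_zero, mul_eq_zero, ENNReal.coe_eq_zero, ha, hb, false_or] at this
          exact this.1)
      have h2 : ∫⁻ ω, (l ω ^ (1 - s)) ^ (s / (1 - s)) ∂ν ≤ M := by
        refine le_trans (le_of_eq ?_) (hmax a b hab)
        simp_rw [← ENNReal.rpow_mul, mul_div_cancel₀ _ hs1'.ne', hl]
      have h3 : M ^ s * M ^ (1 - s) ≤ (∫⁻ ω, k ω / l ω ^ (1 - s) ∂ν) ^ s * M ^ (1 - s) := by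
        rw [← ENNReal.rpow_add _ _ hM0 hM, add_sub_cancel, ENNReal.rpow_one]
        exact h1.trans (by gcongr)
      have h4 := (ENNReal.mul_le_mul_iff_left
        (by simp [ENNReal.rpow_eq_zero_iff, hM0, hM])
        (ENNReal.rpow_ne_top_of_nonneg hs1'.le hM)).1 h3
      exact (ENNReal.rpow_le_rpow_iff hs0).1 h4
    have hsum : a * ∫⁻ ω, k ω / l ω ^ (1 - s) ∂ν + b * ∫⁻ ω, g ω / l ω ^ (1 - s) ∂ν ≤ M := by
      refine le_trans (le_of_eq ?_) (hmax a b hab)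
      have hkl : Measurable fun ω => k ω / l ω ^ (1 - s) := hk.div hwm
      have hgl : Measurable fun ω => g ω / l ω ^ (1 - s) := hg.div hwm
      rw [← lintegral_const_mul _ hkl, ← lintegral_const_mul _ hgl,
        ← lintegral_add_left (hkl.const_mul _)]
      refine lintegral_congr fun ω => ?_
      rw [← mul_div_assoc, ← mul_div_assoc, ← ENNReal.add_div]
      change l ω / _ = l ω ^ s
      by_cases h0 : l ω = 0
      · simp [h0, hs0, hs1']
      · nth_rewrite 1 [← ENNReal.rpow_one (l ω)]
        rw [← ENNReal.rpow_sub _ _ h0 (hl_top ω)]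
        congr 1
        ring
    have hle : a * M + b * ∫⁻ ω, g ω / l ω ^ (1 - s) ∂ν ≤ a * M + b * M := by
      rw [← add_mul (a : ℝ≥0∞), ← ENNReal.coe_add, hab, ENNReal.coe_one, one_mul]
      exact le_trans (by gcongr) hsum
    rw [ENNReal.add_le_add_iff_left (ENNReal.mul_ne_top ENNReal.coe_ne_top hM)] at hle
    exact (ENNReal.mul_le_mul_iff_right (by simpa) ENNReal.coe_ne_top).1 hle
  let b : ℕ → ℝ≥0 := fun n => 1 / ((n + 1 : ℕ) + 1 : ℝ≥0)
  have hb_pos : ∀ n, b n ≠ 0 := fun n => by positivity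
  have hb_lt : ∀ n, b n < 1 := fun n => by
    simp only [b]
    rw [div_lt_one (by positivity)]
    push_cast
    have : (0 : ℝ≥0) < n + 1 := by positivity
    exact lt_add_of_pos_left _ this
  have hb : Tendsto b atTop (𝓝 0) :=
    (tendsto_one_div_add_atTop_nhds_zero_nat (𝕜 := ℝ≥0)).comp (tendsto_add_atTop_nat 1)
  have ha : Tendsto (fun n => 1 - b n) atTop (𝓝 1) := by
    simpa using (tendsto_const_nhds (x := (1 : ℝ≥0))).sub hb
  have hlim : ∀ ω, Tendsto (fun n => g ω / (((1 - b n : ℝ≥0) : ℝ≥0∞) * k ω + b n * g ω) ^ (1 - s))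
      atTop (𝓝 (g ω / k ω ^ (1 - s))) := by
    intro ω
    refine ENNReal.Tendsto.const_div ?_ (Or.inr (hg_top ω))
    refine ((ENNReal.continuous_rpow_const (y := 1 - s)).tendsto _).comp ?_
    have h1 := ENNReal.Tendsto.mul_const (ENNReal.tendsto_coe.2 ha) (Or.inr (hk_top ω))
    have h2 := ENNReal.Tendsto.mul_const (ENNReal.tendsto_coe.2 hb) (Or.inr (hg_top ω))
    simpa using h1.add h2
  calc ∫⁻ ω, g ω / k ω ^ (1 - s) ∂ν
      = ∫⁻ ω, liminf (fun n =>
          g ω / (((1 - b n : ℝ≥0) : ℝ≥0∞) * k ω + b n * g ω) ^ (1 - s)) atTop ∂ν :=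
        lintegral_congr fun ω => (hlim ω).liminf_eq.symm
    _ ≤ liminf (fun n => ∫⁻ ω,
          g ω / (((1 - b n : ℝ≥0) : ℝ≥0∞) * k ω + b n * g ω) ^ (1 - s) ∂ν) atTop :=
        lintegral_liminf_le fun n =>
          hg.div (((hk.const_mul _).add (hg.const_mul _)).pow_const _)
    _ ≤ M := by
        refine (liminf_le_liminf (.of_forall fun n => hstep _ _
          (tsub_pos_of_lt (hb_lt n)).ne' (hb_pos n) (tsub_add_cancel_of_le (hb_lt n).le))).trans_eq ?_
        simp

/-- The weight for finitely many functions, obtained by maximizing the concave functional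
`∫ f ^ s` over their convex hull. -/
theorem exists_weight_of_fin {Ω : Type*} [MeasurableSpace Ω] {ν : Measure Ω} {s : ℝ}
    (hs0 : 0 < s) (hs1 : s < 1) {n : ℕ} {g : Fin n → Ω → ℝ≥0∞} (hg : ∀ i, Measurable (g i))
    (hg_top : ∀ i ω, g i ω ≠ ∞) {B : ℝ≥0∞} (hB : B ≠ ∞)
    (H : ∀ c : Fin n → ℝ≥0, ∫⁻ ω, (∑ i, c i * g i ω) ^ s ∂ν ≤ B * (∑ i, (c i : ℝ≥0∞)) ^ s) :
    ∃ h : Ω → ℝ≥0∞, Measurable h ∧ (∀ ω, h ω ≠ ∞) ∧ ∫⁻ ω, h ω ∂ν ≤ 1 ∧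
      ∀ i, ∫⁻ ω, g i ω / h ω ^ ((1 - s) / s) ∂ν ≤ B ^ (1 / s) := by
  classical
  rcases Nat.eq_zero_or_pos n with rfl | hn
  · exact ⟨0, measurable_const, by simp, by simp, fun i => i.elim0⟩
  have hs1' : 0 < 1 - s := sub_pos.2 hs1
  have hθ : 0 < (1 - s) / s := div_pos hs1' hs0
  let S := stdSimplex ℝ (Fin n)
  let k : (Fin n → ℝ) → Ω → ℝ≥0∞ := fun t ω => ∑ i, ENNReal.ofReal (t i) * g i ω
  have hkm : ∀ t, Measurable (k t) := fun t =>
    Finset.measurable_sum _ fun i _ => (hg i).const_mul _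
  have hk_top : ∀ t ω, k t ω ≠ ∞ := fun t ω =>
    ENNReal.sum_ne_top.2 fun i _ => ENNReal.mul_ne_top ENNReal.ofReal_ne_top (hg_top i ω)
  have hcont : ContinuousOn (fun t => ∫⁻ ω, k t ω ^ s ∂ν) S := by
    intro t _
    refine tendsto_lintegral_filter_of_dominated_convergence (fun ω => (∑ i, g i ω) ^ s)
      (.of_forall fun t => (hkm t).pow_const s) ?_ ?_ (.of_forall fun ω => ?_)
    · filter_upwards [self_mem_nhdsWithin] with t ht
      refine .of_forall fun ω => ENNReal.rpow_le_rpow (Finset.sum_le_sum fun i _ => ?_) hs0.le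
      refine mul_le_of_le_one_left' (ENNReal.ofReal_le_one.2 ?_)
      exact (mem_Icc_of_mem_stdSimplex ht i).2
    · refine ne_top_of_le_ne_top ?_ (le_trans (le_of_eq (by simp)) (H fun _ => 1))
      exact ENNReal.mul_ne_top hB (ENNReal.rpow_ne_top_of_nonneg hs0.le (by simp))
    · refine Tendsto.mono_left ?_ nhdsWithin_le_nhds
      refine ((ENNReal.continuous_rpow_const (y := s)).tendsto _).comp ?_
      refine tendsto_finsetSum _ fun i _ => ?_
      exact ENNReal.Tendsto.mul_const (ENNReal.tendsto_ofReal ((continuous_apply i).tendsto t))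
        (Or.inr (hg_top i ω))
  obtain ⟨t, htS, ht⟩ := (isCompact_stdSimplex ℝ (Fin n)).exists_isMaxOn
    ⟨_, single_mem_stdSimplex ℝ (⟨0, hn⟩ : Fin n)⟩ hcont
  have hmax : ∀ u ∈ S, ∫⁻ ω, k u ω ^ s ∂ν ≤ ∫⁻ ω, k t ω ^ s ∂ν := fun u hu => ht hu
  have hksingle : ∀ i ω, k (Pi.single i 1) ω = g i ω := by
    intro i ω
    simp only [k]
    rw [Finset.sum_eq_single i (fun j _ hj => by simp [hj]) (by simp)]
    simp
  have hMB : ∫⁻ ω, k t ω ^ s ∂ν ≤ B := by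
    refine (H fun i => (t i).toNNReal).trans_eq ?_
    have : ∑ i, ((t i).toNNReal : ℝ≥0∞) = 1 := by
      change ∑ i, ENNReal.ofReal (t i) = 1
      rw [← ENNReal.ofReal_sum_of_nonneg fun i _ => htS.1 i, htS.2, ENNReal.ofReal_one]
    rw [this, ENNReal.one_rpow, mul_one]
  by_cases hM0 : ∫⁻ ω, k t ω ^ s ∂ν = 0
  · refine ⟨0, measurable_const, by simp, by simp, fun i => ?_⟩
    have h1 : ∫⁻ ω, g i ω ^ s ∂ν = 0 := by
      have := hmax _ (single_mem_stdSimplex ℝ i)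
      simp only [hksingle] at this
      exact le_antisymm (this.trans_eq hM0) zero_le
    rw [lintegral_eq_zero_iff ((hg i).pow_const s)] at h1
    refine (lintegral_eq_zero_of_ae_eq_zero ?_).trans_le zero_le
    filter_upwards [h1] with ω hω
    have : g i ω = 0 := by simpa [ENNReal.rpow_eq_zero_iff, hs0, hs0.not_gt] using hω
    simp [this]
  have hM : ∫⁻ ω, k t ω ^ s ∂ν ≠ ∞ := ne_top_of_le_ne_top hB hMB
  set M := ∫⁻ ω, k t ω ^ s ∂ν with hMdef
  refine ⟨fun ω => k t ω ^ s / M, ((hkm t).pow_const s).div_const _, fun ω =>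
    ENNReal.div_ne_top (ENNReal.rpow_ne_top_of_nonneg hs0.le (hk_top t ω)) hM0, ?_, fun i => ?_⟩
  · simp_rw [div_eq_mul_inv]
    rw [lintegral_mul_const _ ((hkm t).pow_const s), ← hMdef, ENNReal.mul_inv_cancel hM0 hM]
  have hopt : ∫⁻ ω, g i ω / k t ω ^ (1 - s) ∂ν ≤ M := by
    refine lintegral_div_rpow_le_of_isMax hs0 hs1 (hkm t) (hg i) (hk_top t) (hg_top i) hM0 hM ?_
    intro a b hab
    have hmem : (a : ℝ) • t + (b : ℝ) • Pi.single i 1 ∈ S :=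
      convex_stdSimplex ℝ (Fin n) htS (single_mem_stdSimplex ℝ i) a.2 b.2 (by exact_mod_cast hab)
    refine le_trans (le_of_eq (lintegral_congr fun ω => ?_)) (hmax _ hmem)
    rw [← hksingle i ω]
    simp only [k]
    rw [Finset.mul_sum, Finset.mul_sum, ← Finset.sum_add_distrib]
    congr 1
    refine Finset.sum_congr rfl fun j _ => ?_
    have h1 : (0 : ℝ) ≤ (Pi.single i 1 : Fin n → ℝ) j := (single_mem_stdSimplex ℝ i).1 j
    rw [Pi.add_apply, Pi.smul_apply, Pi.smul_apply, smul_eq_mul, smul_eq_mul,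
      ENNReal.ofReal_add (mul_nonneg a.coe_nonneg (htS.1 j)) (mul_nonneg b.coe_nonneg h1),
      ENNReal.ofReal_mul a.coe_nonneg, ENNReal.ofReal_mul b.coe_nonneg, ENNReal.ofReal_coe_nnreal,
      ENNReal.ofReal_coe_nnreal]
    ring
  calc ∫⁻ ω, g i ω / (k t ω ^ s / M) ^ ((1 - s) / s) ∂ν
      = ∫⁻ ω, g i ω / k t ω ^ (1 - s) * M ^ ((1 - s) / s) ∂ν := by
        refine lintegral_congr fun ω => ?_
        rw [ENNReal.div_rpow_of_nonneg _ _ hθ.le, ← ENNReal.rpow_mul, mul_div_cancel₀ _ hs0.ne',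
          div_eq_mul_inv (g i ω), ENNReal.inv_div
          (Or.inl (ENNReal.rpow_ne_top_of_nonneg hθ.le hM))
          (Or.inl (by simp [ENNReal.rpow_eq_zero_iff, hM0, hM])), div_eq_mul_inv, div_eq_mul_inv (g i ω)]
        ring
    _ = (∫⁻ ω, g i ω / k t ω ^ (1 - s) ∂ν) * M ^ ((1 - s) / s) :=
        lintegral_mul_const _ ((hg i).div ((hkm t).pow_const _))
    _ ≤ M * M ^ ((1 - s) / s) := by gcongr
    _ = M ^ (1 / s) := by
        nth_rewrite 1 [← ENNReal.rpow_one M]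
        rw [← ENNReal.rpow_add _ _ hM0 hM]
        congr 1
        field_simp
        ring
    _ ≤ B ^ (1 / s) := by gcongr

theorem ENNReal.rpow_le_one_iff_of_pos {x : ℝ≥0∞} {z : ℝ} (hz : 0 < z) : x ^ z ≤ 1 ↔ x ≤ 1 := by
  simpa using ENNReal.rpow_le_rpow_iff (x := x) (y := 1) hz

/-- Maurey's factorization: if the convex combinations of a family of nonnegative functions are
bounded in `L^s` with `0 < s < 1`, a single weight bounds all of them in weighted `L^1`. -/
theorem exists_weight {Ω ι : Type*} [MeasurableSpace Ω] {ν : Measure Ω} {s : ℝ}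
    (hs0 : 0 < s) (hs1 : s < 1) {g : ι → Ω → ℝ≥0∞} (hg : ∀ i, Measurable (g i))
    (hg_top : ∀ i ω, g i ω ≠ ∞) {B : ℝ≥0∞} (hB : B ≠ ∞)
    (H : ∀ (n : ℕ) (y : Fin n → ι) (c : Fin n → ℝ≥0),
      ∫⁻ ω, (∑ i, c i * g (y i) ω) ^ s ∂ν ≤ B * (∑ i, (c i : ℝ≥0∞)) ^ s) :
    ∃ h : Ω → ℝ≥0∞, Measurable h ∧ (∀ ω, h ω ≠ ∞) ∧ ∫⁻ ω, h ω ∂ν ≤ 1 ∧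
      ∀ i, ∫⁻ ω, g i ω / h ω ^ ((1 - s) / s) ∂ν ≤ B ^ (1 / s) := by
  have hθ : 0 < 2 * ((1 - s) / s) := mul_pos two_pos (div_pos (sub_pos.2 hs1) hs0)
  have hnorm : ∀ v : Lp ℝ 2 ν, ‖v‖ ≤ 1 ↔ ∫⁻ ω, ‖v ω‖ₑ ^ (2 : ℝ) ∂ν ≤ 1 := fun v => by
    rw [← norm_one (α := ℝ), ← enorm_le_iff_norm_le, Lp.enorm_def,
      eLpNorm_eq_lintegral_rpow_enorm_toReal two_ne_zero ENNReal.ofNat_ne_top, enorm_one,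
      ENNReal.rpow_le_one_iff_of_pos (by simp), ENNReal.toReal_ofNat]
  obtain ⟨v, hv1, hv⟩ := exists_mem_iInter_of_convex_isClosed (H := Lp ℝ 2 ν) (R := 1)
    (K := fun i => {v : Lp ℝ 2 ν |
      ∫⁻ ω, g i ω / ENNReal.ofReal (v ω) ^ (2 * ((1 - s) / s)) ∂ν ≤ B ^ (1 / s)})
    (fun i => convex_setOf_lintegral_div_le hθ (hg i) _)
    (fun i => isClosed_setOf_lintegral_div_le (hg i) (hg_top i) _) (fun F => by
      obtain ⟨h, hm, h_top, h1, h2⟩ := exists_weight_of_fin (ν := ν) hs0 hs1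
        (g := fun k : Fin F.card => g (F.equivFin.symm k)) (fun _ => hg _) (fun _ => hg_top _) hB
        (H _ fun k => (F.equivFin.symm k : ι))
      let u : Ω → ℝ := fun ω => (h ω ^ (1 / 2 : ℝ)).toReal
      have hu_nonneg : ∀ ω, 0 ≤ u ω := fun ω => ENNReal.toReal_nonneg
      have hu : ∀ ω, ENNReal.ofReal (u ω) = h ω ^ (1 / 2 : ℝ) := fun ω =>
        ENNReal.ofReal_toReal (ENNReal.rpow_ne_top_of_nonneg (by norm_num) (h_top ω))
      have hu_enorm : ∀ ω, ‖u ω‖ₑ ^ (2 : ℝ) = h ω := fun ω => by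
        rw [Real.enorm_of_nonneg (hu_nonneg ω), hu, ← ENNReal.rpow_mul]
        norm_num
      have hum : Measurable u := (hm.pow_const _).ennreal_toReal
      have hmem : MemLp u 2 ν := by
        refine ⟨hum.aestronglyMeasurable, ?_⟩
        rw [eLpNorm_eq_lintegral_rpow_enorm_toReal two_ne_zero ENNReal.ofNat_ne_top]
        simp only [ENNReal.toReal_ofNat, hu_enorm]
        exact ENNReal.rpow_lt_top_of_nonneg (by norm_num)
          (ne_top_of_le_ne_top ENNReal.one_ne_top h1)
      have hcoe := hmem.coeFn_toLp
      refine ⟨hmem.toLp u, ?_, fun i hi => ?_⟩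
      · refine (hnorm _).2 (le_trans (le_of_eq (lintegral_congr_ae ?_)) h1)
        filter_upwards [hcoe] with ω hω
        rw [hω, hu_enorm]
      · have h3 := h2 (F.equivFin ⟨i, hi⟩)
        simp only [Equiv.symm_apply_apply] at h3
        refine le_trans (le_of_eq (lintegral_congr_ae ?_)) h3
        filter_upwards [hcoe] with ω hω
        rw [hω, hu, ← ENNReal.rpow_mul]
        congr 2
        ring)
  refine ⟨fun ω => ENNReal.ofReal (v ω) ^ (2 : ℝ),
    (Lp.stronglyMeasurable v).measurable.ennreal_ofReal.pow_const _,
    fun ω => ENNReal.rpow_ne_top_of_nonneg two_pos.le ENNReal.ofReal_ne_top, ?_, fun i => ?_⟩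
  · refine le_trans (lintegral_mono fun ω => ?_) ((hnorm v).1 hv1)
    exact ENNReal.rpow_le_rpow (Real.ofReal_le_enorm _) two_pos.le
  · have := hv i
    rw [Set.mem_ofPred_eq] at this
    simpa only [← ENNReal.rpow_mul] using this

/-- The vector-valued norm inequality as an inequality between lower Lebesgue integrals. -/
theorem eLpNorm_sum_rpow_le_iff {Ω : Type*} [MeasurableSpace Ω] {ν : Measure Ω} {p r C S : ℝ}
    (hp : 0 < p) (hr : 0 < r) (hC : 0 ≤ C) (hS : 0 ≤ S) {n : ℕ} (a : Fin n → Ω → ℝ) :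
    eLpNorm (fun ω => (∑ k, |a k ω| ^ r) ^ (1 / r)) (ENNReal.ofReal p) ν ≤
        ENNReal.ofReal (C * S ^ (1 / r)) ↔
      ∫⁻ ω, (∑ k, ENNReal.ofReal (|a k ω| ^ r)) ^ (p / r) ∂ν ≤
        ENNReal.ofReal (C ^ r * S) ^ (p / r) := by
  have hsum : ∀ ω, 0 ≤ ∑ k, |a k ω| ^ r := fun ω =>
    Finset.sum_nonneg fun k _ => Real.rpow_nonneg (abs_nonneg _) _
  have h1 : ENNReal.ofReal (C * S ^ (1 / r)) =
      (ENNReal.ofReal (C ^ r * S) ^ (p / r)) ^ (1 / p) := by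
    rw [← ENNReal.rpow_mul, ENNReal.ofReal_rpow_of_nonneg (by positivity) (by positivity),
      show p / r * (1 / p) = 1 / r by field_simp, Real.mul_rpow (by positivity) hS,
      ← Real.rpow_mul hC, mul_one_div_cancel hr.ne', Real.rpow_one]
  rw [eLpNorm_eq_lintegral_rpow_enorm_toReal (by simpa) ENNReal.ofReal_ne_top,
    ENNReal.toReal_ofReal hp.le, h1, ENNReal.rpow_le_rpow_iff (by positivity)]
  refine iff_of_eq (congrArg (· ≤ _) (lintegral_congr fun ω => ?_))
  rw [Real.enorm_of_nonneg (Real.rpow_nonneg (hsum ω) _),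
    ← ENNReal.ofReal_sum_of_nonneg fun k _ => Real.rpow_nonneg (abs_nonneg _) _,
    ← ENNReal.ofReal_rpow_of_nonneg (hsum ω) (by positivity), ← ENNReal.rpow_mul]
  congr 1
  ring

/-- **Maurey–Rosenthal theorem** (classical form): for a bounded linear operator
`T : E → L^p(ν)` with `1 ≤ p < r < ∞`, the vector-valued norm inequality (0.1)
holds with constant `C` iff the weighted norm inequality (0.2) holds with a
weight `w ≥ 0` satisfying `‖w‖_{L^{p/(r-p)}(ν)} ≤ 1`. -/
theorem maurey_rosenthal_Lp
    {Ω : Type*} [MeasurableSpace Ω] (ν : Measure Ω) [SigmaFinite ν]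
    (p r : ℝ) (hp : 1 ≤ p) (hpr : p < r)
    {E : Type*} [NormedAddCommGroup E] [NormedSpace ℝ E]
    [Fact (1 ≤ ENNReal.ofReal p)]
    (T : E →L[ℝ] Lp ℝ (ENNReal.ofReal p) ν) (C : ℝ) (hC : 0 ≤ C) :
    (∀ (n : ℕ) (x : Fin n → E),
        eLpNorm (fun ω => (∑ k, |T (x k) ω| ^ r) ^ (1 / r)) (ENNReal.ofReal p) ν ≤
          ENNReal.ofReal (C * (∑ k, ‖x k‖ ^ r) ^ (1 / r)))
      ↔
    (∃ w : Ω → ℝ, Measurable w ∧ (∀ ω, 0 ≤ w ω) ∧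
        eLpNorm w (ENNReal.ofReal (p / (r - p))) ν ≤ 1 ∧
        (∀ x : E,
          ∫⁻ ω, ENNReal.ofReal (|T x ω| ^ r) / ENNReal.ofReal (w ω) ∂ν ≤
            ENNReal.ofReal (C ^ r * ‖x‖ ^ r)) ∧
        (∀ x : E, ∀ᵐ ω ∂ν, w ω = 0 → T x ω = 0)) := by
  have hp0 : 0 < p := one_pos.trans_le hp
  have hr0 : 0 < r := hp0.trans hpr
  have hrp : 0 < r - p := sub_pos.2 hpr
  have hs0 : 0 < p / r := div_pos hp0 hr0
  have hs1 : p / r < 1 := (div_lt_one hr0).2 hpr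
  have hq0 : 0 < p / (r - p) := div_pos hp0 hrp
  have hTm : ∀ x : E, Measurable fun ω => ENNReal.ofReal (|T x ω| ^ r) := fun x =>
    ((Lp.stronglyMeasurable (T x)).measurable.abs.pow_const r).ennreal_ofReal
  have hweight : ∀ w : Ω → ℝ, (∀ ω, 0 ≤ w ω) →
      (eLpNorm w (ENNReal.ofReal (p / (r - p))) ν ≤ 1 ↔
        ∫⁻ ω, ENNReal.ofReal (w ω) ^ (p / (r - p)) ∂ν ≤ 1) := fun w hw => by
    rw [eLpNorm_eq_lintegral_rpow_enorm_toReal (by simpa) ENNReal.ofReal_ne_top,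
      ENNReal.toReal_ofReal hq0.le, ENNReal.rpow_le_one_iff_of_pos (by positivity)]
    simp only [Real.enorm_of_nonneg (hw _)]
  have hSnonneg : ∀ (n : ℕ) (x : Fin n → E), 0 ≤ ∑ k, ‖x k‖ ^ r := fun n x =>
    Finset.sum_nonneg fun k _ => Real.rpow_nonneg (norm_nonneg _) _
  have hsmul : ∀ (a : ℝ) (x : E), ∀ᵐ ω ∂ν, ENNReal.ofReal (|T (a • x) ω| ^ r) =
      ENNReal.ofReal (|a| ^ r) * ENNReal.ofReal (|T x ω| ^ r) := fun a x => by
    rw [map_smul]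
    filter_upwards [Lp.coeFn_smul a (T x)] with ω hω
    rw [hω, Pi.smul_apply, smul_eq_mul, abs_mul, Real.mul_rpow (abs_nonneg _) (abs_nonneg _),
      ENNReal.ofReal_mul (by positivity)]
  constructor
  · intro H
    obtain ⟨h, hm, h_top, h1, h2⟩ := exists_weight (ν := ν) hs0 hs1
      (g := fun (y : {y : E // ‖y‖ ≤ 1}) ω => ENNReal.ofReal (|T y ω| ^ r)) (fun y => hTm y)
      (fun _ _ => ENNReal.ofReal_ne_top) (B := ENNReal.ofReal (C ^ r) ^ (p / r))
      (ENNReal.rpow_ne_top_of_nonneg hs0.le ENNReal.ofReal_ne_top) (by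
        intro n y c
        have hc : ∀ k, |((c k : ℝ) ^ (1 / r))| ^ r = c k := fun k => by
          rw [abs_of_nonneg (by positivity), ← Real.rpow_mul (c k).coe_nonneg,
            one_div_mul_cancel hr0.ne', Real.rpow_one]
        have h1 := (eLpNorm_sum_rpow_le_iff hp0 hr0 hC (hSnonneg n _) _).1
          (H n fun k => ((c k : ℝ) ^ (1 / r)) • (y k : E))
        rw [← ENNReal.mul_rpow_of_nonneg _ _ hs0.le]
        refine le_trans (le_of_eq (lintegral_congr_ae ?_)) (h1.trans ?_)
        · filter_upwards [ae_all_iff.2 fun k => hsmul ((c k : ℝ) ^ (1 / r)) (y k : E)] with ω hω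
          simp only [hω, hc, ENNReal.ofReal_coe_nnreal]
        · refine ENNReal.rpow_le_rpow ?_ hs0.le
          rw [ENNReal.ofReal_mul (by positivity)]
          gcongr
          rw [ENNReal.ofReal_sum_of_nonneg fun k _ => by positivity]
          refine Finset.sum_le_sum fun k _ => ?_
          rw [norm_smul, Real.mul_rpow (norm_nonneg _) (norm_nonneg _), Real.norm_eq_abs, hc,
            ← ENNReal.ofReal_coe_nnreal]
          exact ENNReal.ofReal_le_ofReal (mul_le_of_le_one_right (c k).coe_nonneg
            (Real.rpow_le_one (norm_nonneg _) (y k).2 hr0.le)))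
    have hθ : (1 - p / r) / (p / r) = (r - p) / p := by field_simp
    rw [← ENNReal.rpow_mul, mul_one_div_cancel hs0.ne', ENNReal.rpow_one, hθ] at h2
    have hw : ∀ ω, ENNReal.ofReal (h ω ^ ((r - p) / p)).toReal = h ω ^ ((r - p) / p) := fun ω =>
      ENNReal.ofReal_toReal (ENNReal.rpow_ne_top_of_nonneg (by positivity) (h_top ω))
    have hbound : ∀ x : E, ∫⁻ ω, ENNReal.ofReal (|T x ω| ^ r) /
        ENNReal.ofReal (h ω ^ ((r - p) / p)).toReal ∂ν ≤ ENNReal.ofReal (C ^ r * ‖x‖ ^ r) := by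
      intro x
      have hy : ‖‖x‖⁻¹ • x‖ ≤ 1 := by
        rw [norm_smul, norm_inv, norm_norm]
        exact inv_mul_le_one
      have hx : ‖x‖ • ‖x‖⁻¹ • x = x := by
        rcases eq_or_ne x 0 with rfl | hx
        · simp
        · exact smul_inv_smul₀ (norm_ne_zero_iff.2 hx) x
      have h3 := hsmul ‖x‖ (‖x‖⁻¹ • x)
      rw [hx, abs_of_nonneg (norm_nonneg x)] at h3
      have hm' : Measurable fun ω =>
          ENNReal.ofReal (|T (‖x‖⁻¹ • x) ω| ^ r) / h ω ^ ((r - p) / p) :=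
        (hTm _).div (hm.pow_const _)
      calc ∫⁻ ω, ENNReal.ofReal (|T x ω| ^ r) / ENNReal.ofReal (h ω ^ ((r - p) / p)).toReal ∂ν
          = ∫⁻ ω, ENNReal.ofReal (‖x‖ ^ r) *
              (ENNReal.ofReal (|T (‖x‖⁻¹ • x) ω| ^ r) / h ω ^ ((r - p) / p)) ∂ν := by
            refine lintegral_congr_ae ?_
            filter_upwards [h3] with ω hω
            rw [hω, hw, mul_div_assoc]
        _ ≤ ENNReal.ofReal (‖x‖ ^ r) * ENNReal.ofReal (C ^ r) := by
            rw [lintegral_const_mul _ hm']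
            gcongr
            exact h2 ⟨_, hy⟩
        _ = ENNReal.ofReal (C ^ r * ‖x‖ ^ r) := by
            rw [mul_comm, ENNReal.ofReal_mul (by positivity)]
    have hwm : Measurable fun ω => (h ω ^ ((r - p) / p)).toReal :=
      (hm.pow_const _).ennreal_toReal
    refine ⟨fun ω => (h ω ^ ((r - p) / p)).toReal, hwm,
      fun ω => ENNReal.toReal_nonneg, ?_, hbound, fun x => ?_⟩
    · rw [hweight _ fun ω => ENNReal.toReal_nonneg]
      refine le_trans (le_of_eq (lintegral_congr fun ω => ?_)) h1
      rw [hw, ← ENNReal.rpow_mul, show (r - p) / p * (p / (r - p)) = 1 by field_simp,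
        ENNReal.rpow_one]
    · filter_upwards [ae_lt_top ((hTm x).div hwm.ennreal_ofReal)
        (ne_top_of_le_ne_top ENNReal.ofReal_ne_top (hbound x))] with ω hω h0
      by_contra hne
      have hpos : 0 < |T x ω| ^ r := Real.rpow_pos_of_pos (abs_pos.2 hne) r
      rw [Pi.div_apply, h0, ENNReal.ofReal_zero, ENNReal.div_zero (by simpa)] at hω
      exact lt_irrefl _ hω
  · rintro ⟨w, hwm, hw0, hw1, hwT, hwz⟩ n x
    rw [hweight w hw0] at hw1
    refine (eLpNorm_sum_rpow_le_iff hp0 hr0 hC (hSnonneg n x) fun k => T (x k)).2 ?_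
    have hGm : Measurable fun ω => ∑ k, ENNReal.ofReal (|T (x k) ω| ^ r) :=
      Finset.measurable_sum _ fun k _ => hTm (x k)
    have hq : p / r / (1 - p / r) = p / (r - p) := by field_simp
    refine (lintegral_rpow_le_of_weight hs0 hs1 hGm hwm.ennreal_ofReal
      (.of_forall fun _ => ENNReal.ofReal_ne_top) ?_).trans ?_
    · filter_upwards [ae_all_iff.2 fun k => hwz (x k)] with ω hω h0
      have h0' : w ω = 0 := le_antisymm (ENNReal.ofReal_eq_zero.1 h0) (hw0 ω)
      exact Finset.sum_eq_zero fun k _ => by simp [hω k h0', Real.zero_rpow hr0.ne']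
    · rw [hq]
      refine le_trans (mul_le_of_le_one_right' (ENNReal.rpow_le_one hw1 (sub_pos.2 hs1).le)) ?_
      refine ENNReal.rpow_le_rpow ?_ hs0.le
      rw [Finset.mul_sum, ENNReal.ofReal_sum_of_nonneg fun k _ => by positivity]
      simp_rw [div_eq_mul_inv, Finset.sum_mul]
      have hm : ∀ k, Measurable fun ω =>
          ENNReal.ofReal (|T (x k) ω| ^ r) * (ENNReal.ofReal (w ω))⁻¹ := fun k =>
        (hTm (x k)).mul hwm.ennreal_ofReal.inv
      rw [lintegral_finsetSum _ fun k _ => hm k]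
      refine Finset.sum_le_sum fun k _ => ?_
      simpa only [div_eq_mul_inv] using hwT (x k)
end

section
/- Let (Ω,ν) be a σ-finite measure space, let 0 < p < r < ∞, let E be a real normed space, and let T : E → L^p(ν) be a map satisfying T(cx) = c·T(x) for all c ≥ 0 and x ∈ E. Suppose T is r-convex with constant C, i.e., for every n and all x₁,…,xₙ ∈ E, ‖(∑_{k≤n} |Tx_k|^r)^{1/r}‖_{L^p(ν)} ≤ C (∑_{k≤n} ‖x_k‖_E^r)^{1/r}. Then there exists a measurable weight ω : Ω → [0,∞) with ‖ω‖_{L^{p/(r-p)}(ν)} ≤ C^r such that for every x ∈ E, (∫ |Tx|^r / ω dν)^{1/r} ≤ ‖x‖_E (in particular Tx = 0 ν-a.e. on {ω = 0}). -/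
open MeasureTheory ENNReal
open scoped NNReal ENNReal

theorem rpow_sub_rpow_mul_le {s y z q : ℝ} (hs0 : 0 < s) (hs1 : s < 1) (hz : 0 ≤ z)
    (hzy : z ≤ y) (hq : 0 < q) (hqy : q ≤ y) :
    (y ^ s - z ^ s) * q ^ (1 - s) ≤ y - z := by
  have hy : 0 < y := hq.trans_le hqy
  have hzs : z ≤ z ^ s * y ^ (1 - s) := by
    calc z = z ^ s * z ^ (1 - s) := by
          rw [← Real.rpow_add' hz (by simp), add_sub_cancel, Real.rpow_one]
      _ ≤ z ^ s * y ^ (1 - s) := by gcongr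
  have hys : y ^ s * y ^ (1 - s) = y := by
    rw [← Real.rpow_add hy, add_sub_cancel, Real.rpow_one]
  calc (y ^ s - z ^ s) * q ^ (1 - s) ≤ (y ^ s - z ^ s) * y ^ (1 - s) := by
        have : z ^ s ≤ y ^ s := by gcongr
        have : q ^ (1 - s) ≤ y ^ (1 - s) := Real.rpow_le_rpow hq.le hqy (by linarith)
        gcongr
    _ ≤ y - z := by rw [sub_mul, hys]; linarith

theorem rpow_uniformly_concave_aux {s y z q : ℝ} (hs0 : 0 < s) (hs1 : s < 1) (hz : 0 ≤ z)
    (hzy : z ≤ y) (hq : 0 ≤ q) (h : y ^ 2 + z ^ 2 = 2 * q ^ 2) :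
    s * (1 - s) / 4 * (y ^ s - z ^ s) ^ 2 + ((y ^ s) ^ 2 + (z ^ s) ^ 2) / 2 ≤ (q ^ s) ^ 2 := by
  rcases hq.eq_or_lt with rfl | hq
  · obtain rfl : y = 0 := by nlinarith
    obtain rfl : z = 0 := by nlinarith
    simp [Real.zero_rpow hs0.ne']
  have hy : 0 ≤ y := hz.trans hzy
  have hqy : q ≤ y := by nlinarith
  set R := q ^ (1 - s) with hR
  have hRpos : 0 < R := Real.rpow_pos_of_pos hq _
  have hqR : q ^ s * R = q := by
    rw [hR, ← Real.rpow_add hq, add_sub_cancel, Real.rpow_one]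
  have h1 := rpow_sub_rpow_mul_le hs0 hs1 hz hzy hq hqy
  have h1' : 0 ≤ (y ^ s - z ^ s) * R :=
    mul_nonneg (sub_nonneg.2 (Real.rpow_le_rpow hz hzy hs0.le)) hRpos.le
  have hy2 := Real.geom_mean_le_arith_mean2_weighted hs0.le (by linarith : 0 ≤ 1 - s) hy hq.le
    (by ring)
  have hz2 := Real.geom_mean_le_arith_mean2_weighted hs0.le (by linarith : 0 ≤ 1 - s) hz hq.le
    (by ring)
  rw [← hR] at hy2 hz2 h1
  have hyp : 0 ≤ y ^ s * R := by positivity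
  have hzp : 0 ≤ z ^ s * R := by positivity
  have e1 : ((y ^ s - z ^ s) * R) ^ 2 ≤ (y - z) ^ 2 := pow_le_pow_left₀ h1' h1 2
  have e2 := pow_le_pow_left₀ hyp hy2 2
  have e3 := pow_le_pow_left₀ hzp hz2 2
  have hss : 0 < s * (1 - s) := mul_pos hs0 (by linarith)
  have hsum : y + z ≤ 2 * q := by nlinarith [sq_nonneg (y - z)]
  have e4 : (y - z) ^ 2 ≤ 4 * (q * (2 * q - y - z)) := by nlinarith
  have e5 : s * (1 - s) / 4 * ((y ^ s - z ^ s) * R) ^ 2 ≤ s * (1 - s) * (q * (2 * q - y - z)) := by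
    nlinarith
  have e6 : R ^ 2 * (s * (1 - s) / 4 * (y ^ s - z ^ s) ^ 2 + ((y ^ s) ^ 2 + (z ^ s) ^ 2) / 2)
      ≤ R ^ 2 * (q ^ s) ^ 2 := by
    have : R ^ 2 * (q ^ s) ^ 2 = q ^ 2 := by rw [← mul_pow, mul_comm, hqR]
    rw [this]
    have e7 : ((s * y + (1 - s) * q) ^ 2 + (s * z + (1 - s) * q) ^ 2) / 2
      = q ^ 2 - s * (1 - s) * (q * (2 * q - y - z)) := by linear_combination s ^ 2 / 2 * h
    nlinarith
  exact le_of_mul_le_mul_left e6 (by positivity)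

/-- A quantitative form of the strict concavity of `x ↦ x ^ s` on `[0, ∞)`. -/
theorem rpow_uniformly_concave {s a b : ℝ} (hs0 : 0 < s) (hs1 : s < 1) (ha : 0 ≤ a)
    (hb : 0 ≤ b) :
    s * (1 - s) / 4 * (a ^ (s / 2) - b ^ (s / 2)) ^ 2 + (a ^ s + b ^ s) / 2 ≤
      ((a + b) / 2) ^ s := by
  have key : ∀ x : ℝ, 0 ≤ x → √x ^ s = x ^ (s / 2) ∧ (√x ^ s) ^ 2 = x ^ s := fun x hx => by
    constructor
    · rw [Real.sqrt_eq_rpow, ← Real.rpow_mul hx]; ring_nf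
    · rw [Real.sqrt_eq_rpow, ← Real.rpow_mul hx, ← Real.rpow_mul_natCast hx]
      congr 1; push_cast; ring
  have hm : 0 ≤ (a + b) / 2 := by positivity
  rw [← (key _ ha).1, ← (key _ hb).1, ← (key _ ha).2, ← (key _ hb).2, ← (key _ hm).2]
  have h : √a ^ 2 + √b ^ 2 = 2 * √((a + b) / 2) ^ 2 := by
    rw [Real.sq_sqrt ha, Real.sq_sqrt hb, Real.sq_sqrt hm]; ring
  rcases le_total (√b) (√a) with hab | hab
  · exact rpow_uniformly_concave_aux hs0 hs1 (Real.sqrt_nonneg _) hab (Real.sqrt_nonneg _) h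
  · have := rpow_uniformly_concave_aux hs0 hs1 (Real.sqrt_nonneg _) hab (Real.sqrt_nonneg _)
      (by rw [add_comm]; exact h)
    linarith [sub_sq_comm (√a ^ s) (√b ^ s), this]

/-- The tangent line inequality for the concave function `x ↦ x ^ s`. -/
theorem NNReal.rpow_add_mul_div_le {s : ℝ} (hs0 : 0 < s) (hs1 : s < 1) (x d : ℝ≥0) :
    x ^ s + s.toNNReal * (d / (x + d) ^ (1 - s)) ≤ (x + d) ^ s := by
  rcases eq_or_ne (x + d) 0 with h | h
  · obtain ⟨rfl, rfl⟩ := add_eq_zero.1 h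
    simp [hs0.ne']
  have hy : (0 : ℝ) < x + d := by exact_mod_cast pos_iff_ne_zero.2 h
  have hR : (0 : ℝ) < ((x : ℝ) + d) ^ (1 - s) := Real.rpow_pos_of_pos hy _
  have h1 := Real.geom_mean_le_arith_mean2_weighted hs0.le (by linarith : 0 ≤ 1 - s)
    x.coe_nonneg hy.le (by ring)
  have h2 : ((x : ℝ) + d) ^ s * ((x : ℝ) + d) ^ (1 - s) = x + d := by
    rw [← Real.rpow_add hy, add_sub_cancel, Real.rpow_one]
  rw [← NNReal.coe_le_coe]
  push_cast
  rw [Real.coe_toNNReal _ hs0.le]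
  refine le_of_mul_le_mul_right ?_ hR
  rw [h2, add_mul, mul_assoc, div_mul_cancel₀ _ hR.ne']
  linarith

theorem MeasureTheory.eLpNorm_two_sq_eq_lintegral {Ω : Type*} [MeasurableSpace Ω] {ν : Measure Ω}
    (u : Ω → ℝ) : eLpNorm u 2 ν ^ 2 = ∫⁻ ω, ‖u ω‖ₑ ^ 2 ∂ν := by
  have := eLpNorm_nnreal_pow_eq_lintegral (f := u) (μ := ν) (p := 2) (by simp)
  simpa only [NNReal.coe_ofNat, ENNReal.rpow_ofNat, ENNReal.coe_ofNat] using this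

theorem enorm_rpow_half_sq {s : ℝ} (x : ℝ≥0) :
    ‖((x ^ (s / 2) : ℝ≥0) : ℝ)‖ₑ ^ 2 = ((x ^ s : ℝ≥0) : ℝ≥0∞) := by
  rw [Real.enorm_of_nonneg (NNReal.coe_nonneg _), ENNReal.ofReal_coe_nnreal, ← ENNReal.coe_pow,
    ← NNReal.rpow_mul_natCast]
  congr 2; push_cast; ring

theorem MeasureTheory.Lp.norm_toLp_two_sq {Ω : Type*} [MeasurableSpace Ω] {ν : Measure Ω}
    {u : Ω → ℝ} (hu : MemLp u 2 ν) : ‖hu.toLp u‖ ^ 2 = (∫⁻ ω, ‖u ω‖ₑ ^ 2 ∂ν).toReal := by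
  rw [Lp.norm_toLp, ← ENNReal.toReal_pow, eLpNorm_two_sq_eq_lintegral]

theorem memLp_two_rpow_half {Ω : Type*} [MeasurableSpace Ω] {ν : Measure Ω} {s : ℝ}
    {f : Ω → ℝ≥0} (hf : Measurable f) (hfin : ∫⁻ ω, (f ω ^ s : ℝ≥0) ∂ν ≠ ∞) :
    MemLp (fun ω => ((f ω ^ (s / 2) : ℝ≥0) : ℝ)) 2 ν := by
  refine ⟨(hf.pow_const _).coe_nnreal_real.aestronglyMeasurable, ?_⟩
  have h2 : eLpNorm (fun ω => ((f ω ^ (s / 2) : ℝ≥0) : ℝ)) 2 ν ^ 2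
      = ∫⁻ ω, (f ω ^ s : ℝ≥0) ∂ν := by
    simp_rw [eLpNorm_two_sq_eq_lintegral, enorm_rpow_half_sq]
  rw [lt_top_iff_ne_top]
  intro h
  rw [h] at h2
  exact hfin (by simp [← h2])

theorem lintegral_rpow_uniformly_concave {Ω : Type*} [MeasurableSpace Ω] {ν : Measure Ω} {s : ℝ}
    (hs0 : 0 < s) (hs1 : s < 1) {f g : Ω → ℝ≥0} (hf : Measurable f) (hg : Measurable g) :
    ENNReal.ofReal (s * (1 - s) / 4) *
        ∫⁻ ω, ‖((f ω ^ (s / 2) : ℝ≥0) : ℝ) - ((g ω ^ (s / 2) : ℝ≥0) : ℝ)‖ₑ ^ 2 ∂ν +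
      2⁻¹ * (∫⁻ ω, (f ω ^ s : ℝ≥0) ∂ν + ∫⁻ ω, (g ω ^ s : ℝ≥0) ∂ν) ≤
    ∫⁻ ω, ((2⁻¹ * f ω + 2⁻¹ * g ω) ^ s : ℝ≥0) ∂ν := by
  rw [← lintegral_add_left (by fun_prop), ← lintegral_const_mul _ (by fun_prop),
    ← lintegral_const_mul _ (by fun_prop), ← lintegral_add_left (by fun_prop)]
  refine lintegral_mono fun ω => ?_
  have h := rpow_uniformly_concave hs0 hs1 (f ω).coe_nonneg (g ω).coe_nonneg
  have hc : 0 ≤ s * (1 - s) / 4 := by nlinarith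
  rw [← ofReal_norm, ← ENNReal.ofReal_pow (norm_nonneg _), Real.norm_eq_abs, sq_abs,
    ← ENNReal.ofReal_mul hc]
  have e : (2⁻¹ * ((f ω ^ s : ℝ≥0) + (g ω ^ s : ℝ≥0)) : ℝ≥0∞)
      = ENNReal.ofReal (((f ω : ℝ) ^ s + (g ω : ℝ) ^ s) / 2) := by
    rw [div_eq_inv_mul, ENNReal.ofReal_mul (by norm_num), ENNReal.ofReal_inv_of_pos (by norm_num),
      ENNReal.ofReal_add (by positivity) (by positivity), ← NNReal.coe_rpow, ← NNReal.coe_rpow,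
      ENNReal.ofReal_coe_nnreal, ENNReal.ofReal_coe_nnreal]
    norm_num
  rw [e, ← ENNReal.ofReal_add (by positivity) (by positivity), ← ENNReal.ofReal_coe_nnreal]
  refine ENNReal.ofReal_le_ofReal ?_
  push_cast
  convert h using 2
  ring

/-- A maximizing sequence of `f ↦ ∫ f ^ s` in a convex set has a subsequence converging almost
everywhere to a function at which the supremum is attained. -/
theorem exists_tendsto_ae_lintegral_rpow_eq {Ω : Type*} [MeasurableSpace Ω] {ν : Measure Ω}
    {s : ℝ} (hs0 : 0 < s) (hs1 : s < 1) {f : ℕ → Ω → ℝ≥0} (hf : ∀ n, Measurable (f n))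
    {M : ℝ≥0∞} (hM : M ≠ ∞) (hmid : ∀ n m, ∫⁻ ω, ((2⁻¹ * f n ω + 2⁻¹ * f m ω) ^ s : ℝ≥0) ∂ν ≤ M)
    (hlim : Filter.Tendsto (fun n => ∫⁻ ω, (f n ω ^ s : ℝ≥0) ∂ν) Filter.atTop (nhds M)) :
    ∃ (g : Ω → ℝ≥0) (k : ℕ → ℕ), Measurable g ∧ ∫⁻ ω, (g ω ^ s : ℝ≥0) ∂ν = M ∧
      ∀ᵐ ω ∂ν, Filter.Tendsto (fun n => f (k n) ω) Filter.atTop (nhds (g ω)) := by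
  have hfin : ∀ n, ∫⁻ ω, (f n ω ^ s : ℝ≥0) ∂ν ≠ ∞ := fun n => by
    refine ne_top_of_le_ne_top hM ((le_of_eq ?_).trans (hmid n n))
    refine lintegral_congr fun ω => ?_
    rw [← add_mul, ← two_mul, mul_inv_cancel₀ two_ne_zero, one_mul]
  have hmem := fun n => memLp_two_rpow_half (hf n) (hfin n)
  let U : ℕ → Lp ℝ 2 ν := fun n => (hmem n).toLp _
  have hU : ∀ n, ‖U n‖ ^ 2 = (∫⁻ ω, (f n ω ^ s : ℝ≥0) ∂ν).toReal := fun n => by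
    rw [Lp.norm_toLp_two_sq]
    simp_rw [enorm_rpow_half_sq]
  have hUlim : Filter.Tendsto (fun n => ‖U n‖ ^ 2) Filter.atTop (nhds M.toReal) := by
    simp_rw [hU]
    exact (ENNReal.tendsto_toReal hM).comp hlim
  set c := s * (1 - s) / 4 with hc
  have hcpos : 0 < c := by have := mul_pos hs0 (sub_pos.2 hs1); positivity
  have hdist : ∀ n m, c * ‖U n - U m‖ ^ 2 + 2⁻¹ * (‖U n‖ ^ 2 + ‖U m‖ ^ 2) ≤ M.toReal := by
    intro n m
    have h := ENNReal.toReal_mono hM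
      ((lintegral_rpow_uniformly_concave (ν := ν) hs0 hs1 (hf n) (hf m)).trans (hmid n m))
    have hsub : ‖U n - U m‖ ^ 2 = (∫⁻ ω, ‖((f n ω ^ (s / 2) : ℝ≥0) : ℝ)
        - ((f m ω ^ (s / 2) : ℝ≥0) : ℝ)‖ₑ ^ 2 ∂ν).toReal := by
      rw [← MemLp.toLp_sub, Lp.norm_toLp_two_sq]
      rfl
    have hne := (lintegral_rpow_uniformly_concave (ν := ν) hs0 hs1 (hf n) (hf m)).trans (hmid n m)
      |>.trans_lt hM.lt_top
    rw [ENNReal.add_lt_top] at hne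
    rw [ENNReal.toReal_add hne.1.ne hne.2.ne, ENNReal.toReal_mul, ENNReal.toReal_mul,
      ENNReal.toReal_add (hfin n) (hfin m), ← hsub, ← hU, ← hU, ENNReal.toReal_ofReal hcpos.le] at h
    simpa using h
  have hcauchy : CauchySeq U := by
    rw [Metric.cauchySeq_iff]
    intro ε hε
    have h := hUlim.eventually_const_lt (sub_lt_self M.toReal (by positivity : 0 < c * ε ^ 2))
    obtain ⟨N, hN⟩ := Filter.eventually_atTop.1 h
    refine ⟨N, fun m hm n hn => ?_⟩
    rw [dist_eq_norm]
    have h1 := hN m hm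
    have h2 := hN n hn
    have h3 := hdist m n
    refine lt_of_pow_lt_pow_left₀ 2 hε.le ?_
    refine lt_of_mul_lt_mul_left ?_ hcpos.le
    linarith
  obtain ⟨V, hV⟩ := cauchySeq_tendsto_of_complete hcauchy
  obtain ⟨k, -, hk⟩ := (tendstoInMeasure_of_tendsto_Lp hV).exists_seq_tendsto_ae
  have hVM : ‖V‖ ^ 2 = M.toReal := tendsto_nhds_unique (hV.norm.pow 2) hUlim
  refine ⟨fun ω => ‖V ω‖₊ ^ (2 / s), k, ?_, ?_, ?_⟩
  · exact (Lp.stronglyMeasurable V).measurable.nnnorm.pow_const _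
  · have hVmem := Lp.memLp V
    have h1 := Lp.norm_toLp_two_sq hVmem
    rw [Lp.toLp_coeFn, hVM] at h1
    have h3 : ∫⁻ ω, ‖V ω‖ₑ ^ 2 ∂ν ≠ ∞ := by
      rw [← eLpNorm_two_sq_eq_lintegral]
      exact ENNReal.pow_ne_top hVmem.2.ne
    rw [(ENNReal.toReal_eq_toReal_iff' hM h3).1 h1]
    refine lintegral_congr fun ω => ?_
    rw [← NNReal.rpow_mul, div_mul_cancel₀ _ hs0.ne', NNReal.rpow_ofNat]
    rfl
  · have hae : ∀ᵐ ω ∂ν, ∀ n, U n ω = ((f n ω ^ (s / 2) : ℝ≥0) : ℝ) :=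
      ae_all_iff.2 fun n => (hmem n).coeFn_toLp
    filter_upwards [hk, hae] with ω h1 h2
    have h3 := (h1.nnnorm).nnrpow (tendsto_const_nhds (x := 2 / s)) (Or.inr (by positivity))
    refine h3.congr fun n => ?_
    rw [h2, Real.nnnorm_of_nonneg (NNReal.coe_nonneg _)]
    change (f (k n) ω ^ (s / 2)) ^ (2 / s) = _
    rw [← NNReal.rpow_mul]
    have : s / 2 * (2 / s) = 1 := by field_simp
    rw [this, NNReal.rpow_one]

/-- First order optimality condition for the maximum of `f ↦ ∫ f ^ s`. -/
theorem lintegral_div_rpow_le_of_lintegral_add_rpow_le {Ω : Type*} [MeasurableSpace Ω]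
    {ν : Measure Ω} {s : ℝ} (hs0 : 0 < s) (hs1 : s < 1) {f g : Ω → ℝ≥0} (hf : Measurable f)
    (hg : Measurable g) (hfin : ∫⁻ ω, (g ω ^ s : ℝ≥0) ∂ν ≠ ∞)
    (h : ∀ t : ℝ≥0, 0 < t → ∫⁻ ω, ((g ω + t * f ω) ^ s : ℝ≥0) ∂ν ≤
      (1 + t) ^ s * ∫⁻ ω, (g ω ^ s : ℝ≥0) ∂ν) :
    ∫⁻ ω, (f ω : ℝ≥0∞) / (g ω ^ (1 - s) : ℝ≥0) ∂ν ≤ ∫⁻ ω, (g ω ^ s : ℝ≥0) ∂ν := by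
  set M := ∫⁻ ω, (g ω ^ s : ℝ≥0) ∂ν with hM
  have hF : ∀ t : ℝ≥0, 0 < t →
      ∫⁻ ω, ((f ω / (g ω + t * f ω) ^ (1 - s) : ℝ≥0) : ℝ≥0∞) ∂ν ≤ M := by
    intro t ht
    set I := ∫⁻ ω, ((f ω / (g ω + t * f ω) ^ (1 - s) : ℝ≥0) : ℝ≥0∞) ∂ν with hI
    have h1 : M + (s.toNNReal * t : ℝ≥0) * I ≤ ∫⁻ ω, ((g ω + t * f ω) ^ s : ℝ≥0) ∂ν := by
      rw [hM, hI, ← lintegral_const_mul _ (by fun_prop), ← lintegral_add_left (by fun_prop)]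
      refine lintegral_mono fun ω => ?_
      have := NNReal.rpow_add_mul_div_le hs0 hs1 (g ω) (t * f ω)
      rw [← ENNReal.coe_mul, ← ENNReal.coe_add]
      refine ENNReal.coe_le_coe.2 ((le_of_eq ?_).trans this)
      ring
    have h2 : ((1 + t : ℝ≥0∞)) ^ s ≤ 1 + (s.toNNReal * t : ℝ≥0) := by
      have : (1 + t) ^ s ≤ 1 + s.toNNReal * t := by
        rw [← NNReal.coe_le_coe]
        push_cast
        rw [Real.coe_toNNReal _ hs0.le]
        exact rpow_one_add_le_one_add_mul_self (by linarith [t.coe_nonneg]) hs0.le hs1.le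
      rw [← ENNReal.coe_one, ← ENNReal.coe_add, ← ENNReal.coe_rpow_of_nonneg _ hs0.le,
        ← ENNReal.coe_add]
      exact ENNReal.coe_le_coe.2 this
    have h3 : M + (s.toNNReal * t : ℝ≥0) * I ≤ M + (s.toNNReal * t : ℝ≥0) * M := by
      calc _ ≤ _ := h1
        _ ≤ _ := h t ht
        _ ≤ (1 + (s.toNNReal * t : ℝ≥0)) * M := by gcongr
        _ = _ := by rw [add_mul, one_mul]
    have hst : s.toNNReal * t ≠ 0 := mul_ne_zero (by simpa using hs0) ht.ne'
    exact (ENNReal.mul_le_mul_iff_right (by exact_mod_cast hst) ENNReal.coe_ne_top).1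
      ((ENNReal.add_le_add_iff_left hfin).1 h3)
  let t : ℕ → ℝ≥0 := fun n => 1 / ((n : ℝ≥0) + 1)
  have htpos : ∀ n, 0 < t n := fun n => by positivity
  have htlim : Filter.Tendsto t Filter.atTop (nhds 0) := tendsto_one_div_add_atTop_nhds_zero_nat
  have hlim : ∀ ω, Filter.Tendsto
      (fun n => ((f ω / (g ω + t n * f ω) ^ (1 - s) : ℝ≥0) : ℝ≥0∞)) Filter.atTop
      (nhds ((f ω : ℝ≥0∞) / (g ω ^ (1 - s) : ℝ≥0))) := by
    intro ω
    rcases eq_or_ne (f ω) 0 with hf0 | hf0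
    · simp [hf0]
    have hden : Filter.Tendsto (fun n => (((g ω + t n * f ω) ^ (1 - s) : ℝ≥0) : ℝ≥0∞))
        Filter.atTop (nhds (g ω ^ (1 - s) : ℝ≥0)) := by
      refine ENNReal.tendsto_coe.2 ?_
      have h1 : Filter.Tendsto (fun n => g ω + t n * f ω) Filter.atTop (nhds (g ω)) := by
        simpa using (htlim.mul_const (f ω)).const_add (g ω)
      exact ((NNReal.continuous_rpow_const (by linarith)).tendsto _).comp h1
    refine (ENNReal.Tendsto.div tendsto_const_nhds (Or.inl (by exact_mod_cast hf0)) hden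
      (Or.inr ENNReal.coe_ne_top)).congr fun n => ?_
    refine (ENNReal.coe_div ?_).symm
    have : 0 < g ω + t n * f ω := add_pos_of_nonneg_of_pos (zero_le)
      (mul_pos (htpos n) (pos_iff_ne_zero.2 hf0))
    exact (NNReal.rpow_pos this).ne'
  calc ∫⁻ ω, (f ω : ℝ≥0∞) / (g ω ^ (1 - s) : ℝ≥0) ∂ν
      = ∫⁻ ω, Filter.liminf (fun n => ((f ω / (g ω + t n * f ω) ^ (1 - s) : ℝ≥0) : ℝ≥0∞))
          Filter.atTop ∂ν := lintegral_congr fun ω => (hlim ω).liminf_eq.symm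
    _ ≤ _ := lintegral_liminf_le fun n => by fun_prop
    _ ≤ M := by
      refine (Filter.liminf_le_liminf (Filter.Eventually.of_forall fun n => hF _ (htpos n))).trans
        (Filter.liminf_const M).le

/-- A convex set of nonnegative functions that is bounded in `L^s`, `0 < s < 1`, is bounded in a
weighted `L¹` whose weight is given by a single function in `L^s`. -/
theorem exists_weight_of_convex_of_lintegral_rpow_le {Ω : Type*} [MeasurableSpace Ω]
    {ν : Measure Ω} {s : ℝ} (hs0 : 0 < s) (hs1 : s < 1) {A : Set (Ω → ℝ≥0)} (hA : A.Nonempty)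
    (hmeas : ∀ f ∈ A, Measurable f) (hconv : Convex ℝ≥0 A) {K : ℝ≥0∞} (hKtop : K ≠ ∞)
    (hK : ∀ f ∈ A, ∫⁻ ω, (f ω ^ s : ℝ≥0) ∂ν ≤ K) :
    ∃ g : Ω → ℝ≥0, Measurable g ∧ ∫⁻ ω, (g ω ^ s : ℝ≥0) ∂ν ≤ K ∧
      ∀ f ∈ A, ∫⁻ ω, (f ω : ℝ≥0∞) / (g ω ^ (1 - s) : ℝ≥0) ∂ν ≤ K := by
  let J : (Ω → ℝ≥0) → ℝ≥0∞ := fun f => ∫⁻ ω, (f ω ^ s : ℝ≥0) ∂ν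
  set M := sSup (J '' A) with hMdef
  have hMK : M ≤ K := sSup_le (by rintro _ ⟨f, hf, rfl⟩; exact hK f hf)
  have hMtop : M ≠ ∞ := ne_top_of_le_ne_top hKtop hMK
  have hle : ∀ f ∈ A, J f ≤ M := fun f hf => le_sSup ⟨f, hf, rfl⟩
  obtain ⟨v, -, hv, hvA⟩ := exists_seq_tendsto_sSup (hA.image J) (OrderTop.bddAbove _)
  choose f hfA hfv using hvA
  have hlim : Filter.Tendsto (fun n => J (f n)) Filter.atTop (nhds M) := by simpa only [hfv] using hv
  obtain ⟨g, k, hg, hgM, hk⟩ := exists_tendsto_ae_lintegral_rpow_eq hs0 hs1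
    (fun n => hmeas _ (hfA n)) hMtop
    (fun n m => hle _ (hconv (hfA n) (hfA m) (zero_le) (zero_le)
      (by rw [← two_mul, mul_inv_cancel₀ two_ne_zero]))) hlim
  refine ⟨g, hg, hgM.trans_le hMK, fun h hh => ?_⟩
  have hhm := hmeas h hh
  rw [← hgM] at hMK hMtop
  refine (lintegral_div_rpow_le_of_lintegral_add_rpow_le hs0 hs1 hhm hg hMtop
    fun t ht => ?_).trans hMK
  rw [hgM]
  have hbound : ∀ n, ∫⁻ ω, ((f (k n) ω + t * h ω) ^ s : ℝ≥0) ∂ν ≤ (1 + t) ^ s * M := by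
    intro n
    have h1t : (1 + t) ≠ 0 := by positivity
    have hmem := hle _ (hconv (hfA (k n)) hh (zero_le (a := (1 + t)⁻¹))
      (zero_le (a := (1 + t)⁻¹ * t)) (by field_simp))
    calc ∫⁻ ω, ((f (k n) ω + t * h ω) ^ s : ℝ≥0) ∂ν
        = (1 + t) ^ s * J ((1 + t)⁻¹ • f (k n) + ((1 + t)⁻¹ * t) • h) := by
          rw [← ENNReal.coe_one, ← ENNReal.coe_add, ← ENNReal.coe_rpow_of_nonneg _ hs0.le,
            ← lintegral_const_mul']
          · refine lintegral_congr fun ω => ?_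
            rw [← ENNReal.coe_mul, ← NNReal.mul_rpow]
            simp only [Pi.add_apply, Pi.smul_apply, smul_eq_mul]
            congr 2
            field_simp
          · exact ENNReal.coe_ne_top
      _ ≤ _ := by gcongr
  calc ∫⁻ ω, ((g ω + t * h ω) ^ s : ℝ≥0) ∂ν
      = ∫⁻ ω, Filter.liminf (fun n => (((f (k n) ω + t * h ω) ^ s : ℝ≥0) : ℝ≥0∞))
          Filter.atTop ∂ν := by
        refine lintegral_congr_ae ?_
        filter_upwards [hk] with ω hω
        refine (Filter.Tendsto.liminf_eq (ENNReal.tendsto_coe.2 ?_)).symm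
        exact ((NNReal.continuous_rpow_const hs0.le).tendsto _).comp (hω.add_const _)
    _ ≤ _ := lintegral_liminf_le fun n => by
        have := hmeas _ (hfA (k n))
        fun_prop
    _ ≤ (1 + t) ^ s * M :=
      (Filter.liminf_le_liminf (Filter.Eventually.of_forall hbound)).trans
        (Filter.liminf_const _).le

/-- A homogeneous map of degree `r` into nonnegative functions whose sums satisfy an `L^s` bound,
`0 < s < 1`, is bounded in a weighted `L¹`. -/
theorem exists_weight_of_lintegral_sum_rpow_le {Ω : Type*} [MeasurableSpace Ω] {ν : Measure Ω}
    {E : Type*} [NormedAddCommGroup E] [NormedSpace ℝ E] {r s : ℝ} (hr : 0 < r) (hs0 : 0 < s)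
    (hs1 : s < 1) {F : E → Ω → ℝ≥0} (hF : ∀ x, Measurable (F x))
    (hFhom : ∀ (c : ℝ≥0) (x : E), F ((c : ℝ) • x) =ᵐ[ν] fun ω => c ^ r * F x ω)
    {K : ℝ≥0∞} (hKtop : K ≠ ∞)
    (hK : ∀ (n : ℕ) (x : Fin n → E), ∑ k, ‖x k‖₊ ^ r ≤ 1 →
      ∫⁻ ω, ((∑ k, F (x k) ω) ^ s : ℝ≥0) ∂ν ≤ K) :
    ∃ g : Ω → ℝ≥0, Measurable g ∧ ∫⁻ ω, (g ω ^ s : ℝ≥0) ∂ν ≤ K ∧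
      ∀ x, ‖x‖₊ ≤ 1 → ∫⁻ ω, (F x ω : ℝ≥0∞) / (g ω ^ (1 - s) : ℝ≥0) ∂ν ≤ K := by
  let A : Set (Ω → ℝ≥0) := {f | Measurable f ∧ ∃ (n : ℕ) (x : Fin n → E),
    ∑ k, ‖x k‖₊ ^ r ≤ 1 ∧ f =ᵐ[ν] fun ω => ∑ k, F (x k) ω}
  have hmem : ∀ x, ‖x‖₊ ≤ 1 → F x ∈ A := fun x hx =>
    ⟨hF x, 1, fun _ => x, by simpa using NNReal.rpow_le_one hx hr.le, by simp⟩
  have hconv : Convex ℝ≥0 A := by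
    rintro f ⟨hf, n, x, hx, hfx⟩ h ⟨hh, m, y, hy, hhy⟩ a b - - hab
    have hroot : ∀ c : ℝ≥0, (c ^ (1 / r)) ^ r = c := fun c => by
      rw [← NNReal.rpow_mul, one_div_mul_cancel hr.ne', NNReal.rpow_one]
    have hnorm : ∀ (c : ℝ≥0) (z : E), ‖((c ^ (1 / r) : ℝ≥0) : ℝ) • z‖₊ ^ r = c * ‖z‖₊ ^ r :=
      fun c z => by
        rw [nnnorm_smul, Real.nnnorm_of_nonneg (NNReal.coe_nonneg _), NNReal.mul_rpow]
        congr 1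
        exact hroot c
    refine ⟨by simpa only [smul_eq_mul] using (hf.const_smul a).add (hh.const_smul b), n + m,
      Fin.append (fun k => ((a ^ (1 / r) : ℝ≥0) : ℝ) • x k)
        (fun k => ((b ^ (1 / r) : ℝ≥0) : ℝ) • y k), ?_, ?_⟩
    · simp only [Fin.sum_univ_add, Fin.append_left, Fin.append_right, hnorm, ← Finset.mul_sum]
      calc a * ∑ k, ‖x k‖₊ ^ r + b * ∑ k, ‖y k‖₊ ^ r ≤ a * 1 + b * 1 := by gcongr
        _ = 1 := by rw [mul_one, mul_one, hab]
    · have h1 := ae_all_iff.2 fun k => hFhom (a ^ (1 / r)) (x k)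
      have h2 := ae_all_iff.2 fun k => hFhom (b ^ (1 / r)) (y k)
      filter_upwards [h1, h2, hfx, hhy] with ω h1 h2 h3 h4
      simp only [Fin.sum_univ_add, Fin.append_left, Fin.append_right, h1, h2, hroot,
        ← Finset.mul_sum, Pi.add_apply, Pi.smul_apply, smul_eq_mul, h3, h4]
  obtain ⟨g, hg, hgK, hA⟩ := exists_weight_of_convex_of_lintegral_rpow_le hs0 hs1
    ⟨F 0, hmem 0 (by simp)⟩ (fun f hf => hf.1) hconv hKtop (by
      rintro f ⟨-, n, x, hx, hfx⟩
      refine (lintegral_congr_ae ?_).trans_le (hK n x hx)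
      filter_upwards [hfx] with ω h
      rw [h])
  exact ⟨g, hg, hgK, fun x hx => hA _ (hmem x hx)⟩

theorem MeasureTheory.lintegral_div_mul_const_le_one {Ω : Type*} [MeasurableSpace Ω]
    {ν : Measure Ω} {f g : Ω → ℝ≥0} (hf : Measurable f) (hg : Measurable g) {K : ℝ≥0}
    (h : ∫⁻ ω, (f ω : ℝ≥0∞) / g ω ∂ν ≤ K) :
    ∫⁻ ω, (f ω : ℝ≥0∞) / (g ω * K : ℝ≥0) ∂ν ≤ 1 := by
  rcases eq_or_ne K 0 with rfl | hK
  · have h0 : ∫⁻ ω, (f ω : ℝ≥0∞) / g ω ∂ν = 0 := by simpa using h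
    rw [lintegral_eq_zero_iff (by fun_prop)] at h0
    refine (lintegral_eq_zero_of_ae_eq_zero ?_).trans_le zero_le_one
    filter_upwards [h0] with ω hω
    rcases ENNReal.div_eq_zero_iff.1 hω with h | h
    · simp [h]
    · exact absurd h ENNReal.coe_ne_top
  · have hK' : (K : ℝ≥0∞) ≠ 0 := by exact_mod_cast hK
    calc ∫⁻ ω, (f ω : ℝ≥0∞) / (g ω * K : ℝ≥0) ∂ν
        = ∫⁻ ω, (f ω : ℝ≥0∞) / g ω * (K : ℝ≥0∞)⁻¹ ∂ν := by
          refine lintegral_congr fun ω => ?_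
          rw [ENNReal.coe_mul, div_eq_mul_inv, ENNReal.mul_inv (Or.inr ENNReal.coe_ne_top)
            (Or.inr hK'), div_eq_mul_inv, mul_assoc]
      _ = (∫⁻ ω, (f ω : ℝ≥0∞) / g ω ∂ν) * (K : ℝ≥0∞)⁻¹ :=
          lintegral_mul_const _ (by fun_prop)
      _ ≤ K * (K : ℝ≥0∞)⁻¹ := by gcongr
      _ = 1 := ENNReal.mul_inv_cancel hK' ENNReal.coe_ne_top

theorem eLpNorm_rpow_mul_const_le {Ω : Type*} [MeasurableSpace Ω] {ν : Measure Ω} {p r : ℝ}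
    (hp : 0 < p) (hpr : p < r) {g : Ω → ℝ≥0} {C : ℝ≥0}
    (h : ∫⁻ ω, (g ω ^ (p / r) : ℝ≥0) ∂ν ≤ (C ^ p : ℝ≥0)) :
    eLpNorm (fun ω => ((g ω ^ (1 - p / r) * C ^ p : ℝ≥0) : ℝ)) (ENNReal.ofReal (p / (r - p))) ν ≤
      ENNReal.ofReal ((C : ℝ) ^ r) := by
  have hr : 0 < r := hp.trans hpr
  have hrp : 0 < r - p := sub_pos.2 hpr
  have hq : 0 < p / (r - p) := div_pos hp hrp
  rw [eLpNorm_eq_lintegral_rpow_enorm_toReal (by simpa using hq) ENNReal.ofReal_ne_top,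
    ENNReal.toReal_ofReal hq.le]
  have hpt : ∀ ω, ‖((g ω ^ (1 - p / r) * C ^ p : ℝ≥0) : ℝ)‖ₑ ^ (p / (r - p)) =
      ((C ^ p) ^ (p / (r - p)) : ℝ≥0) * (g ω ^ (p / r) : ℝ≥0) := fun ω => by
    rw [Real.enorm_of_nonneg (NNReal.coe_nonneg _), ENNReal.ofReal_coe_nnreal,
      ← ENNReal.coe_rpow_of_nonneg _ hq.le, ← ENNReal.coe_mul, NNReal.mul_rpow,
      ← NNReal.rpow_mul (g ω), mul_comm]
    congr 3
    field_simp
  simp_rw [hpt]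
  rw [lintegral_const_mul' _ _ ENNReal.coe_ne_top]
  calc _ ≤ (((C ^ p) ^ (p / (r - p)) : ℝ≥0) * (C ^ p : ℝ≥0) : ℝ≥0∞) ^ (1 / (p / (r - p))) := by
        gcongr
    _ = ((C ^ r : ℝ≥0) : ℝ≥0∞) := by
        rw [← ENNReal.coe_mul, ← ENNReal.coe_rpow_of_nonneg _ (by positivity), ← NNReal.rpow_mul,
          ← NNReal.rpow_add_of_nonneg _ (by positivity) hp.le, ← NNReal.rpow_mul]
        congr 2
        field_simp
        ring
    _ = _ := by rw [← NNReal.coe_rpow, ENNReal.ofReal_coe_nnreal]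

/-- **Corollary 2 (first part)** for `Y = L^p(ν)`: an `r`-convex homogeneous operator
`T : E → L^p(ν)` (`0 < p < r < ∞`) with constant `C` satisfies a weighted norm
inequality with a weight `ω ≥ 0`, `‖ω‖_{L^{p/(r-p)}(ν)} ≤ C^r`. -/
theorem maurey_rosenthal_homogeneous_into_Lp
    {Ω : Type*} [MeasurableSpace Ω] (ν : Measure Ω) [SigmaFinite ν]
    (p r : ℝ) (hp : 0 < p) (hpr : p < r)
    {E : Type*} [NormedAddCommGroup E] [NormedSpace ℝ E]
    (T : E → Lp ℝ (ENNReal.ofReal p) ν)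
    (hThom : ∀ (c : ℝ), 0 ≤ c → ∀ x : E, T (c • x) = c • T x)
    (C : ℝ) (hC : 0 ≤ C)
    (hTconv : ∀ (n : ℕ) (x : Fin n → E),
      eLpNorm (fun ω => (∑ k, |T (x k) ω| ^ r) ^ (1 / r)) (ENNReal.ofReal p) ν ≤
        ENNReal.ofReal (C * (∑ k, ‖x k‖ ^ r) ^ (1 / r))) :
    ∃ w : Ω → ℝ, Measurable w ∧ (∀ ω, 0 ≤ w ω) ∧
      eLpNorm w (ENNReal.ofReal (p / (r - p))) ν ≤ ENNReal.ofReal (C ^ r) ∧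
      (∀ x : E,
        (∫⁻ ω, ENNReal.ofReal (|T x ω| ^ r) / ENNReal.ofReal (w ω) ∂ν) ^ (1 / r) ≤
          ENNReal.ofReal ‖x‖) ∧
      (∀ x : E, ∀ᵐ ω ∂ν, w ω = 0 → T x ω = 0) := by
  have hr : 0 < r := hp.trans hpr
  lift C to ℝ≥0 using hC
  have hmeas : ∀ x, Measurable (T x) := fun x => (Lp.stronglyMeasurable (T x)).measurable
  let F : E → Ω → ℝ≥0 := fun x ω => ‖T x ω‖₊ ^ r
  have hF : ∀ x, Measurable (F x) := fun x => (hmeas x).nnnorm.pow_const r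
  have hFreal : ∀ x ω, ((F x ω : ℝ≥0) : ℝ) = |T x ω| ^ r := fun x ω => by simp [F]
  have hFhom : ∀ (c : ℝ≥0) (x : E), F ((c : ℝ) • x) =ᵐ[ν] fun ω => c ^ r * F x ω := by
    intro c x
    simp only [F]
    rw [hThom c c.coe_nonneg x]
    filter_upwards [Lp.coeFn_smul (c : ℝ) (T x)] with ω hω
    rw [hω, Pi.smul_apply, nnnorm_smul, Real.nnnorm_of_nonneg c.coe_nonneg, NNReal.mul_rpow]
    rfl
  have hsum : ∀ (n : ℕ) (x : Fin n → E), ∑ k, ‖x k‖₊ ^ r ≤ 1 →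
      ∫⁻ ω, ((∑ k, F (x k) ω) ^ (p / r) : ℝ≥0) ∂ν ≤ (C ^ p : ℝ≥0) := by
    intro n x hx
    have h := hTconv n x
    have hx' : ∑ k, ‖x k‖ ^ r ≤ 1 := by simpa using NNReal.coe_le_coe.2 hx
    have hx0 : 0 ≤ ∑ k, ‖x k‖ ^ r := by positivity
    have hC' : ENNReal.ofReal (C * (∑ k, ‖x k‖ ^ r) ^ (1 / r)) ≤ C := by
      rw [← ENNReal.ofReal_coe_nnreal]
      exact ENNReal.ofReal_le_ofReal
        (mul_le_of_le_one_right C.coe_nonneg (Real.rpow_le_one hx0 hx' (by positivity)))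
    replace h := h.trans hC'
    rw [eLpNorm_eq_lintegral_rpow_enorm_toReal (by simpa using hp) ENNReal.ofReal_ne_top,
      ENNReal.toReal_ofReal hp.le, one_div p, ENNReal.rpow_inv_le_iff hp] at h
    rw [ENNReal.coe_rpow_of_nonneg _ hp.le]
    refine (lintegral_congr fun ω => ?_).trans_le h
    have : (∑ k, |T (x k) ω| ^ r) ^ (1 / r) = (((∑ k, F (x k) ω) ^ (1 / r) : ℝ≥0) : ℝ) := by
      push_cast
      simp only [hFreal]
    rw [this, Real.enorm_of_nonneg (NNReal.coe_nonneg _), ENNReal.ofReal_coe_nnreal,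
      ← ENNReal.coe_rpow_of_nonneg _ hp.le, ← NNReal.rpow_mul, one_div_mul_eq_div]
  obtain ⟨g, hg, hgK, hFg⟩ := exists_weight_of_lintegral_sum_rpow_le hr (div_pos hp hr)
    ((div_lt_one hr).2 hpr) hF hFhom ENNReal.coe_ne_top hsum
  let w : Ω → ℝ≥0 := fun ω => g ω ^ (1 - p / r) * C ^ p
  have hw : Measurable w := (hg.pow_const _).mul_const _
  have hball : ∀ x, ‖x‖₊ ≤ 1 → ∫⁻ ω, (F x ω : ℝ≥0∞) / w ω ∂ν ≤ 1 := fun x hx =>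
    lintegral_div_mul_const_le_one (hF x) (hg.pow_const _) (hFg x hx)
  have hbound : ∀ x, ∫⁻ ω, (F x ω : ℝ≥0∞) / w ω ∂ν ≤ (‖x‖₊ ^ r : ℝ≥0) := by
    intro x
    have hx : ((‖x‖₊ : ℝ≥0) : ℝ) • ‖x‖⁻¹ • x = x := by
      rcases eq_or_ne x 0 with rfl | hx
      · simp
      · rw [coe_nnnorm, smul_inv_smul₀ (norm_ne_zero_iff.2 hx)]
    have hx1 : ‖‖x‖⁻¹ • x‖₊ ≤ 1 := by
      rw [nnnorm_smul, nnnorm_inv, nnnorm_norm]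
      exact inv_mul_le_one
    have hae := hFhom ‖x‖₊ (‖x‖⁻¹ • x)
    rw [hx] at hae
    calc ∫⁻ ω, (F x ω : ℝ≥0∞) / w ω ∂ν
        = ∫⁻ ω, (‖x‖₊ ^ r : ℝ≥0) * ((F (‖x‖⁻¹ • x) ω : ℝ≥0∞) / w ω) ∂ν := by
          refine lintegral_congr_ae ?_
          filter_upwards [hae] with ω hω
          rw [hω, ENNReal.coe_mul, mul_div_assoc]
      _ = (‖x‖₊ ^ r : ℝ≥0) * ∫⁻ ω, (F (‖x‖⁻¹ • x) ω : ℝ≥0∞) / w ω ∂ν :=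
          lintegral_const_mul' _ _ ENNReal.coe_ne_top
      _ ≤ (‖x‖₊ ^ r : ℝ≥0) * 1 := by gcongr; exact hball _ hx1
      _ = _ := mul_one _
  refine ⟨fun ω => w ω, hw.coe_nnreal_real, fun ω => NNReal.coe_nonneg _,
    eLpNorm_rpow_mul_const_le hp hpr hgK, fun x => ?_, fun x => ?_⟩
  · simp_rw [← hFreal, ENNReal.ofReal_coe_nnreal]
    rw [one_div, ENNReal.rpow_inv_le_iff hr, ← coe_nnnorm x, ENNReal.ofReal_coe_nnreal,
      ← ENNReal.coe_rpow_of_nonneg _ hr.le]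
    exact hbound x
  · have hFx := hF x
    filter_upwards [ae_lt_top (by fun_prop) ((hbound x).trans_lt ENNReal.coe_lt_top).ne]
      with ω hω hw0
    have hw0' : w ω = 0 := by exact_mod_cast hw0
    by_contra hT
    have hFne : F x ω ≠ 0 := by simp [F, hT, hr.ne']
    rw [hw0', ENNReal.coe_zero, ENNReal.div_zero (by exact_mod_cast hFne)] at hω
    exact hω.ne rfl
end

section
/- Let (Ω,μ) be a σ-finite measure space, let 1 ≤ q < ∞ and 0 < r < q, let F be a real normed space, and let T : L^q(μ) → F be a map satisfying T(cx) = c·T(x) for all c ≥ 0. Suppose T is r-concave with constant C, i.e., for every n and all x₁,…,xₙ ∈ L^q(μ), (∑_{k≤n} ‖Tx_k‖_F^r)^{1/r} ≤ C ‖(∑_{k≤n} |x_k|^r)^{1/r}‖_{L^q(μ)}. Then there exists a measurable function w : Ω → [0,∞) with ‖w‖_{L^{q/(q-r)}(μ)} ≤ 1 such that for every x ∈ L^q(μ), ‖Tx‖_F ≤ C (∫ |x|^r w dμ)^{1/r}. -/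
open MeasureTheory ENNReal
open scoped NNReal ENNReal
open Filter Topology

/-- Hahn–Banach for a convex cone `D` in `E × ℝ` on which the second coordinate is dominated by
`K` times the norm of the first: some functional bounded by `K` dominates it on all of `D`. -/
lemma exists_continuousLinearMap_ge_of_cone {E : Type*} [NormedAddCommGroup E] [NormedSpace ℝ E]
    (D : Set (E × ℝ)) (K : ℝ) (hK : 0 ≤ K) (hzero : (0, 0) ∈ D)
    (hadd : ∀ d ∈ D, ∀ e ∈ D, d + e ∈ D) (hsmul : ∀ c : ℝ, 0 < c → ∀ d ∈ D, c • d ∈ D)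
    (hD : ∀ d ∈ D, d.2 ≤ K * ‖d.1‖) :
    ∃ φ : E →L[ℝ] ℝ, (∀ f, φ f ≤ K * ‖f‖) ∧ ∀ d ∈ D, d.2 ≤ φ d.1 := by
  have : Nonempty D := ⟨⟨_, hzero⟩⟩
  set N : E → ℝ := fun f => ⨅ d : D, (K * ‖f + d.1.1‖ - d.1.2) with hN
  have hbdd : ∀ f, BddBelow (Set.range fun d : D => K * ‖f + d.1.1‖ - d.1.2) := by
    intro f
    refine ⟨-(K * ‖f‖), ?_⟩
    rintro _ ⟨d, rfl⟩
    have h1 := hD d.1 d.2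
    have h2 : ‖d.1.1‖ ≤ ‖f + d.1.1‖ + ‖f‖ := by
      simpa using norm_sub_le (f + d.1.1) f
    have h3 := mul_le_mul_of_nonneg_left h2 hK
    simp only
    linarith
  have hle : ∀ f, ∀ d ∈ D, N f ≤ K * ‖f + d.1‖ - d.2 := fun f d hd =>
    ciInf_le (hbdd f) (⟨d, hd⟩ : D)
  have hhom_le : ∀ c : ℝ, 0 < c → ∀ f, N (c • f) ≤ c * N f := by
    intro c hc f
    rw [hN, Real.mul_iInf_of_nonneg hc.le]
    refine le_ciInf fun d => ?_
    refine (hle (c • f) _ (hsmul c hc d.1 d.2)).trans_eq ?_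
    rw [Prod.smul_fst, Prod.smul_snd, ← smul_add, norm_smul, Real.norm_of_nonneg hc.le,
      smul_eq_mul]
    ring
  have hhom : ∀ c : ℝ, 0 < c → ∀ f, N (c • f) = c * N f := by
    intro c hc f
    refine le_antisymm (hhom_le c hc f) ?_
    have := hhom_le c⁻¹ (inv_pos.2 hc) (c • f)
    rwa [inv_smul_smul₀ hc.ne', ← div_eq_inv_mul, le_div_iff₀' hc] at this
  have hNadd : ∀ f g, N (f + g) ≤ N f + N g := by
    intro f g
    refine le_ciInf_add_ciInf fun d e => ?_
    refine (hle (f + g) _ (hadd d.1 d.2 e.1 e.2)).trans ?_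
    have h2 : ‖f + g + (d.1 + e.1).1‖ ≤ ‖f + d.1.1‖ + ‖g + e.1.1‖ := by
      rw [Prod.fst_add, add_add_add_comm]
      exact norm_add_le _ _
    have h3 := mul_le_mul_of_nonneg_left h2 hK
    rw [Prod.snd_add]
    linarith
  have hN0 : N 0 = 0 := by
    have := hhom 2 (by norm_num) 0
    rw [smul_zero] at this
    linarith
  obtain ⟨g, -, hg⟩ := exists_extension_of_le_sublinear (⊥ : E →ₗ.[ℝ] ℝ) N hhom hNadd (by
    rintro ⟨x, hx⟩
    obtain rfl : x = 0 := (Submodule.mem_bot ℝ).1 hx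
    exact ((LinearPMap.map_zero _).trans hN0.symm).le)
  have hgK : ∀ f, g f ≤ K * ‖f‖ := fun f =>
    (hg f).trans (by simpa using hle f _ hzero)
  refine ⟨g.mkContinuous K fun f => abs_le.2 ⟨?_, hgK f⟩, hgK, fun d hd => ?_⟩
  · have := hgK (-f)
    rw [map_neg, norm_neg] at this
    linarith
  · have := (hg (-d.1)).trans (hle (-d.1) d hd)
    rw [map_neg, neg_add_cancel, norm_zero, mul_zero] at this
    simp only [LinearMap.mkContinuous_apply]
    linarith

/-- Dominated convergence in `L^p`, for nonnegative functions below their limit. -/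
lemma MeasureTheory.Lp.tendsto_of_nonneg_le {Ω : Type*} [MeasurableSpace Ω] {μ : Measure Ω}
    {p : ℝ≥0∞} [Fact (1 ≤ p)] (hp : p ≠ ∞) {F : ℕ → Lp ℝ p μ} {f : Lp ℝ p μ}
    (h0 : ∀ n, ∀ᵐ ω ∂μ, 0 ≤ F n ω) (hle : ∀ n, ∀ᵐ ω ∂μ, F n ω ≤ f ω)
    (hlim : ∀ᵐ ω ∂μ, Tendsto (fun n => F n ω) atTop (𝓝 (f ω))) :
    Tendsto F atTop (𝓝 f) := by
  have hp0 : p ≠ 0 := (zero_lt_one.trans_le (Fact.out : 1 ≤ p)).ne'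
  have hpr : 0 < p.toReal := ENNReal.toReal_pos hp0 hp
  rw [Lp.tendsto_Lp_iff_tendsto_eLpNorm']
  simp_rw [eLpNorm_eq_lintegral_rpow_enorm_toReal hp0 hp]
  rw [← ENNReal.zero_rpow_of_pos (one_div_pos.2 hpr)]
  refine ((ENNReal.continuous_rpow_const).tendsto _).comp ?_
  rw [← lintegral_zero (μ := μ)]
  refine tendsto_lintegral_of_dominated_convergence' (fun ω => ‖f ω‖ₑ ^ p.toReal) (fun n => ?_)
    (fun n => ?_) ?_ ?_
  · exact ((Lp.aestronglyMeasurable _).sub (Lp.aestronglyMeasurable _)).enorm.pow_const _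
  · filter_upwards [h0 n, hle n] with ω h1 h2
    gcongr
    rw [enorm_le_iff_norm_le, Pi.sub_apply, Real.norm_eq_abs, Real.norm_eq_abs,
      abs_of_nonneg (h1.trans h2), abs_le]
    constructor <;> linarith
  · exact (lintegral_rpow_enorm_lt_top_of_eLpNorm_lt_top hp0 hp (Lp.eLpNorm_lt_top f)).ne
  · filter_upwards [hlim] with ω h
    have h1 : Tendsto (fun n => F n ω - f ω) atTop (𝓝 0) := by
      simpa using h.sub_const (f ω)
    have h2 := ((ENNReal.continuous_rpow_const (y := p.toReal)).tendsto _).comp h1.enorm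
    simpa [ENNReal.zero_rpow_of_pos hpr, Function.comp_def] using h2

section PositiveFunctional

variable {Ω : Type*} [MeasurableSpace Ω] {μ : Measure Ω} {p : ℝ≥0∞}

lemma exists_pos_memLp_of_sigmaFinite (μ : Measure Ω) [SigmaFinite μ] (hp0 : p ≠ 0) (hp : p ≠ ∞) :
    ∃ h : Ω → ℝ, Measurable h ∧ (∀ ω, 0 < h ω) ∧ MemLp h p μ := by
  have hpr : 0 < p.toReal := ENNReal.toReal_pos hp0 hp
  obtain ⟨g, hgpos, hgm, hgint⟩ := exists_pos_lintegral_lt_of_sigmaFinite μ one_ne_zero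
  have hm : Measurable fun ω => ((g ω ^ (1 / p.toReal) : ℝ≥0) : ℝ) := by fun_prop
  refine ⟨_, hm, fun ω => NNReal.coe_pos.2 (NNReal.rpow_pos (hgpos ω)),
    hm.aestronglyMeasurable, ?_⟩
  rw [eLpNorm_lt_top_iff_lintegral_rpow_enorm_lt_top hp0 hp]
  refine lt_of_le_of_lt (le_of_eq (lintegral_congr fun ω => ?_)) (hgint.trans one_lt_top)
  rw [NNReal.enorm_eq, ← ENNReal.coe_rpow_of_nonneg _ hpr.le, ← NNReal.rpow_mul,
    one_div_mul_cancel hpr.ne', NNReal.rpow_one]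

lemma ofReal_map_sum_of_nonneg {ι : Type*} [Fact (1 ≤ p)] {φ : Lp ℝ p μ →L[ℝ] ℝ}
    (hφ : ∀ f, 0 ≤ f → 0 ≤ φ f) (s : Finset ι) {F : ι → Lp ℝ p μ} (hF : ∀ i, 0 ≤ F i) :
    ENNReal.ofReal (φ (∑ i ∈ s, F i)) = ∑ i ∈ s, ENNReal.ofReal (φ (F i)) := by
  rw [map_sum, ENNReal.ofReal_sum_of_nonneg fun i _ => hφ _ (hF i)]

lemma MeasureTheory.MemLp.toLp_nonneg {f : Ω → ℝ} (hf : MemLp f p μ) (h0 : ∀ ω, 0 ≤ f ω) :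
    0 ≤ hf.toLp f := by
  rw [← Lp.coeFn_nonneg]
  filter_upwards [hf.coeFn_toLp] with ω h
  simpa [h] using h0 ω

/-- A positive functional on `L^p`, evaluated at the truncations `s.indicator h` of a fixed
nonnegative function `h`, is a measure in `s`. -/
lemma exists_measure_apply_eq_of_positive [Fact (1 ≤ p)] (hp : p ≠ ∞) {φ : Lp ℝ p μ →L[ℝ] ℝ}
    (hφ : ∀ f, 0 ≤ f → 0 ≤ φ f) {h : Ω → ℝ} (h0 : ∀ ω, 0 ≤ h ω) (hh : MemLp h p μ) :
    ∃ ν : Measure Ω, ∀ s (hs : MeasurableSet s),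
      ν s = ENNReal.ofReal (φ ((hh.indicator hs).toLp (s.indicator h))) := by
  refine ⟨Measure.ofMeasurable
    (fun s hs => ENNReal.ofReal (φ ((hh.indicator hs).toLp (s.indicator h)))) ?_ ?_,
    fun s hs => Measure.ofMeasurable_apply s hs⟩
  · have : (hh.indicator MeasurableSet.empty).toLp (Set.indicator ∅ h) = 0 := by
      simp only [Set.indicator_empty']
      exact MemLp.toLp_zero _
    rw [this, map_zero, ofReal_zero]
  intro A hA hdisj
  have hnn : ∀ i, ∀ ω, 0 ≤ (A i).indicator h ω := fun i =>
    Set.indicator_nonneg fun ω _ => h0 ω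
  have hsum : ∀ ω, HasSum (fun i => (A i).indicator h ω) ((⋃ i, A i).indicator h ω) := by
    intro ω
    by_cases hω : ∃ j, ω ∈ A j
    · obtain ⟨j, hj⟩ := hω
      rw [Set.indicator_of_mem (Set.mem_iUnion_of_mem j hj),
        ← Set.indicator_of_mem hj h]
      exact hasSum_single j fun i hi =>
        Set.indicator_of_notMem (fun hωi => (Set.disjoint_left.1 (hdisj hi) hωi) hj) h
    · rw [Set.indicator_of_notMem (by simpa using hω)]
      have : ∀ i, (A i).indicator h ω = 0 := fun i =>
        Set.indicator_of_notMem (fun hi => hω ⟨i, hi⟩) h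
      simp [this, hasSum_zero]
  set F : ℕ → Lp ℝ p μ := fun i => (hh.indicator (hA i)).toLp ((A i).indicator h)
  have hFω : ∀ n, ∀ᵐ ω ∂μ,
      (∑ i ∈ Finset.range n, F i : Lp ℝ p μ) ω = ∑ i ∈ Finset.range n, (A i).indicator h ω := by
    intro n
    have h1 : ∀ᵐ ω ∂μ, ∀ i, F i ω = (A i).indicator h ω :=
      ae_all_iff.2 fun i => (hh.indicator (hA i)).coeFn_toLp
    filter_upwards [h1, Lp.coeFn_fun_finsetSum (Finset.range n) F] with ω h1 h2
    rw [h2]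
    exact Finset.sum_congr rfl fun i _ => h1 i
  have hU := (hh.indicator (MeasurableSet.iUnion hA)).coeFn_toLp
  have hlim : Tendsto (fun n => ∑ i ∈ Finset.range n, F i) atTop
      (𝓝 ((hh.indicator (MeasurableSet.iUnion hA)).toLp ((⋃ i, A i).indicator h))) := by
    refine Lp.tendsto_of_nonneg_le hp (fun n => ?_) (fun n => ?_) ?_
    · filter_upwards [hFω n] with ω h1
      rw [h1]
      exact Finset.sum_nonneg fun i _ => hnn i ω
    · filter_upwards [hFω n, hU] with ω h1 h2
      rw [h1, h2]
      exact sum_le_hasSum _ (fun i _ => hnn i ω) (hsum ω)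
    · filter_upwards [ae_all_iff.2 hFω, hU] with ω h1 h2
      simp_rw [h1, h2]
      exact (hsum ω).tendsto_sum_nat
  have h1 := (ENNReal.continuous_ofReal.comp φ.continuous).tendsto _ |>.comp hlim
  refine tendsto_nhds_unique h1 ?_
  refine (ENNReal.tendsto_nat_tsum _).congr fun n => ?_
  exact (ofReal_map_sum_of_nonneg hφ _ fun i => (hh.indicator (hA i)).toLp_nonneg (hnn i)).symm

/-- If a positive functional `φ` on `L^p` satisfies `φ (1_s h) = ν s` for all measurable `s`, then
`φ (k h) = ∫ k dν` for every measurable `k ≥ 0` such that `k h ∈ L^p`. -/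
lemma ofReal_map_toLp_mul_eq_lintegral [Fact (1 ≤ p)] (hp : p ≠ ∞) {φ : Lp ℝ p μ →L[ℝ] ℝ}
    (hφ : ∀ f, 0 ≤ f → 0 ≤ φ f) {h : Ω → ℝ} (h0 : ∀ ω, 0 ≤ h ω) (hhm : Measurable h)
    (hh : MemLp h p μ) {ν : Measure Ω}
    (hν : ∀ s (hs : MeasurableSet s),
      ν s = ENNReal.ofReal (φ ((hh.indicator hs).toLp (s.indicator h))))
    {k : Ω → ℝ≥0∞} (hk : Measurable k) (hktop : ∀ ω, k ω ≠ ∞)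
    (hkh : MemLp (fun ω => (k ω).toReal * h ω) p μ) :
    ENNReal.ofReal (φ (hkh.toLp _)) = ∫⁻ ω, k ω ∂ν := by
  have hle : ∀ {f g : Ω → ℝ≥0∞}, Measurable f → (∀ ω, g ω ≠ ∞) → (∀ ω, f ω ≤ g ω) →
      MemLp (fun ω => (g ω).toReal * h ω) p μ → MemLp (fun ω => (f ω).toReal * h ω) p μ := by
    intro f g hf hg hfg hgh
    refine hgh.mono (hf.ennreal_toReal.mul hhm).aestronglyMeasurable (ae_of_all _ fun ω => ?_)
    rw [norm_mul, norm_mul, Real.norm_of_nonneg toReal_nonneg, Real.norm_of_nonneg toReal_nonneg]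
    gcongr
    · exact hg ω
    · exact hfg ω
  refine Measurable.ennreal_induction
    (motive := fun k => (∀ ω, k ω ≠ ∞) → ∀ hkh : MemLp (fun ω => (k ω).toReal * h ω) p μ,
      ENNReal.ofReal (φ (hkh.toLp _)) = ∫⁻ ω, k ω ∂ν) ?_ ?_ ?_ hk hktop hkh
  · intro c s hs hktop hkh
    rw [lintegral_indicator_const hs]
    by_cases hc : c = ∞
    · obtain rfl : s = ∅ := by
        refine Set.eq_empty_of_forall_notMem fun ω hω => hktop ω ?_
        rw [Set.indicator_of_mem hω, hc]
      have : hkh.toLp _ = 0 := by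
        rw [Lp.eq_zero_iff_ae_eq_zero]
        filter_upwards [hkh.coeFn_toLp] with ω h1
        rw [h1]
        simp
      rw [this, map_zero, ofReal_zero, measure_empty, mul_zero]
    · have : hkh.toLp _ = c.toReal • (hh.indicator hs).toLp (s.indicator h) := by
        rw [← MemLp.toLp_const_smul]
        refine MemLp.toLp_congr _ _ (ae_of_all _ fun ω => ?_)
        by_cases hω : ω ∈ s <;> simp [hω]
      rw [hν s hs, this, map_smul, smul_eq_mul, ENNReal.ofReal_mul toReal_nonneg, ENNReal.ofReal_toReal hc]
  · intro f g hfg hf hg ihf ihg hktop hkh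
    have hft : ∀ ω, f ω ≠ ∞ := fun ω => ne_top_of_le_ne_top (hktop ω) le_self_add
    have hgt : ∀ ω, g ω ≠ ∞ := fun ω => ne_top_of_le_ne_top (hktop ω) le_add_self
    have hfL := hle hf hktop (fun ω => le_self_add) hkh
    have hgL := hle hg hktop (fun ω => le_add_self) hkh
    have : hkh.toLp _ = hfL.toLp _ + hgL.toLp _ := by
      rw [← MemLp.toLp_add]
      refine MemLp.toLp_congr _ _ (ae_of_all _ fun ω => ?_)
      simp [ENNReal.toReal_add (hft ω) (hgt ω), add_mul]
    rw [this, map_add]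
    simp only [Pi.add_apply]
    rw [lintegral_add_left hf, ← ihf hft hfL, ← ihg hgt hgL,
      ENNReal.ofReal_add]
    · exact hφ _ (hfL.toLp_nonneg fun ω => mul_nonneg toReal_nonneg (h0 ω))
    · exact hφ _ (hgL.toLp_nonneg fun ω => mul_nonneg toReal_nonneg (h0 ω))
  · intro f hf hmono ih hktop hkh
    have hlesup : ∀ n ω, f n ω ≤ ⨆ n, f n ω := fun n ω => le_iSup (fun n => f n ω) n
    have hft : ∀ n ω, f n ω ≠ ∞ := fun n ω => ne_top_of_le_ne_top (hktop ω) (hlesup n ω)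
    have hfL : ∀ n, MemLp (fun ω => (f n ω).toReal * h ω) p μ := fun n =>
      hle (hf n) hktop (hlesup n) hkh
    have hfLω : ∀ n, ∀ᵐ ω ∂μ, (hfL n).toLp _ ω = (f n ω).toReal * h ω := fun n =>
      (hfL n).coeFn_toLp
    have hlim : Tendsto (fun n => (hfL n).toLp _) atTop (𝓝 (hkh.toLp _)) := by
      refine Lp.tendsto_of_nonneg_le hp (fun n => ?_) (fun n => ?_) ?_
      · filter_upwards [hfLω n] with ω h1
        rw [h1]
        exact mul_nonneg toReal_nonneg (h0 ω)
      · filter_upwards [hfLω n, hkh.coeFn_toLp] with ω h1 h2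
        rw [h1, h2]
        exact mul_le_mul_of_nonneg_right (ENNReal.toReal_mono (hktop ω) (hlesup n ω)) (h0 ω)
      · filter_upwards [ae_all_iff.2 hfLω, hkh.coeFn_toLp] with ω h1 h2
        simp_rw [h1, h2]
        refine Tendsto.mul_const _ ((ENNReal.tendsto_toReal (hktop ω)).comp ?_)
        exact tendsto_atTop_iSup fun m n hmn => hmono hmn ω
    have h1 := (ENNReal.continuous_ofReal.comp φ.continuous).tendsto _ |>.comp hlim
    refine tendsto_nhds_unique h1 ?_
    rw [lintegral_iSup hf hmono]
    refine Tendsto.congr (fun n => (ih n (hft n) (hfL n)).symm) ?_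
    exact tendsto_atTop_iSup fun m n hmn => lintegral_mono (hmono hmn)

/-- Riesz representation of positive functionals on `L^p`, `1 ≤ p < ∞`, over a `σ`-finite
measure. -/
lemma exists_density_of_positive [SigmaFinite μ] [Fact (1 ≤ p)] (hp : p ≠ ∞)
    {φ : Lp ℝ p μ →L[ℝ] ℝ} (hφ : ∀ f, 0 ≤ f → 0 ≤ φ f) :
    ∃ g : Ω → ℝ≥0∞, Measurable g ∧ ∀ f : Lp ℝ p μ, 0 ≤ f →
      ENNReal.ofReal (φ f) = ∫⁻ ω, ENNReal.ofReal (f ω) * g ω ∂μ := by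
  have hp0 : p ≠ 0 := (zero_lt_one.trans_le (Fact.out : 1 ≤ p)).ne'
  obtain ⟨h, hhm, hpos, hh⟩ := exists_pos_memLp_of_sigmaFinite μ hp0 hp
  have h0 := fun ω => (hpos ω).le
  obtain ⟨ν, hν⟩ := exists_measure_apply_eq_of_positive hp hφ h0 hh
  have : IsFiniteMeasure ν := ⟨by rw [hν _ MeasurableSet.univ]; exact ofReal_lt_top⟩
  have hac : ν ≪ μ := by
    refine Measure.AbsolutelyContinuous.mk fun s hs hμs => ?_
    have : (hh.indicator hs).toLp (s.indicator h) = 0 := by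
      rw [Lp.eq_zero_iff_ae_eq_zero]
      filter_upwards [(hh.indicator hs).coeFn_toLp, measure_eq_zero_iff_ae_notMem.1 hμs]
        with ω h1 h2
      simp [h1, h2]
    rw [hν s hs, this, map_zero, ofReal_zero]
  refine ⟨fun ω => ν.rnDeriv μ ω / ENNReal.ofReal (h ω), by fun_prop, fun f hf => ?_⟩
  obtain ⟨f', hf'm, hf'⟩ := (Lp.aestronglyMeasurable f).aemeasurable
  have hf0 : ∀ᵐ ω ∂μ, 0 ≤ f ω := (Lp.coeFn_nonneg f).2 hf
  set k : Ω → ℝ≥0∞ := fun ω => ENNReal.ofReal (f' ω / h ω)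
  have hkm : Measurable k := by fun_prop
  have hkf : ∀ᵐ ω ∂μ, (k ω).toReal * h ω = f ω := by
    filter_upwards [hf', hf0] with ω h1 h2
    rw [ENNReal.toReal_ofReal (div_nonneg (h1 ▸ h2) (h0 ω)), div_mul_cancel₀ _ (hpos ω).ne', h1]
  have hkh : MemLp (fun ω => (k ω).toReal * h ω) p μ := (memLp_congr_ae hkf).2 (Lp.memLp f)
  have hkL : hkh.toLp _ = f := Lp.ext (hkh.coeFn_toLp.trans hkf)
  rw [← hkL, ofReal_map_toLp_mul_eq_lintegral hp hφ h0 hhm hh hν hkm (fun _ => ofReal_ne_top) hkh,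
    hkL]
  conv_lhs => rw [← Measure.withDensity_rnDeriv_eq ν μ hac]
  rw [lintegral_withDensity_eq_lintegral_mul _ (Measure.measurable_rnDeriv ν μ) hkm]
  refine lintegral_congr_ae ?_
  filter_upwards [hf'] with ω h1
  simp only [Pi.mul_apply, k]
  rw [ENNReal.ofReal_div_of_pos (hpos ω), h1, div_eq_mul_inv, div_eq_mul_inv]
  ring

end PositiveFunctional

/-- Converse of the Hölder inequality: a weight that pairs with `L^p` with norm at most `K` lies in
the conjugate space, with norm at most `K`. -/
lemma lintegral_rpow_le_of_forall_lintegral_mul_le {Ω : Type*} [MeasurableSpace Ω]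
    {μ : Measure Ω} [SigmaFinite μ] {p p' : ℝ} (hpp : p.HolderConjugate p') {g : Ω → ℝ≥0∞}
    (hg : Measurable g) {K : ℝ≥0∞}
    (H : ∀ f : Ω → ℝ≥0∞, Measurable f → (∀ ω, f ω ≠ ∞) → ∫⁻ ω, f ω ^ p ∂μ ≠ ∞ →
      ∫⁻ ω, f ω * g ω ∂μ ≤ K * (∫⁻ ω, f ω ^ p ∂μ) ^ (1 / p)) :
    ∫⁻ ω, g ω ^ p' ∂μ ≤ K ^ p' := by
  have hp' : 0 < p' := hpp.symm.pos
  have hp'1 : 0 < p' - 1 := hpp.symm.sub_one_pos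
  have hp'p : (p' - 1) * p = p' := hpp.symm.sub_one_mul_conj
  set u : ℕ → Ω → ℝ≥0∞ := fun n => (spanningSets μ n).indicator fun ω => min (g ω) n with hu
  have hum : ∀ n, Measurable (u n) := fun n =>
    (hg.min measurable_const).indicator (measurableSet_spanningSets μ n)
  have hug : ∀ n ω, u n ω ≤ g ω := fun n ω =>
    (Set.indicator_le_self _ _ ω).trans (min_le_left _ _)
  have hun : ∀ n ω, u n ω ≤ (spanningSets μ n).indicator (fun _ => (n : ℝ≥0∞)) ω := fun n ω =>
    Set.indicator_le_indicator (min_le_right _ _)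
  have hut : ∀ n ω, u n ω ≠ ∞ := fun n ω =>
    ne_top_of_le_ne_top (natCast_ne_top n) ((hun n ω).trans (Set.indicator_le_self _ _ ω))
  have hmono : ∀ ω, Monotone fun n => u n ω := by
    intro ω m n hmn
    refine (Set.indicator_le_indicator_of_subset (monotone_spanningSets μ hmn)
      (fun _ => zero_le) ω).trans (Set.indicator_le_indicator (min_le_min le_rfl ?_))
    exact_mod_cast hmn
  have hlim : ∀ ω, Tendsto (fun n => u n ω) atTop (𝓝 (g ω)) := by
    intro ω
    have h1 : Tendsto (fun n : ℕ => min (g ω) (n : ℝ≥0∞)) atTop (𝓝 (g ω)) := by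
      simpa using (tendsto_const_nhds (x := g ω)).min ENNReal.tendsto_nat_nhds_top
    refine h1.congr' ?_
    filter_upwards [eventually_ge_atTop (spanningSetsIndex μ ω)] with n hn
    simp only [hu]
    rw [Set.indicator_of_mem (mem_spanningSets_of_index_le μ ω hn)]
  refine le_of_tendsto (lintegral_tendsto_of_tendsto_of_monotone
    (fun n => ((hum n).pow_const p').aemeasurable)
    (ae_of_all _ fun ω m n hmn => ENNReal.rpow_le_rpow (hmono ω hmn) hp'.le)
    (ae_of_all _ fun ω => ((ENNReal.continuous_rpow_const).tendsto _).comp (hlim ω)))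
    (Eventually.of_forall fun n => ?_)
  have hpow : ∀ ω, (u n ω ^ (p' - 1)) ^ p = u n ω ^ p' := fun ω => by
    rw [← ENNReal.rpow_mul, hp'p]
  have hfin : ∫⁻ ω, u n ω ^ p' ∂μ ≠ ∞ := by
    refine ne_top_of_le_ne_top ?_ (lintegral_mono (g := (spanningSets μ n).indicator
      fun _ => (n : ℝ≥0∞) ^ p') fun ω => ?_)
    · rw [lintegral_indicator_const (measurableSet_spanningSets μ n)]
      exact mul_ne_top (rpow_ne_top_of_nonneg hp'.le (natCast_ne_top n))
        (measure_spanningSets_lt_top μ n).ne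
    · refine (ENNReal.rpow_le_rpow (hun n ω) hp'.le).trans_eq ?_
      by_cases hω : ω ∈ spanningSets μ n <;> simp [hω, hp']
  have key := H (fun ω => u n ω ^ (p' - 1)) ((hum n).pow_const _)
    (fun ω => rpow_ne_top_of_nonneg hp'1.le (hut n ω)) (by simpa only [hpow] using hfin)
  simp only [hpow] at key
  have hle : ∫⁻ ω, u n ω ^ p' ∂μ ≤ ∫⁻ ω, u n ω ^ (p' - 1) * g ω ∂μ := by
    refine lintegral_mono fun ω => ?_
    calc u n ω ^ p' = u n ω ^ (p' - 1) * u n ω ^ (1 : ℝ) := by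
          rw [← ENNReal.rpow_add_of_nonneg _ _ hp'1.le zero_le_one, sub_add_cancel]
      _ ≤ u n ω ^ (p' - 1) * g ω := by
          rw [ENNReal.rpow_one]
          gcongr
          exact hug n ω
  replace key := hle.trans key
  set A := ∫⁻ ω, u n ω ^ p' ∂μ
  rcases eq_or_ne A 0 with hA | hA
  · simp [hA]
  rw [← ENNReal.rpow_inv_le_iff hp']
  have hA1 : A = A ^ p'⁻¹ * A ^ (1 / p) := by
    rw [← ENNReal.rpow_add _ _ hA hfin, one_div, hpp.symm.inv_add_inv_eq_one, ENNReal.rpow_one]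
  nth_rewrite 1 [hA1] at key
  exact (ENNReal.mul_le_mul_iff_left (by simp [hA, hfin]) (by simp [hA, hfin])).1 key

lemma memLp_abs_rpow_div {Ω : Type*} [MeasurableSpace Ω] {μ : Measure Ω} {q r : ℝ} (hr : 0 < r)
    (x : Lp ℝ (ENNReal.ofReal q) μ) : MemLp (fun ω => |x ω| ^ r) (ENNReal.ofReal (q / r)) μ := by
  have hx := (Lp.memLp x).norm_rpow_div (ENNReal.ofReal r)
  simpa [ENNReal.toReal_ofReal hr.le, ENNReal.ofReal_div_of_pos hr] using hx

lemma sum_norm_rpow_le_of_concave {Ω : Type*} [MeasurableSpace Ω] {μ : Measure Ω}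
    {q r : ℝ} (hq : 0 < q) (hr : 0 < r) [Fact (1 ≤ ENNReal.ofReal (q / r))]
    {F : Type*} [NormedAddCommGroup F] {T : Lp ℝ (ENNReal.ofReal q) μ → F} {C : ℝ} (hC : 0 ≤ C) {n : ℕ}
    {x : Fin n → Lp ℝ (ENNReal.ofReal q) μ}
    (hT : ENNReal.ofReal ((∑ k, ‖T (x k)‖ ^ r) ^ (1 / r)) ≤
        ENNReal.ofReal C *
          eLpNorm (fun ω => (∑ k, |x k ω| ^ r) ^ (1 / r)) (ENNReal.ofReal q) μ)
    {u : Lp ℝ (ENNReal.ofReal (q / r)) μ} (hu : ∀ᵐ ω ∂μ, ∑ k, |x k ω| ^ r ≤ u ω) :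
    ∑ k, ‖T (x k)‖ ^ r ≤ C ^ r * ‖u‖ := by
  have hr' : 0 < 1 / r := one_div_pos.2 hr
  have hS : 0 ≤ ∑ k, ‖T (x k)‖ ^ r := Finset.sum_nonneg fun k _ => by positivity
  have h1 : eLpNorm (fun ω => (∑ k, |x k ω| ^ r) ^ (1 / r)) (ENNReal.ofReal q) μ ≤
      ENNReal.ofReal (‖u‖ ^ (1 / r)) := by
    calc _ ≤ eLpNorm (fun ω => ‖u ω‖ ^ (1 / r)) (ENNReal.ofReal q) μ := by
          refine eLpNorm_mono_ae ?_
          filter_upwards [hu] with ω hω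
          have h0 : 0 ≤ ∑ k, |x k ω| ^ r := Finset.sum_nonneg fun k _ => by positivity
          rw [Real.norm_of_nonneg (by positivity), Real.norm_of_nonneg (by positivity)]
          gcongr
          exact hω.trans (le_abs_self _)
      _ = ENNReal.ofReal (‖u‖ ^ (1 / r)) := by
          rw [eLpNorm_norm_rpow _ hr', ← ENNReal.ofReal_mul hq.le, mul_one_div, ← Lp.enorm_def,
            ← ofReal_norm, ENNReal.ofReal_rpow_of_nonneg (norm_nonneg _) hr'.le]
  have h2 := hT.trans (mul_le_mul_right h1 _)
  rw [← ENNReal.ofReal_mul hC, ENNReal.ofReal_le_ofReal_iff (by positivity)] at h2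
  have h3 := Real.rpow_le_rpow (by positivity) h2 hr.le
  rwa [Real.mul_rpow hC (by positivity), ← Real.rpow_mul hS, ← Real.rpow_mul (norm_nonneg _),
    one_div_mul_cancel hr.ne', Real.rpow_one, Real.rpow_one] at h3

/-- The Hahn–Banach step: an `r`-concave homogeneous operator on `L^q` is dominated by a positive
functional on `L^{q/r}` of norm at most `C ^ r`. -/
lemma exists_positive_functional_of_concave {Ω : Type*} [MeasurableSpace Ω] {μ : Measure Ω}
    {q r : ℝ} (hq : 0 < q) (hr : 0 < r) [Fact (1 ≤ ENNReal.ofReal (q / r))]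
    {F : Type*} [NormedAddCommGroup F] [NormedSpace ℝ F]
    {T : Lp ℝ (ENNReal.ofReal q) μ → F}
    (hThom : ∀ (c : ℝ), 0 ≤ c → ∀ x, T (c • x) = c • T x) {C : ℝ} (hC : 0 ≤ C)
    (hTconc : ∀ (n : ℕ) (x : Fin n → Lp ℝ (ENNReal.ofReal q) μ),
      ENNReal.ofReal ((∑ k, ‖T (x k)‖ ^ r) ^ (1 / r)) ≤
        ENNReal.ofReal C *
          eLpNorm (fun ω => (∑ k, |x k ω| ^ r) ^ (1 / r)) (ENNReal.ofReal q) μ) :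
    ∃ φ : Lp ℝ (ENNReal.ofReal (q / r)) μ →L[ℝ] ℝ, (∀ f, φ f ≤ C ^ r * ‖f‖) ∧
      (∀ f, 0 ≤ f → 0 ≤ φ f) ∧ ∀ x, ‖T x‖ ^ r ≤ φ ((memLp_abs_rpow_div hr x).toLp _) := by
  set D : Set (Lp ℝ (ENNReal.ofReal (q / r)) μ × ℝ) :=
    {d | ∃ (n : ℕ) (x : Fin n → Lp ℝ (ENNReal.ofReal q) μ),
      (∀ᵐ ω ∂μ, ∑ k, |x k ω| ^ r ≤ d.1 ω) ∧ d.2 = ∑ k, ‖T (x k)‖ ^ r}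
  have hpos : ∀ f : Lp ℝ (ENNReal.ofReal (q / r)) μ, 0 ≤ f → (f, (0 : ℝ)) ∈ D := fun f hf =>
    ⟨0, Fin.elim0, by
      filter_upwards [(Lp.coeFn_nonneg f).2 hf] with ω hω using by simpa using hω, by simp⟩
  have hadd : ∀ d ∈ D, ∀ e ∈ D, d + e ∈ D := by
    rintro ⟨u, s⟩ ⟨n, x, hx, hs⟩ ⟨v, t⟩ ⟨m, y, hy, ht⟩
    refine ⟨n + m, Fin.append x y, ?_, ?_⟩
    · filter_upwards [hx, hy, Lp.coeFn_add u v] with ω h1 h2 h3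
      simp only [Prod.mk_add_mk, h3, Pi.add_apply, Fin.sum_univ_add, Fin.append_left,
        Fin.append_right]
      exact add_le_add h1 h2
    · simp only at hs ht
      simp [Fin.sum_univ_add, hs, ht]
  have hsmul : ∀ c : ℝ, 0 < c → ∀ d ∈ D, c • d ∈ D := by
    rintro c hc ⟨u, s⟩ ⟨n, x, hx, hs⟩
    have hc' : 0 ≤ c ^ (1 / r) := by positivity
    have hcr : (c ^ (1 / r)) ^ r = c := by
      rw [← Real.rpow_mul hc.le, one_div_mul_cancel hr.ne', Real.rpow_one]
    refine ⟨n, fun k => c ^ (1 / r) • x k, ?_, ?_⟩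
    · filter_upwards [hx, Lp.coeFn_smul c u,
        ae_all_iff.2 fun k => Lp.coeFn_smul (c ^ (1 / r)) (x k)] with ω h1 h2 h3
      simp only [Prod.smul_mk, h2, h3, Pi.smul_apply, smul_eq_mul, abs_mul, abs_of_nonneg hc',
        Real.mul_rpow hc' (abs_nonneg _), hcr, ← Finset.mul_sum]
      exact mul_le_mul_of_nonneg_left h1 hc.le
    · simp only at hs
      simp only [Prod.smul_mk, hThom _ hc', norm_smul, Real.norm_of_nonneg hc',
        Real.mul_rpow hc' (norm_nonneg _), hcr, ← Finset.mul_sum, hs, smul_eq_mul]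
  have hle : ∀ d ∈ D, d.2 ≤ C ^ r * ‖d.1‖ := by
    rintro ⟨u, s⟩ ⟨n, x, hx, hs⟩
    simp only at hs
    rw [hs]
    exact sum_norm_rpow_le_of_concave hq hr hC (hTconc n x) hx
  obtain ⟨φ, hφK, hφD⟩ := exists_continuousLinearMap_ge_of_cone D (C ^ r) (by positivity)
    (hpos 0 le_rfl) hadd hsmul hle
  refine ⟨φ, hφK, fun f hf => hφD _ (hpos f hf), fun x =>
    hφD ((memLp_abs_rpow_div hr x).toLp _, ‖T x‖ ^ r) ⟨1, fun _ => x, ?_, by simp⟩⟩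
  filter_upwards [(memLp_abs_rpow_div hr x).coeFn_toLp] with ω hω
  rw [hω]
  simp

/-- A density representing a functional on `L^p` of norm at most `K` has norm at most `K` in the
conjugate space. -/
lemma lintegral_density_rpow_le {Ω : Type*} [MeasurableSpace Ω] {μ : Measure Ω} [SigmaFinite μ]
    {p p' : ℝ} [Fact (1 ≤ ENNReal.ofReal p)] (hpp : p.HolderConjugate p') {K : ℝ} (hK : 0 ≤ K)
    {φ : Lp ℝ (ENNReal.ofReal p) μ → ℝ} (hφ : ∀ f, φ f ≤ K * ‖f‖)
    {g : Ω → ℝ≥0∞} (hg : Measurable g)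
    (hφg : ∀ f : Lp ℝ (ENNReal.ofReal p) μ, 0 ≤ f →
      ENNReal.ofReal (φ f) = ∫⁻ ω, ENNReal.ofReal (f ω) * g ω ∂μ) :
    ∫⁻ ω, g ω ^ p' ∂μ ≤ ENNReal.ofReal K ^ p' := by
  have hp0 : ENNReal.ofReal p ≠ 0 := (ENNReal.ofReal_pos.2 hpp.pos).ne'
  refine lintegral_rpow_le_of_forall_lintegral_mul_le hpp hg fun f hf hft hfp => ?_
  have hnorm : eLpNorm (fun ω => (f ω).toReal) (ENNReal.ofReal p) μ =
      (∫⁻ ω, f ω ^ p ∂μ) ^ (1 / p) := by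
    rw [eLpNorm_eq_lintegral_rpow_enorm_toReal hp0 ofReal_ne_top,
      ENNReal.toReal_ofReal hpp.nonneg]
    congr 1
    exact lintegral_congr fun ω => by rw [← ofReal_norm, Real.norm_of_nonneg toReal_nonneg,
      ENNReal.ofReal_toReal (hft ω)]
  have hfL : MemLp (fun ω => (f ω).toReal) (ENNReal.ofReal p) μ := by
    refine ⟨hf.ennreal_toReal.aestronglyMeasurable, ?_⟩
    rw [hnorm]
    exact (rpow_ne_top_of_nonneg (one_div_pos.2 hpp.pos).le hfp).lt_top
  have h1 : ∫⁻ ω, f ω * g ω ∂μ = ENNReal.ofReal (φ (hfL.toLp _)) := by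
    rw [hφg _ (hfL.toLp_nonneg fun ω => toReal_nonneg)]
    refine lintegral_congr_ae ?_
    filter_upwards [hfL.coeFn_toLp] with ω hω
    rw [hω, ENNReal.ofReal_toReal (hft ω)]
  rw [h1]
  refine (ENNReal.ofReal_le_ofReal (hφ _)).trans_eq ?_
  rw [ENNReal.ofReal_mul hK, ofReal_norm, Lp.enorm_toLp, hnorm]

/-- **Corollary 5 (first part)** for `X = L^q(μ)`: an `r`-concave homogeneous operator
`T : L^q(μ) → F` (`0 < r < q`, `1 ≤ q`) with constant `C` admits a weight `w ≥ 0` with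
`‖w‖_{L^{q/(q-r)}(μ)} ≤ 1` such that `‖Tx‖_F ≤ C (∫ |x|^r w dμ)^{1/r}` for all `x`. -/
theorem maurey_rosenthal_homogeneous_on_Lq
    {Ω : Type*} [MeasurableSpace Ω] (μ : Measure Ω) [SigmaFinite μ]
    (q r : ℝ) (hq : 1 ≤ q) (hr : 0 < r) (hrq : r < q)
    {F : Type*} [NormedAddCommGroup F] [NormedSpace ℝ F]
    (T : Lp ℝ (ENNReal.ofReal q) μ → F)
    (hThom : ∀ (c : ℝ), 0 ≤ c → ∀ x, T (c • x) = c • T x)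
    (C : ℝ) (hC : 0 ≤ C)
    (hTconc : ∀ (n : ℕ) (x : Fin n → Lp ℝ (ENNReal.ofReal q) μ),
      ENNReal.ofReal ((∑ k, ‖T (x k)‖ ^ r) ^ (1 / r)) ≤
        ENNReal.ofReal C *
          eLpNorm (fun ω => (∑ k, |x k ω| ^ r) ^ (1 / r)) (ENNReal.ofReal q) μ) :
    ∃ w : Ω → ℝ, Measurable w ∧ (∀ ω, 0 ≤ w ω) ∧
      eLpNorm w (ENNReal.ofReal (q / (q - r))) μ ≤ 1 ∧
      ∀ x : Lp ℝ (ENNReal.ofReal q) μ,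
        ENNReal.ofReal ‖T x‖ ≤
          ENNReal.ofReal C *
            (∫⁻ ω, ENNReal.ofReal (|x ω| ^ r * w ω) ∂μ) ^ (1 / r) := by
  have hq0 : 0 < q := hr.trans hrq
  have hqr : 0 < q - r := sub_pos.2 hrq
  have hpp : (q / r).HolderConjugate (q / (q - r)) := by
    rw [Real.holderConjugate_iff]
    refine ⟨(one_lt_div hr).2 hrq, ?_⟩
    field_simp
    ring
  rcases hC.eq_or_lt with rfl | hCpos
  · refine ⟨0, measurable_const, fun _ => le_rfl, by simp, fun x => ?_⟩
    have hx := hTconc 1 fun _ => x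
    simpa [← Real.rpow_mul (norm_nonneg (T x)), mul_inv_cancel₀ hr.ne'] using hx
  have : Fact (1 ≤ ENNReal.ofReal (q / r)) := ⟨by
    simpa using ENNReal.ofReal_le_ofReal hpp.lt.le⟩
  obtain ⟨φ, hφK, hφpos, hφT⟩ := exists_positive_functional_of_concave hq0 hr hThom hC hTconc
  obtain ⟨g, hgm, hg⟩ := exists_density_of_positive ofReal_ne_top hφpos
  set K := C ^ r with hKdef
  have hK : 0 < K := Real.rpow_pos_of_pos hCpos r
  have hK0 : ENNReal.ofReal K ≠ 0 := (ENNReal.ofReal_pos.2 hK).ne'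
  set p' := q / (q - r)
  have hp' : 0 < p' := hpp.symm.pos
  have hgK : ∫⁻ ω, g ω ^ p' ∂μ ≤ ENNReal.ofReal K ^ p' :=
    lintegral_density_rpow_le hpp hK.le hφK hgm hg
  have hgfin : ∀ᵐ ω ∂μ, g ω ≠ ∞ := by
    filter_upwards [ae_lt_top (hgm.pow_const p')
      (ne_top_of_le_ne_top (rpow_ne_top_of_nonneg hp'.le ofReal_ne_top) hgK)] with ω hω
    rintro h
    simp [h, hp'] at hω
  refine ⟨fun ω => (g ω).toReal / K, by fun_prop, fun ω => by positivity, ?_, fun x => ?_⟩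
  · rw [eLpNorm_eq_lintegral_rpow_enorm_toReal (ENNReal.ofReal_pos.2 hp').ne' ofReal_ne_top,
      ENNReal.toReal_ofReal hp'.le]
    refine ENNReal.rpow_le_one ?_ (one_div_pos.2 hp').le
    calc ∫⁻ ω, ‖(g ω).toReal / K‖ₑ ^ p' ∂μ
        ≤ ∫⁻ ω, g ω ^ p' * ((ENNReal.ofReal K)⁻¹) ^ p' ∂μ := by
          refine lintegral_mono fun ω => ?_
          rw [← ENNReal.mul_rpow_of_nonneg _ _ hp'.le, ← div_eq_mul_inv, ← ofReal_norm,
            Real.norm_of_nonneg (by positivity), ENNReal.ofReal_div_of_pos hK]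
          gcongr
          exact ENNReal.ofReal_toReal_le
      _ = (∫⁻ ω, g ω ^ p' ∂μ) * ((ENNReal.ofReal K)⁻¹) ^ p' :=
          lintegral_mul_const _ (hgm.pow_const p')
      _ ≤ ENNReal.ofReal K ^ p' * ((ENNReal.ofReal K)⁻¹) ^ p' := by gcongr
      _ = 1 := by
          rw [← ENNReal.mul_rpow_of_nonneg _ _ hp'.le, ENNReal.mul_inv_cancel hK0 ofReal_ne_top,
            ENNReal.one_rpow]
  · have hxL := memLp_abs_rpow_div hr x
    have h1 : ENNReal.ofReal (‖T x‖ ^ r) ≤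
        ENNReal.ofReal K * ∫⁻ ω, ENNReal.ofReal (|x ω| ^ r * ((g ω).toReal / K)) ∂μ := by
      refine (ENNReal.ofReal_le_ofReal (hφT x)).trans_eq ?_
      rw [hg _ (hxL.toLp_nonneg fun ω => by positivity),
        ← lintegral_const_mul' _ _ ofReal_ne_top]
      refine lintegral_congr_ae ?_
      filter_upwards [hxL.coeFn_toLp, hgfin] with ω h2 h3
      rw [h2, ← ENNReal.ofReal_mul hK.le, mul_left_comm, mul_div_cancel₀ _ hK.ne',
        ENNReal.ofReal_mul (by positivity), ENNReal.ofReal_toReal h3]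
    have h2 := ENNReal.rpow_le_rpow h1 (one_div_pos.2 hr).le
    rwa [ENNReal.mul_rpow_of_nonneg _ _ (one_div_pos.2 hr).le,
      ENNReal.ofReal_rpow_of_nonneg (by positivity) (by positivity),
      ENNReal.ofReal_rpow_of_nonneg (by positivity) (by positivity), hKdef,
      ← Real.rpow_mul (norm_nonneg _), ← Real.rpow_mul hC, mul_one_div_cancel hr.ne',
      Real.rpow_one, Real.rpow_one] at h2
end
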